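/- arXiv:1501.05005 — 5 statements merged into one kernel-verified Lean document; each statement's English description precedes it below -/
import Mathlib

section
/- Let (X1,Y1) and (X2,Y2) be BDEs on a common probability space such that the pair (X1,Y1) is independent of the pair (X2,Y2), and let (U1,Ȳ) and (U2,(U1,Ȳ)) be the output BDEs of the polar transform. Then V(U1|Ȳ) + V(U2|(U1,Ȳ)) ≤ V(X1|Y1) + V(X2|Y2), with equality if and only if V(X1|Y1) = 0 or V(X2|Y2) = 0. -/
open MeasureTheory ProbabilityTheory

/-- The conditional entropy random variable `h(X|Y)` of a binary data element `(X,Y)`: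
`h(X|Y)(ω) = - log₂ κ(Y ω)({X ω})` where `κ = condDistrib X Y μ` is a regular conditional
distribution of `X` given `Y`. -/
noncomputable def entRV {Ω β : Type*} [MeasurableSpace Ω] [MeasurableSpace β]
    (X : Ω → ZMod 2) (Y : Ω → β) (μ : Measure Ω) [IsFiniteMeasure μ] : Ω → ℝ :=
  fun ω => - Real.logb 2 ((condDistrib X Y μ (Y ω)) {X ω}).toReal

/-- The varentropy `V(X|Y)` of a binary data element `(X,Y)`. -/
noncomputable def varent {Ω β : Type*} [MeasurableSpace Ω] [MeasurableSpace β]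
    (X : Ω → ZMod 2) (Y : Ω → β) (μ : Measure Ω) [IsFiniteMeasure μ] : ℝ :=
  variance (entRV X Y μ) μ

namespace PolarAux

noncomputable def sg (x : ZMod 2) : ℝ := if x = 0 then 1 else -1
/-- probability of the bit `x` when the bias is `a` -/
noncomputable def rr (a : ℝ) (x : ZMod 2) : ℝ := (1 + sg x * a) / 2
noncomputable def LL (a : ℝ) (x : ZMod 2) : ℝ := - Real.log (rr a x)
noncomputable def ph (a : ℝ) : ℝ := Real.binEntropy ((1 + a) / 2)
noncomputable def gG (a b : ℝ) : ℝ := ph a + ph b - ph (a * b)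
noncomputable def cC (a b : ℝ) : ℝ :=
  (∑ x : ZMod 2 × ZMod 2, rr a x.1 * rr b x.2 * (LL (a * b) (x.1 + x.2) *
    (LL a x.1 + LL b x.2 - LL (a * b) (x.1 + x.2)))) - ph (a * b) * gG a b

lemma sg_zero : sg 0 = 1 := by simp [sg]
lemma sg_one : sg 1 = -1 := by simp [sg]

lemma sum2 (F : ZMod 2 → ℝ) : ∑ x : ZMod 2, F x = F 0 + F 1 := Fin.sum_univ_two F

lemma sum4 (F : ZMod 2 × ZMod 2 → ℝ) :
    ∑ x : ZMod 2 × ZMod 2, F x = F (0,0) + F (0,1) + (F (1,0) + F (1,1)) := by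
  rw [Fintype.sum_prod_type, sum2, sum2, sum2]

lemma one_add_one' : (1 : ZMod 2) + 1 = 0 := by decide

lemma rr_zero (a : ℝ) : rr a 0 = (1 + a) / 2 := by simp [rr, sg_zero]
lemma rr_one (a : ℝ) : rr a 1 = (1 - a) / 2 := by simp [rr, sg_one]; ring

lemma ph_eq (a : ℝ) : ph a = rr a 0 * LL a 0 + rr a 1 * LL a 1 := by
  have : 1 - (1 + a) / 2 = (1 - a) / 2 := by ring
  simp only [ph, Real.binEntropy, LL, rr_zero, rr_one, Real.log_inv, this]

lemma ph_neg (a : ℝ) : ph (-a) = ph a := by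
  unfold ph
  rw [← Real.binEntropy_one_sub]; congr 1; ring

lemma ph_abs (a : ℝ) : ph |a| = ph a := by
  rcases abs_choice a with h | h <;> rw [h]; exact ph_neg a

lemma ph_anti : StrictAntiOn ph (Set.Icc 0 1) := by
  intro a ha b hb hab
  apply Real.binEntropy_strictAntiOn
  · constructor <;> [linarith [ha.1]; linarith [ha.2]]
  · constructor <;> [linarith [hb.1]; linarith [hb.2]]
  · linarith

lemma ph_concave : ConcaveOn ℝ (Set.Icc (-1) 1) ph := by
  refine ⟨convex_Icc _ _, ?_⟩
  intro x hx y hy a b ha hb hab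
  have := Real.strictConcave_binEntropy.concaveOn.2 (x := (1 + x) / 2) (y := (1 + y) / 2)
    (by constructor <;> [linarith [hx.1]; linarith [hx.2]])
    (by constructor <;> [linarith [hy.1]; linarith [hy.2]]) ha hb hab
  refine this.trans_eq ?_
  change _ = Real.binEntropy _
  simp only [smul_eq_mul]
  congr 1
  linear_combination (1/2) * hab

lemma ph_zero : ph 0 = Real.log 2 := by
  unfold ph; rw [← Real.binEntropy_two_inv]; norm_num
lemma ph_one : ph 1 = 0 := by unfold ph; norm_num
lemma ph_neg_one : ph (-1) = 0 := by rw [ph_neg, ph_one]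

lemma ph_nonneg {a : ℝ} (h : |a| ≤ 1) : 0 ≤ ph a := by
  rw [abs_le] at h
  exact Real.binEntropy_nonneg (by linarith) (by linarith)

lemma ph_le (a : ℝ) : ph a ≤ Real.log 2 := Real.binEntropy_le_log_two

lemma ph_eq_zero {a : ℝ} : ph a = 0 ↔ a = 1 ∨ a = -1 := by
  unfold ph
  rw [Real.binEntropy_eq_zero]
  constructor
  · rintro (h | h)
    · right; linarith
    · left; linarith
  · rintro (h | h) <;> subst h <;> norm_num

lemma ph_eq_log {a : ℝ} : ph a = Real.log 2 ↔ a = 0 := by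
  unfold ph
  rw [Real.binEntropy_eq_log_two]
  constructor <;> intro h <;> linarith

lemma log_mul_div {x y z : ℝ} (hx : 0 < x) (hy : 0 < y) (hz : 0 < z) :
    Real.log (x * y / z) = Real.log x + Real.log y - Real.log z := by
  rw [Real.log_div (by positivity) hz.ne', Real.log_mul hx.ne' hy.ne']

lemma ph_conc {x y a b : ℝ} (hx : x ∈ Set.Icc (-1 : ℝ) 1) (hy : y ∈ Set.Icc (-1 : ℝ) 1)
    (ha : 0 ≤ a) (hb : 0 ≤ b) (hab : a + b = 1) : a * ph x + b * ph y ≤ ph (a * x + b * y) :=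
  ph_concave.2 hx hy ha hb hab

lemma cC_formula {a b : ℝ} (ha : |a| < 1) (hb : |b| < 1) :
    cC a b = (1 + a * b) / 2 * ((1 - a * b) / 2) *
      (Real.log ((1 - a * b) / 2) - Real.log ((1 + a * b) / 2)) *
      (ph ((a + b) / (1 + a * b)) - ph ((a - b) / (1 - a * b))) := by
  have hab : |a * b| < 1 := by
    rw [abs_mul]; nlinarith [abs_nonneg a, abs_nonneg b]
  rw [abs_lt] at ha hb hab
  obtain ⟨ha1, ha2⟩ := ha
  obtain ⟨hb1, hb2⟩ := hb
  obtain ⟨hc1, hc2⟩ := hab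
  have h1 : 0 < 1 + a := by linarith
  have h2 : 0 < 1 - a := by linarith
  have h3 : 0 < 1 + b := by linarith
  have h4 : 0 < 1 - b := by linarith
  have h5 : 0 < 1 + a * b := by linarith
  have h6 : 0 < 1 - a * b := by linarith
  have e0 : ph ((a + b) / (1 + a * b)) =
      (1 + a) / 2 * ((1 + b) / 2) / ((1 + a * b) / 2) *
        (Real.log ((1 + a * b) / 2) - Real.log ((1 + a) / 2) - Real.log ((1 + b) / 2)) +
      (1 - a) / 2 * ((1 - b) / 2) / ((1 + a * b) / 2) *
        (Real.log ((1 + a * b) / 2) - Real.log ((1 - a) / 2) - Real.log ((1 - b) / 2)) := by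
    have q0 : rr ((a + b) / (1 + a * b)) 0 = (1 + a) / 2 * ((1 + b) / 2) / ((1 + a * b) / 2) := by
      rw [rr_zero]; field_simp; ring
    have q1 : rr ((a + b) / (1 + a * b)) 1 = (1 - a) / 2 * ((1 - b) / 2) / ((1 + a * b) / 2) := by
      rw [rr_one]; field_simp; ring
    rw [ph_eq, LL, LL, q0, q1, log_mul_div (by positivity) (by positivity) (by positivity),
      log_mul_div (by positivity) (by positivity) (by positivity)]
    ring
  have e1 : ph ((a - b) / (1 - a * b)) =
      (1 + a) / 2 * ((1 - b) / 2) / ((1 - a * b) / 2) *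
        (Real.log ((1 - a * b) / 2) - Real.log ((1 + a) / 2) - Real.log ((1 - b) / 2)) +
      (1 - a) / 2 * ((1 + b) / 2) / ((1 - a * b) / 2) *
        (Real.log ((1 - a * b) / 2) - Real.log ((1 - a) / 2) - Real.log ((1 + b) / 2)) := by
    have q0 : rr ((a - b) / (1 - a * b)) 0 = (1 + a) / 2 * ((1 - b) / 2) / ((1 - a * b) / 2) := by
      rw [rr_zero]; field_simp; ring
    have q1 : rr ((a - b) / (1 - a * b)) 1 = (1 - a) / 2 * ((1 + b) / 2) / ((1 - a * b) / 2) := by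
      rw [rr_one]; field_simp; ring
    rw [ph_eq, LL, LL, q0, q1, log_mul_div (by positivity) (by positivity) (by positivity),
      log_mul_div (by positivity) (by positivity) (by positivity)]
    ring
  rw [e0, e1, cC, sum4, gG]
  simp only [ph_eq, LL, rr_zero, rr_one, one_add_one', add_zero, zero_add]
  generalize Real.log ((1 + a) / 2) = A0
  generalize Real.log ((1 - a) / 2) = A1
  generalize Real.log ((1 + b) / 2) = B0
  generalize Real.log ((1 - b) / 2) = B1
  generalize Real.log ((1 + a * b) / 2) = C0
  generalize Real.log ((1 - a * b) / 2) = C1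
  field_simp
  ring

lemma ph_lt_of_abs {u v : ℝ} (hv : |v| ≤ 1) (h : |u| < |v|) : ph v < ph u := by
  rw [← ph_abs u, ← ph_abs v]
  exact ph_anti ⟨abs_nonneg _, h.le.trans hv⟩ ⟨abs_nonneg _, hv⟩ h

lemma cC_pos_aux {a b : ℝ} (ha : |a| < 1) (hb : |b| < 1) (hab : 0 < a * b) : 0 < cC a b := by
  rw [cC_formula ha hb]
  have hab1 : |a * b| < 1 := by
    rw [abs_mul]; nlinarith [abs_nonneg a, abs_nonneg b]
  have ha' : a ^ 2 < 1 := (sq_lt_one_iff_abs_lt_one a).2 ha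
  have hb' : b ^ 2 < 1 := (sq_lt_one_iff_abs_lt_one b).2 hb
  rw [abs_lt] at hab1
  have h5 : 0 < 1 + a * b := by linarith
  have h6 : 0 < 1 - a * b := by linarith
  have l : Real.log ((1 - a * b) / 2) < Real.log ((1 + a * b) / 2) :=
    Real.log_lt_log (by positivity) (by linarith)
  have key : ph ((a + b) / (1 + a * b)) < ph ((a - b) / (1 - a * b)) := by
    apply ph_lt_of_abs
    · rw [← sq_le_one_iff_abs_le_one, div_pow, div_le_one (by positivity)]
      nlinarith
    · rw [← sq_lt_sq, div_pow, div_pow, div_lt_div_iff₀ (by positivity) (by positivity)]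
      have : 0 < 4 * (a * b) * ((1 - a ^ 2) * (1 - b ^ 2)) := by
        have : 0 < 1 - a ^ 2 := by linarith
        have : 0 < 1 - b ^ 2 := by linarith
        positivity
      nlinarith
  have : 0 < (Real.log ((1 + a * b) / 2) - Real.log ((1 - a * b) / 2)) *
     (ph ((a - b) / (1 - a * b)) - ph ((a + b) / (1 + a * b))) :=
    mul_pos (by linarith) (by linarith)
  have h7 : 0 < (1 + a * b) / 2 * ((1 - a * b) / 2) := by positivity
  nlinarith [mul_pos h7 this]

lemma cC_neg (a b : ℝ) : cC a (-b) = cC a b := by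
  rw [cC, cC, sum4, sum4, gG, gG]
  simp only [mul_neg, ph_neg, LL, rr_zero, rr_one, one_add_one', add_zero, zero_add, sub_neg_eq_add,
    ← sub_eq_add_neg]
  ring

lemma cC_pos {a b : ℝ} (ha : |a| < 1) (hb : |b| < 1) (ha0 : a ≠ 0) (hb0 : b ≠ 0) : 0 < cC a b := by
  rcases lt_or_gt_of_ne (mul_ne_zero ha0 hb0) with h | h
  · rw [← cC_neg]
    exact cC_pos_aux ha (by rwa [abs_neg]) (by linarith)
  · exact cC_pos_aux ha hb h

lemma cC_comm (a b : ℝ) : cC a b = cC b a := by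
  rw [cC, cC, sum4, sum4, gG, gG, mul_comm b a]
  simp only [one_add_one', add_zero, zero_add]
  ring

lemma cC_zero_left (b : ℝ) : cC 0 b = 0 := by
  rw [cC, sum4, gG]
  simp only [zero_mul, ph_eq, LL, rr_zero, rr_one, one_add_one', add_zero, zero_add, sub_zero]
  ring

lemma cC_one_left (b : ℝ) : cC 1 b = 0 := by
  rw [cC, sum4, gG]
  simp only [one_mul, ph_eq, LL, rr_zero, rr_one, one_add_one', add_zero, zero_add, sub_self]
  norm_num

lemma cC_neg_one_left (b : ℝ) : cC (-1) b = 0 := by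
  rw [cC_comm, cC_neg, cC_comm, cC_one_left]

def Sing (a : ℝ) : Prop := a = 0 ∨ a = 1 ∨ a = -1

lemma cC_sing {a : ℝ} (h : Sing a) (b : ℝ) : cC a b = 0 := by
  rcases h with h | h | h <;> subst h
  exacts [cC_zero_left b, cC_one_left b, cC_neg_one_left b]

lemma abs_lt_one_of_not_sing {a : ℝ} (ha : |a| ≤ 1) (h : ¬ Sing a) : |a| < 1 ∧ a ≠ 0 := by
  unfold Sing at h
  push Not at h
  refine ⟨lt_of_le_of_ne ha ?_, h.1⟩
  intro h'
  rcases (abs_eq zero_le_one).1 h' with h'' | h''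
  exacts [h.2.1 h'', h.2.2 h'']

lemma cC_nonneg {a b : ℝ} (ha : |a| ≤ 1) (hb : |b| ≤ 1) : 0 ≤ cC a b := by
  by_cases h : Sing a
  · rw [cC_sing h]
  by_cases h' : Sing b
  · rw [cC_comm, cC_sing h']
  obtain ⟨h1, h2⟩ := abs_lt_one_of_not_sing ha h
  obtain ⟨h3, h4⟩ := abs_lt_one_of_not_sing hb h'
  exact (cC_pos h1 h3 h2 h4).le

lemma cC_eq_zero {a b : ℝ} (ha : |a| ≤ 1) (hb : |b| ≤ 1) (hc : cC a b = 0) : Sing a ∨ Sing b := by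
  by_contra h
  push Not at h
  obtain ⟨h1, h2⟩ := abs_lt_one_of_not_sing ha h.1
  obtain ⟨h3, h4⟩ := abs_lt_one_of_not_sing hb h.2
  exact (cC_pos h1 h3 h2 h4).ne' hc

lemma f_anti {u u' v : ℝ} (h : |u| ≤ |u'|) (hu' : |u'| ≤ 1) (hv : |v| ≤ 1) :
    ph (u' * v) ≤ ph (u * v) := by
  rw [← ph_abs (u' * v), ← ph_abs (u * v), abs_mul, abs_mul]
  have := abs_nonneg u
  have := abs_nonneg v
  apply ph_anti.antitoneOn
  · constructor <;> [positivity; nlinarith]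
  · constructor <;> [positivity; nlinarith]
  · gcongr

lemma ph_incr {u u' v : ℝ} (h0 : 0 ≤ u) (h : u ≤ u') (hu' : u' ≤ 1) (hv0 : 0 ≤ v) (hv : v ≤ 1) :
    ph u' - ph u ≤ ph (u' * v) - ph (u * v) := by
  -- concavity on the four points
  rcases h.eq_or_lt with rfl | h
  · simp
  have hA : ph (u - u * v + u' * v) + ph u ≤ ph (u' * v) + ph u + (ph u - ph (u * v)) := by
    rcases hv.eq_or_lt with rfl | hv
    · simp
    rcases h0.eq_or_lt with rfl | h0
    · simp
    -- shift
    set d := (u' - u) * v with hd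
    set w := u - u * v with hw
    have hwpos : 0 < w := by rw [hw]; nlinarith
    have hdn : 0 ≤ d := by rw [hd]; apply mul_nonneg <;> linarith
    have hm : u - u * v + u' * v = u * v + (w + d) := by rw [hw, hd]; ring
    have hm2 : u' * v = u * v + d := by rw [hd]; ring
    have hm3 : u = u * v + w := by rw [hw]; ring
    have huv : 0 ≤ u * v := by positivity
    have htop : u * v + (w + d) ≤ 1 := by rw [← hm]; nlinarith
    have c1 := ph_conc (x := u * v) (y := u * v + (w + d))
      ⟨by linarith, by linarith⟩ ⟨by linarith, htop⟩
      (a := w / (w + d)) (b := d / (w + d)) (by positivity) (by positivity)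
      (by field_simp)
    have c2 := ph_conc (x := u * v) (y := u * v + (w + d))
      ⟨by linarith, by linarith⟩ ⟨by linarith, htop⟩
      (a := d / (w + d)) (b := w / (w + d)) (by positivity) (by positivity)
      (by field_simp; ring)
    have r1 : (w / (w + d)) * (u * v) + (d / (w + d)) * (u * v + (w + d)) = u' * v := by
      rw [hm2]; field_simp; ring
    have r2 : (d / (w + d)) * (u * v) + (w / (w + d)) * (u * v + (w + d)) = u := by
      conv_rhs => rw [hm3]
      field_simp; ring
    rw [r1] at c1
    rw [r2] at c2
    rw [hm]
    have hs : w / (w + d) + d / (w + d) = 1 := by field_simp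
    generalize w / (w + d) = α at *
    have : d / (w + d) = 1 - α := by linarith
    rw [this] at c1 c2
    nlinarith
  have hB : ph u' ≤ ph (u - u * v + u' * v) := by
    apply ph_anti.antitoneOn
    · constructor <;> nlinarith
    · constructor <;> linarith
    · nlinarith
  linarith

lemma g_anti {u u' v : ℝ} (h : |u| ≤ |u'|) (hu' : |u'| ≤ 1) (hv : |v| ≤ 1) :
    gG u' v ≤ gG u v := by
  have := ph_incr (abs_nonneg u) h hu' (abs_nonneg v) hv
  rw [← abs_mul, ← abs_mul] at this
  simp only [ph_abs] at this
  unfold gG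
  linarith

lemma gG_comm (a b : ℝ) : gG a b = gG b a := by
  unfold gG; rw [mul_comm]; ring

lemma ph_continuous : Continuous ph := by unfold ph; fun_prop



lemma cheb {α : Type*} [MeasurableSpace α] (ρ : Measure α) [IsProbabilityMeasure ρ]
    {F G q : α → ℝ} (hF : Integrable F ρ) (hG : Integrable G ρ)
    (hFG : Integrable (fun x => F x * G x) ρ)
    (aF : ∀ x x', q x ≤ q x' → F x' ≤ F x) (aG : ∀ x x', q x ≤ q x' → G x' ≤ G x) :
    (∫ x, F x ∂ρ) * (∫ x, G x ∂ρ) ≤ ∫ x, F x * G x ∂ρ := by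
  have h0 : 0 ≤ ∫ z : α × α, (F z.1 - F z.2) * (G z.1 - G z.2) ∂(ρ.prod ρ) := by
    apply integral_nonneg
    intro z
    rcases le_total (q z.1) (q z.2) with h | h
    · exact mul_nonneg (sub_nonneg.2 (aF _ _ h)) (sub_nonneg.2 (aG _ _ h))
    · exact mul_nonneg_of_nonpos_of_nonpos (sub_nonpos.2 (aF _ _ h)) (sub_nonpos.2 (aG _ _ h))
  have i1 : Integrable (fun z : α × α => F z.1 * G z.1) (ρ.prod ρ) := hFG.comp_fst ρ
  have i2 : Integrable (fun z : α × α => F z.2 * G z.2) (ρ.prod ρ) := hFG.comp_snd ρ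
  have i3 : Integrable (fun z : α × α => F z.1 * G z.2) (ρ.prod ρ) := hF.mul_prod hG
  have i4 : Integrable (fun z : α × α => G z.1 * F z.2) (ρ.prod ρ) := hG.mul_prod hF
  have e : ∀ z : α × α, (F z.1 - F z.2) * (G z.1 - G z.2) =
      (F z.1 * G z.1 + F z.2 * G z.2) - (F z.1 * G z.2 + G z.1 * F z.2) := by intro z; ring
  simp_rw [e] at h0
  have i12 : Integrable (fun z : α × α => F z.1 * G z.1 + F z.2 * G z.2) (ρ.prod ρ) := i1.add i2
  have i34 : Integrable (fun z : α × α => F z.1 * G z.2 + G z.1 * F z.2) (ρ.prod ρ) := i3.add i4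
  rw [integral_sub i12 i34, integral_add i1 i2, integral_add i3 i4,
    integral_prod_mul, integral_prod_mul, integral_fun_fst (fun x => F x * G x),
    integral_fun_snd (fun x => F x * G x)] at h0
  simp at h0
  nlinarith

lemma harris {α β : Type*} [MeasurableSpace α] [MeasurableSpace β]
    (ρ₁ : Measure α) [IsProbabilityMeasure ρ₁] (ρ₂ : Measure β) [IsProbabilityMeasure ρ₂]
    {F G : α × β → ℝ} {q₁ : α → ℝ} {q₂ : β → ℝ} {C : ℝ}
    (hF : Measurable F) (hG : Measurable G)
    (bF : ∀ z, ‖F z‖ ≤ C) (bG : ∀ z, ‖G z‖ ≤ C)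
    (aF : ∀ x x' y, q₁ x ≤ q₁ x' → F (x', y) ≤ F (x, y))
    (aG : ∀ x x' y, q₁ x ≤ q₁ x' → G (x', y) ≤ G (x, y))
    (aF' : ∀ x y y', q₂ y ≤ q₂ y' → F (x, y') ≤ F (x, y))
    (aG' : ∀ x y y', q₂ y ≤ q₂ y' → G (x, y') ≤ G (x, y)) :
    (∫ z, F z ∂(ρ₁.prod ρ₂)) * (∫ z, G z ∂(ρ₁.prod ρ₂)) ≤ ∫ z, F z * G z ∂(ρ₁.prod ρ₂) := by
  have bFG : ∀ z, ‖F z * G z‖ ≤ C * C := fun z => by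
    rw [norm_mul]
    exact mul_le_mul (bF z) (bG z) (norm_nonneg _) ((norm_nonneg _).trans (bF z))
  have iF : Integrable F (ρ₁.prod ρ₂) := .of_bound hF.aestronglyMeasurable C (.of_forall bF)
  have iG : Integrable G (ρ₁.prod ρ₂) := .of_bound hG.aestronglyMeasurable C (.of_forall bG)
  have iFG : Integrable (fun z => F z * G z) (ρ₁.prod ρ₂) :=
    .of_bound (hF.mul hG).aestronglyMeasurable (C * C) (.of_forall bFG)
  have jF : ∀ y, Integrable (fun x => F (x, y)) ρ₁ := fun y =>
    .of_bound (hF.comp measurable_prodMk_right).aestronglyMeasurable C (.of_forall fun x => bF _)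
  have jG : ∀ y, Integrable (fun x => G (x, y)) ρ₁ := fun y =>
    .of_bound (hG.comp measurable_prodMk_right).aestronglyMeasurable C (.of_forall fun x => bG _)
  have jFG : ∀ y, Integrable (fun x => F (x, y) * G (x, y)) ρ₁ := fun y =>
    .of_bound ((hF.mul hG).comp measurable_prodMk_right).aestronglyMeasurable (C * C)
      (.of_forall fun x => bFG _)
  rw [integral_prod_symm _ iF, integral_prod_symm _ iG, integral_prod_symm _ iFG]
  have kF := iF.integral_prod_right
  have kG := iG.integral_prod_right
  have nF : ∀ y, ‖∫ x, F (x, y) ∂ρ₁‖ ≤ C := fun y => by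
    simpa using norm_integral_le_of_norm_le_const (μ := ρ₁) (f := fun x => F (x, y)) (C := C)
      (.of_forall fun x => bF _)
  have kFG : Integrable (fun y => (∫ x, F (x, y) ∂ρ₁) * (∫ x, G (x, y) ∂ρ₁)) ρ₂ :=
    kG.bdd_mul kF.aestronglyMeasurable (.of_forall nF)
  refine (cheb ρ₂ (q := q₂) kF kG kFG ?_ ?_).trans ?_
  · intro y y' h
    exact integral_mono (jF _) (jF _) fun x => aF' x _ _ h
  · intro y y' h
    exact integral_mono (jG _) (jG _) fun x => aG' x _ _ h
  · refine integral_mono kFG iFG.integral_prod_right fun y => ?_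
    exact cheb ρ₁ (q := q₁) (jF y) (jG y) (jFG y) (fun x x' h => aF x x' y h)
      (fun x x' h => aG x x' y h)

abbrev II : Type := Set.Icc (-1 : ℝ) 1

lemma iabs (a : II) : |(a : ℝ)| ≤ 1 := abs_le.2 a.2

lemma iabs_mul (a b : II) : |(a : ℝ) * b| ≤ 1 := by
  rw [abs_mul]
  exact mul_le_one₀ (iabs a) (abs_nonneg _) (iabs b)

/-- degenerate law -/
def ZZ (ρ : Measure II) : Prop :=
  (∀ᵐ a : II ∂ρ, (a : ℝ) = 0) ∨ (∀ᵐ a : II ∂ρ, (a : ℝ) = 1 ∨ (a : ℝ) = -1)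

lemma gG_sing {a b : ℝ} (h : Sing a ∨ Sing b) : gG a b = ph a * ph b / Real.log 2 := by
  have hl : Real.log 2 ≠ 0 := (Real.log_pos one_lt_two).ne'
  wlog h' : Sing a generalizing a b
  · rw [gG_comm, this h.symm (h.resolve_left h')]; ring
  unfold gG
  rcases h' with h | h | h <;> subst h
  · rw [zero_mul, ph_zero]; field_simp; ring
  · rw [one_mul, ph_one]; ring
  · rw [neg_one_mul, ph_neg, ph_neg, ph_one]; ring

lemma fg_sing {a b : ℝ} (h : Sing a ∨ Sing b) : ph (a * b) * gG a b = ph a * ph b := by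
  have hl : Real.log 2 ≠ 0 := (Real.log_pos one_lt_two).ne'
  rw [gG_sing h]
  wlog h' : Sing a generalizing a b
  · have := this h.symm (h.resolve_left h')
    rw [mul_comm a b, mul_comm (ph a), this]
  rcases h' with h | h | h <;> subst h
  · rw [zero_mul, ph_zero]; field_simp
  · rw [ph_one]; ring
  · rw [ph_neg, ph_one]; ring

lemma ph_int (ρ : Measure II) [IsProbabilityMeasure ρ] : Integrable (fun a : II => ph a) ρ :=
  (ph_continuous.comp continuous_subtype_val).integrable_of_hasCompactSupport
    (HasCompactSupport.of_compactSpace _)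

lemma mean_zero (ρ : Measure II) [IsProbabilityMeasure ρ] (h : ∫ a : II, ph a ∂ρ = 0) : ZZ ρ := by
  right
  rw [integral_eq_zero_iff_of_nonneg (fun a : II => ph_nonneg (iabs a)) (ph_int ρ)] at h
  filter_upwards [h] with a ha
  exact ph_eq_zero.1 ha

lemma mean_log (ρ : Measure II) [IsProbabilityMeasure ρ] (h : ∫ a : II, ph a ∂ρ = Real.log 2) :
    ZZ ρ := by
  left
  have h' : ∫ a : II, (Real.log 2 - ph a) ∂ρ = 0 := by
    rw [integral_sub (integrable_const _) (ph_int ρ), h]; simp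
  rw [integral_eq_zero_iff_of_nonneg (fun a : II => sub_nonneg.2 (ph_le a))
    ((integrable_const (Real.log 2)).sub (ph_int ρ))] at h'
  filter_upwards [h'] with a ha
  have : Real.log 2 - ph a = 0 := ha
  exact ph_eq_log.1 (by linarith)

theorem analytic (ρ₁ ρ₂ : Measure II) [IsProbabilityMeasure ρ₁] [IsProbabilityMeasure ρ₂]
    (hc : Integrable (fun z : II × II => cC z.1 z.2) (ρ₁.prod ρ₂)) {C : ℝ}
    (hC : C = (∫ z : II × II, ph (z.1 * z.2) * gG z.1 z.2 ∂(ρ₁.prod ρ₂))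
      - (∫ z : II × II, ph (z.1 * z.2) ∂(ρ₁.prod ρ₂)) * (∫ z : II × II, gG z.1 z.2 ∂(ρ₁.prod ρ₂))
      + ∫ z : II × II, cC z.1 z.2 ∂(ρ₁.prod ρ₂)) :
    0 ≤ C ∧ (C = 0 ↔ ZZ ρ₁ ∨ ZZ ρ₂) := by
  have cont1 : Continuous (fun z : II × II => ph (z.1 * z.2)) :=
    ph_continuous.comp (by fun_prop)
  have contg : Continuous (fun z : II × II => gG z.1 z.2) := by
    have h1 : Continuous (fun z : II × II => ph (z.1)) := ph_continuous.comp (by fun_prop)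
    have h2 : Continuous (fun z : II × II => ph (z.2)) := ph_continuous.comp (by fun_prop)
    exact (h1.add h2).sub cont1
  have hl : 0 < Real.log 2 := Real.log_pos one_lt_two
  have b1 : ∀ z : II × II, ‖ph (z.1 * z.2)‖ ≤ 3 * Real.log 2 := fun z => by
    have := ph_nonneg (iabs_mul z.1 z.2)
    have := ph_le (z.1 * z.2)
    rw [Real.norm_eq_abs, abs_le]; constructor <;> linarith
  have b2 : ∀ z : II × II, ‖gG z.1 z.2‖ ≤ 3 * Real.log 2 := fun z => by
    have := ph_nonneg (iabs_mul z.1 z.2)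
    have := ph_le (z.1 * z.2)
    have := ph_nonneg (iabs z.1)
    have := ph_le z.1
    have := ph_nonneg (iabs z.2)
    have := ph_le z.2
    rw [Real.norm_eq_abs, abs_le, gG]; constructor <;> linarith
  have hH := harris ρ₁ ρ₂ (q₁ := fun a : II => |(a : ℝ)|) (q₂ := fun a : II => |(a : ℝ)|)
    cont1.measurable contg.measurable b1 b2
    (fun x x' y h => f_anti h (iabs x') (iabs y))
    (fun x x' y h => g_anti h (iabs x') (iabs y))
    (fun x y y' h => by
      simp only [mul_comm (x : ℝ)]
      exact f_anti h (iabs y') (iabs x))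
    (fun x y y' h => by
      simp only [gG_comm (x : ℝ)]
      exact g_anti h (iabs y') (iabs x))
  have cn : 0 ≤ fun z : II × II => cC z.1 z.2 := fun z => cC_nonneg (iabs z.1) (iabs z.2)
  have hcn : 0 ≤ ∫ z : II × II, cC z.1 z.2 ∂(ρ₁.prod ρ₂) := integral_nonneg cn
  refine ⟨by linarith, ?_⟩
  -- computation in the degenerate case
  have key : (∀ᵐ z : II × II ∂(ρ₁.prod ρ₂), Sing z.1 ∨ Sing z.2) →
      C = (∫ a : II, ph a ∂ρ₁) * (∫ a : II, ph a ∂ρ₂) *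
        (1 - (∫ a : II, ph a ∂ρ₁) / Real.log 2) * (1 - (∫ a : II, ph a ∂ρ₂) / Real.log 2) := by
    intro hs
    have e0 : ∫ z : II × II, cC z.1 z.2 ∂(ρ₁.prod ρ₂) = 0 := by
      rw [← integral_zero (II × II) ℝ (μ := ρ₁.prod ρ₂)]
      apply integral_congr_ae
      filter_upwards [hs] with z hz
      rcases hz with hz | hz
      · exact cC_sing hz _
      · rw [cC_comm]; exact cC_sing hz _
    have e1 : ∫ z : II × II, ph (z.1 * z.2) * gG z.1 z.2 ∂(ρ₁.prod ρ₂) =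
        (∫ a : II, ph a ∂ρ₁) * (∫ a : II, ph a ∂ρ₂) := by
      rw [← integral_prod_mul]
      apply integral_congr_ae
      filter_upwards [hs] with z hz
      exact fg_sing hz
    have e2 : ∫ z : II × II, gG z.1 z.2 ∂(ρ₁.prod ρ₂) =
        (∫ a : II, ph a ∂ρ₁) * (∫ a : II, ph a ∂ρ₂) / Real.log 2 := by
      rw [← integral_prod_mul, ← integral_div]
      apply integral_congr_ae
      filter_upwards [hs] with z hz
      exact gG_sing hz
    have e3 : ∫ z : II × II, ph (z.1 * z.2) ∂(ρ₁.prod ρ₂) =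
        (∫ a : II, ph a ∂ρ₁) + (∫ a : II, ph a ∂ρ₂)
          - (∫ a : II, ph a ∂ρ₁) * (∫ a : II, ph a ∂ρ₂) / Real.log 2 := by
      rw [← e2]
      have i1 := (ph_int ρ₁).comp_fst ρ₂
      have i2 := (ph_int ρ₂).comp_snd ρ₁
      have ig : Integrable (fun z : II × II => gG z.1 z.2) (ρ₁.prod ρ₂) :=
        .of_bound contg.aestronglyMeasurable _ (.of_forall b2)
      have t1 : ∫ z : II × II, ph z.1 ∂(ρ₁.prod ρ₂) = ∫ a : II, ph a ∂ρ₁ := by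
        rw [integral_fun_fst (fun a : II => ph a)]; simp
      have t2 : ∫ z : II × II, ph z.2 ∂(ρ₁.prod ρ₂) = ∫ a : II, ph a ∂ρ₂ := by
        rw [integral_fun_snd (fun a : II => ph a)]; simp
      have i12 : Integrable (fun z : II × II => ph z.1 + ph z.2) (ρ₁.prod ρ₂) := i1.add i2
      rw [← t1, ← t2, ← integral_add i1 i2, ← integral_sub i12 ig]
      congr 1; ext z; simp only [gG]; ring
    rw [hC, e0, e1, e2, e3]
    field_simp
    ring
  constructor
  · intro h
    have hc0 : ∫ z : II × II, cC z.1 z.2 ∂(ρ₁.prod ρ₂) = 0 := by linarith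
    rw [integral_eq_zero_iff_of_nonneg cn hc] at hc0
    have hs : ∀ᵐ z : II × II ∂(ρ₁.prod ρ₂), Sing z.1 ∨ Sing z.2 := by
      filter_upwards [hc0] with z hz
      exact cC_eq_zero (iabs z.1) (iabs z.2) hz
    have hk := key hs
    rw [h] at hk
    rcases mul_eq_zero.1 hk.symm with hk | hk
    · rcases mul_eq_zero.1 hk with hk | hk
      · rcases mul_eq_zero.1 hk with hk | hk
        · exact .inl (mean_zero _ hk)
        · exact .inr (mean_zero _ hk)
      · refine .inl (mean_log _ ?_)
        field_simp at hk; linarith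
    · refine .inr (mean_log _ ?_)
      field_simp at hk; linarith
  · intro h
    have conv1 : ∀ ρ : Measure II, IsProbabilityMeasure ρ → ZZ ρ → (∀ᵐ a : II ∂ρ, Sing (a : ℝ)) ∧
        ((∫ a : II, ph a ∂ρ = 0) ∨ (∫ a : II, ph a ∂ρ = Real.log 2)) := by
      rintro ρ hρ (h | h)
      · refine ⟨by filter_upwards [h] with a ha using .inl ha, .inr ?_⟩
        have : ∫ a : II, ph a ∂ρ = ∫ a : II, Real.log 2 ∂ρ := by
          apply integral_congr_ae
          filter_upwards [h] with a ha
          rw [ha, ph_zero]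
        rw [this]; simp
      · refine ⟨by filter_upwards [h] with a ha using .inr ha, .inl ?_⟩
        have : ∫ a : II, ph a ∂ρ = ∫ a : II, 0 ∂ρ := by
          apply integral_congr_ae
          filter_upwards [h] with a ha
          exact ph_eq_zero.2 ha
        rw [this]; simp
    rcases h with h | h
    · obtain ⟨hs, hm⟩ := conv1 _ inferInstance h
      rw [key (by filter_upwards [Measure.quasiMeasurePreserving_fst.ae hs] with z hz using .inl hz)]
      rcases hm with hm | hm <;> rw [hm] <;> field_simp <;> simp
    · obtain ⟨hs, hm⟩ := conv1 _ inferInstance h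
      rw [key (by filter_upwards [Measure.quasiMeasurePreserving_snd.ae hs] with z hz using .inr hz)]
      rcases hm with hm | hm <;> rw [hm] <;> field_simp <;> simp


set_option linter.unusedSectionVars false
section prob
variable {Ω β S T : Type*} [MeasurableSpace Ω] [MeasurableSpace β]
  [MeasurableSpace S] [MeasurableSpace T]
  [Fintype S] [MeasurableSingletonClass S] [StandardBorelSpace S] [Nonempty S]
  [Fintype T] [MeasurableSingletonClass T] [StandardBorelSpace T] [Nonempty T]
  {μ : Measure Ω} [IsProbabilityMeasure μ] {X : Ω → S} {Z : Ω → T} {Y : Ω → β}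

lemma meas_sing (κ : Kernel β S) : Measurable (fun z : β × S => (κ z.1).real {z.2}) :=
  measurable_from_prod_countable_left fun s =>
    (κ.measurable_coe (measurableSet_singleton s)).ennreal_toReal

lemma ae_transfer (hX : Measurable X) (hY : Measurable Y) {p : β × S → Prop}
    (hp : MeasurableSet {z | p z}) :
    (∀ᵐ ω ∂μ, p (Y ω, X ω)) ↔
      ∀ᵐ y ∂(μ.map Y), ∀ x, condDistrib X Y μ y {x} ≠ 0 → p (y, x) := by
  rw [← ae_map_iff (p := p) (hY.prodMk hX).aemeasurable hp,
    ← compProd_map_condDistrib hX.aemeasurable, Measure.ae_compProd_iff hp]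
  simp_rw [ae_iff_of_countable]

lemma pos_ae (hX : Measurable X) (hY : Measurable Y) :
    ∀ᵐ ω ∂μ, 0 < (condDistrib X Y μ (Y ω)).real {X ω} := by
  refine (ae_transfer (p := fun z => 0 < (condDistrib X Y μ z.1).real {z.2}) hX hY
    (measurableSet_lt measurable_const (meas_sing _))).2 (.of_forall fun y x h => ?_)
  exact ENNReal.toReal_pos h (measure_ne_top _ _)

lemma integral_transfer (hX : Measurable X) (hY : Measurable Y) {F : β × S → ℝ}
    (hF : Measurable F) (hi : Integrable (fun ω => F (Y ω, X ω)) μ) :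
    Integrable (fun ω => ∑ x, (condDistrib X Y μ (Y ω)).real {x} * F (Y ω, x)) μ ∧
    ∫ ω, F (Y ω, X ω) ∂μ = ∫ ω, ∑ x, (condDistrib X Y μ (Y ω)).real {x} * F (Y ω, x) ∂μ := by
  have hi' : Integrable F (μ.map fun ω => (Y ω, X ω)) :=
    (integrable_map_measure hF.aestronglyMeasurable (hY.prodMk hX).aemeasurable).2 hi
  have e : ∀ y, ∫ x, F (y, x) ∂(condDistrib X Y μ y) =
      ∑ x, (condDistrib X Y μ y).real {x} * F (y, x) := fun y => by
    rw [integral_fintype .of_finite]; simp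
  have h1 := hi'.integral_condDistrib hY.aemeasurable hX.aemeasurable
  have h2 := integral_congr_ae (condExp_prod_ae_eq_integral_condDistrib' hY hX.aemeasurable hi')
  rw [integral_condExp hY.comap_le] at h2
  simp_rw [e] at h1 h2
  exact ⟨h1, h2⟩

lemma mul_log_sq_le {t : ℝ} (h0 : 0 ≤ t) (h1 : t ≤ 1) : t * (Real.log t) ^ 2 ≤ 4 := by
  rcases h0.eq_or_lt with rfl | h0
  · simp
  have hs := Real.sqrt_pos.2 h0
  have h := Real.abs_log_mul_self_lt (Real.sqrt t) hs (Real.sqrt_le_one.2 h1)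
  rw [Real.log_sqrt h0.le] at h
  have h2 : (Real.log t / 2 * Real.sqrt t) ^ 2 < 1 := (sq_lt_one_iff_abs_lt_one _).2 h
  rw [mul_pow, Real.sq_sqrt h0.le] at h2
  nlinarith

lemma memLp_ent (hX : Measurable X) (hY : Measurable Y) :
    MemLp (fun ω => - Real.log ((condDistrib X Y μ (Y ω)).real {X ω})) 2 μ := by
  have hm : Measurable (fun z : β × S => - Real.log ((condDistrib X Y μ z.1).real {z.2})) :=
    (Real.measurable_log.comp (meas_sing _)).neg
  have hm' := hm.comp (hY.prodMk hX)
  refine (memLp_two_iff_integrable_sq hm'.aestronglyMeasurable).2 ?_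
  have hsq : Measurable (fun z : β × S => (- Real.log ((condDistrib X Y μ z.1).real {z.2})) ^ 2) :=
    hm.pow_const 2
  refine (integrable_map_measure (f := fun ω => (Y ω, X ω)) hsq.aestronglyMeasurable
    (hY.prodMk hX).aemeasurable).1 ?_
  rw [← hsq.aestronglyMeasurable.ae_integrable_condDistrib_map_iff hX.aemeasurable]
  refine ⟨.of_forall fun y => .of_finite, ?_⟩
  have e : ∀ y, ∫ x, ‖(- Real.log ((condDistrib X Y μ y).real {x})) ^ 2‖ ∂(condDistrib X Y μ y) =
      ∑ x, (condDistrib X Y μ y).real {x} * (Real.log ((condDistrib X Y μ y).real {x})) ^ 2 :=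
    fun y => by
      rw [integral_fintype .of_finite]; simp
  simp_rw [e]
  have : IsProbabilityMeasure (μ.map Y) := Measure.isProbabilityMeasure_map hY.aemeasurable
  refine .of_bound (C := ∑ x : S, 4) ?_ (.of_forall fun y => ?_)
  · refine (Finset.measurable_sum _ fun x _ => ?_).aestronglyMeasurable
    have := ((condDistrib X Y μ).measurable_coe (measurableSet_singleton x)).ennreal_toReal
    exact this.mul ((Real.measurable_log.comp this).pow_const 2)
  · rw [Real.norm_eq_abs, abs_of_nonneg (Finset.sum_nonneg fun x _ => by positivity)]
    exact Finset.sum_le_sum fun x _ => mul_log_sq_le measureReal_nonneg measureReal_le_one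

lemma chain_kernel (hX : Measurable X) (hZ : Measurable Z) (hY : Measurable Y) :
    condDistrib (fun ω => (Z ω, X ω)) Y μ =ᵐ[μ.map Y]
      (condDistrib Z Y μ ⊗ₖ (condDistrib X (fun ω => (Z ω, Y ω)) μ).swapLeft) := by
  refine condDistrib_ae_eq_of_measure_eq_compProd Y (hZ.prodMk hX).aemeasurable ?_
  rw [← Measure.compProd_assoc', compProd_map_condDistrib hZ.aemeasurable]
  have : (μ.map fun ω => (Y ω, Z ω)) ⊗ₘ (condDistrib X (fun ω => (Z ω, Y ω)) μ).swapLeft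
      = μ.map (fun ω => ((Y ω, Z ω), X ω)) := by
    apply Measure.ext_prod
    intro s t hs ht
    rw [Measure.compProd_apply_prod hs ht, setLIntegral_map hs
      (Kernel.measurable_coe _ ht) (hY.prodMk hZ),
      Measure.map_apply ((hY.prodMk hZ).prodMk hX) (hs.prod ht)]
    have := setLIntegral_preimage_condDistrib (μ := μ) (hZ.prodMk hY) hX.aemeasurable ht
      (measurable_swap hs)
    exact this
  rw [this, Measure.map_map (MeasurableEquiv.measurable _) ((hY.prodMk hZ).prodMk hX)]
  rfl

lemma chain_ae (hX : Measurable X) (hZ : Measurable Z) (hY : Measurable Y) :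
    ∀ᵐ ω ∂μ, (condDistrib (fun ω => (Z ω, X ω)) Y μ (Y ω)).real {(Z ω, X ω)} =
      (condDistrib Z Y μ (Y ω)).real {Z ω} *
      (condDistrib X (fun ω => (Z ω, Y ω)) μ (Z ω, Y ω)).real {X ω} := by
  filter_upwards [ae_of_ae_map hY.aemeasurable (chain_kernel (μ := μ) hX hZ hY)] with ω h
  rw [h, measureReal_def, ← Set.singleton_prod_singleton, Kernel.compProd_apply_prod
    (measurableSet_singleton _) (measurableSet_singleton _)]
  rw [lintegral_singleton, ENNReal.toReal_mul, mul_comm]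
  rfl

lemma map_real (κ : Kernel β S) [IsMarkovKernel κ] {f : S → T} [DecidableEq T]
    (hf : Measurable f) (y : β) (t : T) :
    (κ.map f y).real {t} = ∑ x : S with f x = t, (κ y).real {x} := by
  rw [measureReal_def, Kernel.map_apply' _ hf _ (measurableSet_singleton _), ← measureReal_def,
    sum_measureReal_singleton]
  congr 1
  ext x; simp

end prob

lemma shuffle {β₁ β₂ S T : Type*} [MeasurableSpace β₁] [MeasurableSpace β₂]
  [MeasurableSpace S] [MeasurableSpace T] (ν₁ : Measure β₁) (ν₂ : Measure β₂)
  [IsProbabilityMeasure ν₁] [IsProbabilityMeasure ν₂] (κ₁ : Kernel β₁ S) (κ₂ : Kernel β₂ T)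
  [IsMarkovKernel κ₁] [IsMarkovKernel κ₂] :
  ((ν₁ ⊗ₘ κ₁).prod (ν₂ ⊗ₘ κ₂)).map
    (fun z : (β₁ × S) × (β₂ × T) => ((z.1.1, z.2.1), (z.1.2, z.2.2))) =
    (ν₁.prod ν₂) ⊗ₘ (κ₁ ∥ₖ κ₂) := by
  refine Measure.ext_of_lintegral _ fun f hf => ?_
  rw [lintegral_map hf (by fun_prop), lintegral_prod _ (by fun_prop), Measure.lintegral_compProd
    (f := fun x => ∫⁻ (y : β₂ × T), f ((x.1, y.1), x.2, y.2) ∂ν₂ ⊗ₘ κ₂)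
    (by exact Measurable.lintegral_prod_right' (f := fun z : (β₁ × S) × (β₂ × T) =>
        f ((z.1.1, z.2.1), (z.1.2, z.2.2))) (by fun_prop)), Measure.lintegral_compProd hf,
    lintegral_prod _ (by
      exact (hf.lintegral_kernel_prod_right' (κ := κ₁ ∥ₖ κ₂)).aemeasurable)]
  refine lintegral_congr fun y₁ => ?_
  have h1 : ∀ x₁, ∫⁻ (y : β₂ × T), f ((y₁, y.1), x₁, y.2) ∂ν₂ ⊗ₘ κ₂ =
      ∫⁻ y₂, ∫⁻ x₂, f ((y₁, y₂), x₁, x₂) ∂κ₂ y₂ ∂ν₂ := fun x₁ => by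
    rw [Measure.lintegral_compProd (by fun_prop)]
  have h2 : ∀ y₂, ∫⁻ x, f ((y₁, y₂), x) ∂((κ₁ ∥ₖ κ₂) (y₁, y₂)) =
      ∫⁻ x₁, ∫⁻ x₂, f ((y₁, y₂), x₁, x₂) ∂κ₂ y₂ ∂κ₁ y₁ := fun y₂ => by
    rw [Kernel.parallelComp_apply, lintegral_prod _ (by fun_prop)]
  simp_rw [h1, h2]
  rw [lintegral_lintegral_swap]
  have := Measurable.lintegral_kernel_prod_right' (κ := Kernel.prodMkLeft S κ₂)
    (f := fun z : (S × β₂) × T => f ((y₁, z.1.2), z.1.1, z.2)) (by fun_prop)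
  exact this.aemeasurable

section indep
variable {Ω β₁ β₂ S T : Type*} [MeasurableSpace Ω] [MeasurableSpace β₁] [MeasurableSpace β₂]
  [MeasurableSpace S] [MeasurableSpace T]
  [Fintype S] [MeasurableSingletonClass S] [StandardBorelSpace S] [Nonempty S]
  [Fintype T] [MeasurableSingletonClass T] [StandardBorelSpace T] [Nonempty T]
  {μ : Measure Ω} [IsProbabilityMeasure μ] {X₁ : Ω → S} {X₂ : Ω → T} {Y₁ : Ω → β₁} {Y₂ : Ω → β₂}

lemma indep_kernel (hX₁ : Measurable X₁) (hX₂ : Measurable X₂)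
    (hY₁ : Measurable Y₁) (hY₂ : Measurable Y₂)
    (hindep : IndepFun (fun ω => (X₁ ω, Y₁ ω)) (fun ω => (X₂ ω, Y₂ ω)) μ) :
    condDistrib (fun ω => (X₁ ω, X₂ ω)) (fun ω => (Y₁ ω, Y₂ ω)) μ
      =ᵐ[μ.map (fun ω => (Y₁ ω, Y₂ ω))] (condDistrib X₁ Y₁ μ ∥ₖ condDistrib X₂ Y₂ μ) := by
  refine condDistrib_ae_eq_of_measure_eq_compProd _ (hX₁.prodMk hX₂).aemeasurable ?_
  have hY : IndepFun Y₁ Y₂ μ := hindep.comp measurable_snd measurable_snd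
  have hYX : IndepFun (fun ω => (Y₁ ω, X₁ ω)) (fun ω => (Y₂ ω, X₂ ω)) μ :=
    hindep.comp measurable_swap measurable_swap
  rw [(indepFun_iff_map_prod_eq_prod_map_map hY₁.aemeasurable hY₂.aemeasurable).1 hY]
  rw [indepFun_iff_map_prod_eq_prod_map_map (hY₁.prodMk hX₁).aemeasurable
    (hY₂.prodMk hX₂).aemeasurable, ← compProd_map_condDistrib hX₁.aemeasurable,
    ← compProd_map_condDistrib hX₂.aemeasurable] at hYX
  have : IsProbabilityMeasure (μ.map Y₁) := Measure.isProbabilityMeasure_map hY₁.aemeasurable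
  have : IsProbabilityMeasure (μ.map Y₂) := Measure.isProbabilityMeasure_map hY₂.aemeasurable
  set e : (β₁ × S) × (β₂ × T) → (β₁ × β₂) × (S × T) := fun z => ((z.1.1, z.2.1), (z.1.2, z.2.2))
    with he_def
  have he : Measurable e := by fun_prop
  have h0 : μ.map (fun ω => ((Y₁ ω, Y₂ ω), (X₁ ω, X₂ ω))) =
      (μ.map (fun ω => ((Y₁ ω, X₁ ω), (Y₂ ω, X₂ ω)))).map e := by
    rw [Measure.map_map he ((hY₁.prodMk hX₁).prodMk (hY₂.prodMk hX₂))]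
    rfl
  rw [h0, hYX]
  exact shuffle _ _ _ _

end indep

section fin
variable {Ω β : Type*} [MeasurableSpace Ω] [MeasurableSpace β]

lemma bias_mem (X : Ω → ZMod 2) (Y : Ω → β) (μ : Measure Ω) [IsProbabilityMeasure μ] (y : β) :
    2 * (condDistrib X Y μ y).real {0} - 1 ∈ Set.Icc (-1 : ℝ) 1 := by
  have h0 : 0 ≤ (condDistrib X Y μ y).real {0} := measureReal_nonneg
  have h1 : (condDistrib X Y μ y).real {0} ≤ 1 := measureReal_le_one
  constructor <;> linarith

/-- the bias of the conditional law of `X` given `Y = y` -/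
noncomputable def bias (X : Ω → ZMod 2) (Y : Ω → β) (μ : Measure Ω) [IsProbabilityMeasure μ]
    (y : β) : II := ⟨2 * (condDistrib X Y μ y).real {0} - 1, bias_mem X Y μ y⟩

variable {X : Ω → ZMod 2} {Y : Ω → β} {μ : Measure Ω} [IsProbabilityMeasure μ]

lemma measurable_bias : Measurable (bias X Y μ) := by
  refine Measurable.subtype_mk ?_
  have := ((condDistrib X Y μ).measurable_coe (measurableSet_singleton (0 : ZMod 2))).ennreal_toReal
  exact (this.const_mul 2).sub_const 1

lemma real_eq_rr (y : β) (x : ZMod 2) : (condDistrib X Y μ y).real {x} = rr (bias X Y μ y) x := by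
  have h0 : (condDistrib X Y μ y).real {0} = rr (bias X Y μ y) 0 := by
    rw [rr_zero, bias]; ring
  have h1 : (condDistrib X Y μ y).real {1} = rr (bias X Y μ y) 1 := by
    have h : (condDistrib X Y μ y).real {0} + (condDistrib X Y μ y).real {1} = 1 := by
      rw [← sum2 (fun x => (condDistrib X Y μ y).real {x}), sum_measureReal_singleton]
      simp
    rw [rr_one, bias]; linarith
  fin_cases x
  · exact h0
  · exact h1

/-- entropy random variable with natural logarithm -/
noncomputable def ent (X : Ω → ZMod 2) (Y : Ω → β) (μ : Measure Ω) [IsProbabilityMeasure μ]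
    (ω : Ω) : ℝ := - Real.log ((condDistrib X Y μ (Y ω)).real {X ω})

lemma ent_eq (ω : Ω) : ent X Y μ ω = LL (bias X Y μ (Y ω)) (X ω) := by
  rw [ent, real_eq_rr, LL]

lemma zmod_cases (x : ZMod 2) : x = 0 ∨ x = 1 := by
  revert x; decide

lemma log_rr_one {a : ℝ} (h : a = 1 ∨ a = -1) (x : ZMod 2) : LL a x = 0 := by
  rcases h with rfl | rfl <;> rcases zmod_cases x with rfl | rfl <;>
    simp [LL, rr_zero, rr_one]

lemma log_rr_zero (x : ZMod 2) : LL 0 x = Real.log 2 := by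
  simp [LL, rr]

lemma var_zero_iff (hX : Measurable X) (hY : Measurable Y) :
    variance (ent X Y μ) μ = 0 ↔ ZZ (μ.map (fun ω => bias X Y μ (Y ω))) := by
  have hb : Measurable (fun ω => bias X Y μ (Y ω)) := measurable_bias.comp hY
  have hm : Measurable (fun a : II => (a : ℝ)) := measurable_subtype_coe
  have m0 : MeasurableSet {a : II | (a : ℝ) = 0} := hm (measurableSet_singleton 0)
  have m1 : MeasurableSet {a : II | (a : ℝ) = 1 ∨ (a : ℝ) = -1} :=
    (hm (measurableSet_singleton 1)).union (hm (measurableSet_singleton (-1)))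
  unfold ZZ
  rw [ae_map_iff hb.aemeasurable m0, ae_map_iff hb.aemeasurable m1]
  constructor
  · intro h
    have h1 := ae_eq_integral_of_variance_eq_zero (memLp_ent hX hY) h
    set c := ∫ ω, ent X Y μ ω ∂μ with hc
    have h2 := (ae_transfer (p := fun z => - Real.log ((condDistrib X Y μ z.1).real {z.2}) = c)
      hX hY ((Real.measurable_log.comp (meas_sing _)).neg (measurableSet_singleton c))).1 h1
    have h3 : ∀ᵐ ω ∂μ, ∀ x, rr (bias X Y μ (Y ω)) x ≠ 0 →
        LL (bias X Y μ (Y ω)) x = c := by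
      filter_upwards [ae_of_ae_map hY.aemeasurable h2] with ω hω x hx
      have := hω x (fun h0 => hx (by rw [← real_eq_rr, measureReal_def, h0]; rfl))
      rwa [real_eq_rr] at this
    have key : ∀ a : ℝ, (∀ x, rr a x ≠ 0 → LL a x = c) → a ≠ 1 → a ≠ -1 → a ∈ Set.Icc (-1:ℝ) 1 →
        a = 0 ∧ c = Real.log 2 := by
      intro a h h1 h2 ha
      have p1 : 0 < 1 - a := sub_pos.2 (lt_of_le_of_ne ha.2 h1)
      have p2 : 0 < 1 + a := by
        have := lt_of_le_of_ne ha.1 (Ne.symm h2)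
        linarith
      have e0 := h 0 (by rw [rr_zero]; positivity)
      have e1 := h 1 (by rw [rr_one]; positivity)
      have e : Real.log (rr a 0) = Real.log (rr a 1) := by
        unfold LL at e0 e1; linarith
      have e2 := Real.log_injOn_pos (by rw [rr_zero]; exact (by positivity : 0 < (1 + a) / 2))
        (by rw [rr_one]; exact (by positivity : 0 < (1 - a) / 2)) e
      rw [rr_zero, rr_one] at e2
      have ha0 : a = 0 := by linarith
      refine ⟨ha0, ?_⟩
      rw [← e0, ha0, log_rr_zero]
    have hl := Real.log_pos (one_lt_two)
    by_cases hc0 : c = 0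
    · right
      filter_upwards [h3] with ω hω
      by_contra! hcon
      have := (key _ hω hcon.1 hcon.2 (bias X Y μ (Y ω)).2).2
      linarith
    · left
      filter_upwards [h3] with ω hω
      refine (key _ hω ?_ ?_ (bias X Y μ (Y ω)).2).1
      · intro h
        rw [h] at hω
        have := hω 0 (by rw [rr_zero]; norm_num)
        rw [log_rr_one (.inl rfl)] at this
        exact hc0 this.symm
      · intro h
        rw [h] at hω
        have := hω 1 (by rw [rr_one]; norm_num)
        rw [log_rr_one (.inr rfl)] at this
        exact hc0 this.symm
  · rintro (h | h)
    · have : ent X Y μ =ᵐ[μ] fun _ => Real.log 2 := by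
        filter_upwards [h] with ω hω
        rw [ent_eq, hω, log_rr_zero]
      rw [variance_congr this]; simp [variance_eq_integral]
    · have : ent X Y μ =ᵐ[μ] fun _ => (0 : ℝ) := by
        filter_upwards [h] with ω hω
        rw [ent_eq, log_rr_one hω]
      rw [variance_congr this]; simp [variance_eq_integral]

end fin

section main
variable {Ω β₁ β₂ : Type*} [MeasurableSpace Ω] [MeasurableSpace β₁] [MeasurableSpace β₂]
  {μ : Measure Ω} [IsProbabilityMeasure μ] {X₁ X₂ : Ω → ZMod 2} {Y₁ : Ω → β₁} {Y₂ : Ω → β₂}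

lemma sumA (a b : ℝ) : ∑ x : ZMod 2 × ZMod 2, rr a x.1 * rr b x.2 * LL (a * b) (x.1 + x.2)
    = ph (a * b) := by
  rw [sum4, ph_eq]
  simp only [one_add_one', add_zero, zero_add, rr_zero, rr_one]
  ring

lemma sumB (a b : ℝ) : ∑ x : ZMod 2 × ZMod 2, rr a x.1 * rr b x.2 *
    (LL a x.1 + LL b x.2 - LL (a * b) (x.1 + x.2)) = gG a b := by
  rw [sum4, gG, ph_eq, ph_eq, ph_eq]
  simp only [one_add_one', add_zero, zero_add, rr_zero, rr_one]
  ring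

lemma sumAB (a b : ℝ) : ∑ x : ZMod 2 × ZMod 2, rr a x.1 * rr b x.2 * (LL (a * b) (x.1 + x.2) *
    (LL a x.1 + LL b x.2 - LL (a * b) (x.1 + x.2))) = ph (a * b) * gG a b + cC a b := by
  rw [cC]; ring

lemma joint_ae (hX₁ : Measurable X₁) (hX₂ : Measurable X₂)
    (hY₁ : Measurable Y₁) (hY₂ : Measurable Y₂)
    (hindep : IndepFun (fun ω => (X₁ ω, Y₁ ω)) (fun ω => (X₂ ω, Y₂ ω)) μ) :
    ∀ᵐ ω ∂μ, ∀ x : ZMod 2 × ZMod 2,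
      (condDistrib (fun ω => (X₁ ω, X₂ ω)) (fun ω => (Y₁ ω, Y₂ ω)) μ (Y₁ ω, Y₂ ω)).real {x} =
      rr (bias X₁ Y₁ μ (Y₁ ω)) x.1 * rr (bias X₂ Y₂ μ (Y₂ ω)) x.2 := by
  filter_upwards [ae_of_ae_map (hY₁.prodMk hY₂).aemeasurable
    (indep_kernel hX₁ hX₂ hY₁ hY₂ hindep)] with ω hω x
  rw [hω, ← real_eq_rr, ← real_eq_rr, measureReal_def]
  have : ({x} : Set (ZMod 2 × ZMod 2)) = {x.1} ×ˢ {x.2} := by simp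
  rw [this, Kernel.parallelComp_apply_prod, ENNReal.toReal_mul]
  rfl

lemma U1_ae (hX₁ : Measurable X₁) (hX₂ : Measurable X₂)
    (hY₁ : Measurable Y₁) (hY₂ : Measurable Y₂)
    (hindep : IndepFun (fun ω => (X₁ ω, Y₁ ω)) (fun ω => (X₂ ω, Y₂ ω)) μ) :
    ∀ᵐ ω ∂μ, ∀ u : ZMod 2,
      (condDistrib (fun ω => X₁ ω + X₂ ω) (fun ω => (Y₁ ω, Y₂ ω)) μ (Y₁ ω, Y₂ ω)).real {u} =
      rr (bias X₁ Y₁ μ (Y₁ ω) * bias X₂ Y₂ μ (Y₂ ω)) u := by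
  have hf : Measurable (fun x : ZMod 2 × ZMod 2 => x.1 + x.2) := .of_discrete
  filter_upwards [ae_of_ae_map (hY₁.prodMk hY₂).aemeasurable (condDistrib_comp (μ := μ)
    (fun ω => (Y₁ ω, Y₂ ω)) (hX₁.prodMk hX₂).aemeasurable hf),
    joint_ae hX₁ hX₂ hY₁ hY₂ hindep] with ω hω h2 u
  have hω' : condDistrib (fun ω => X₁ ω + X₂ ω) (fun ω => (Y₁ ω, Y₂ ω)) μ (Y₁ ω, Y₂ ω) = _ := hω
  rw [hω', map_real _ hf, Finset.sum_filter, sum4]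
  simp only [h2]
  rcases zmod_cases u with rfl | rfl <;> simp [one_add_one', rr_zero, rr_one] <;> ring

lemma pair_ae (hX₁ : Measurable X₁) (hX₂ : Measurable X₂)
    (hY₁ : Measurable Y₁) (hY₂ : Measurable Y₂)
    (hindep : IndepFun (fun ω => (X₁ ω, Y₁ ω)) (fun ω => (X₂ ω, Y₂ ω)) μ) :
    ∀ᵐ ω ∂μ, 
      (condDistrib (fun ω => (X₁ ω + X₂ ω, X₂ ω)) (fun ω => (Y₁ ω, Y₂ ω)) μ (Y₁ ω, Y₂ ω)).real
        {(X₁ ω + X₂ ω, X₂ ω)} =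
      rr (bias X₁ Y₁ μ (Y₁ ω)) (X₁ ω) * rr (bias X₂ Y₂ μ (Y₂ ω)) (X₂ ω) := by
  have hf : Measurable (fun x : ZMod 2 × ZMod 2 => (x.1 + x.2, x.2)) := .of_discrete
  filter_upwards [ae_of_ae_map (hY₁.prodMk hY₂).aemeasurable (condDistrib_comp (μ := μ)
    (fun ω => (Y₁ ω, Y₂ ω)) (hX₁.prodMk hX₂).aemeasurable hf),
    joint_ae hX₁ hX₂ hY₁ hY₂ hindep] with ω hω h2
  have hω' : condDistrib (fun ω => (X₁ ω + X₂ ω, X₂ ω)) (fun ω => (Y₁ ω, Y₂ ω)) μ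
    (Y₁ ω, Y₂ ω) = _ := hω
  rw [hω', map_real _ hf, Finset.sum_eq_single (X₁ ω, X₂ ω), h2]
  · rintro ⟨a, b⟩ hab hne
    exfalso
    simp only [Finset.mem_filter, Finset.mem_univ, true_and, Prod.mk.injEq] at hab
    obtain ⟨h, rfl⟩ := hab
    exact hne (by rw [add_right_cancel h])
  · intro h; simp at h

lemma AB_ae (hX₁ : Measurable X₁) (hX₂ : Measurable X₂)
    (hY₁ : Measurable Y₁) (hY₂ : Measurable Y₂)
    (hindep : IndepFun (fun ω => (X₁ ω, Y₁ ω)) (fun ω => (X₂ ω, Y₂ ω)) μ) :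
    ∀ᵐ ω ∂μ, ent (fun ω => X₁ ω + X₂ ω) (fun ω => (Y₁ ω, Y₂ ω)) μ ω =
        LL (bias X₁ Y₁ μ (Y₁ ω) * bias X₂ Y₂ μ (Y₂ ω)) (X₁ ω + X₂ ω) ∧
      ent X₂ (fun ω => (X₁ ω + X₂ ω, (Y₁ ω, Y₂ ω))) μ ω =
        LL (bias X₁ Y₁ μ (Y₁ ω)) (X₁ ω) + LL (bias X₂ Y₂ μ (Y₂ ω)) (X₂ ω) -
        LL (bias X₁ Y₁ μ (Y₁ ω) * bias X₂ Y₂ μ (Y₂ ω)) (X₁ ω + X₂ ω) := by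
  have hU : Measurable (fun ω => X₁ ω + X₂ ω) := hX₁.add hX₂
  have hY := hY₁.prodMk hY₂
  filter_upwards [U1_ae hX₁ hX₂ hY₁ hY₂ hindep, pair_ae hX₁ hX₂ hY₁ hY₂ hindep,
    chain_ae (μ := μ) hX₂ hU hY, pos_ae (μ := μ) hX₁ hY₁, pos_ae (μ := μ) hX₂ hY₂,
    pos_ae (μ := μ) hU hY, pos_ae (μ := μ) hX₂ (hU.prodMk hY)] with ω h1 h2 h3 p1 p2 p3 p4
  have hA : ent (fun ω => X₁ ω + X₂ ω) (fun ω => (Y₁ ω, Y₂ ω)) μ ω =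
        LL (bias X₁ Y₁ μ (Y₁ ω) * bias X₂ Y₂ μ (Y₂ ω)) (X₁ ω + X₂ ω) := by
    rw [ent, h1, LL]
  refine ⟨hA, ?_⟩
  rw [← hA]
  rw [h2] at h3
  rw [real_eq_rr] at p1 p2
  have := congrArg Real.log h3
  rw [Real.log_mul p1.ne' p2.ne', Real.log_mul p3.ne' p4.ne'] at this
  simp only [LL, ent]
  linarith

end main

section concl
variable {Ω β₁ β₂ : Type*} [MeasurableSpace Ω] [MeasurableSpace β₁] [MeasurableSpace β₂]
  {μ : Measure Ω} [IsProbabilityMeasure μ] {X₁ X₂ : Ω → ZMod 2} {Y₁ : Ω → β₁} {Y₂ : Ω → β₂}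

lemma measurable_LL : Measurable (fun z : ℝ × ZMod 2 => LL z.1 z.2) := by
  have h : Measurable sg := .of_discrete
  have : Measurable (fun z : ℝ × ZMod 2 => rr z.1 z.2) :=
    ((((h.comp measurable_snd).mul measurable_fst).const_add 1).div_const 2)
  exact (Real.measurable_log.comp this).neg

lemma measurable_ph : Measurable ph := ph_continuous.measurable

set_option maxHeartbeats 1600000 in
lemma cov_main (hX₁ : Measurable X₁) (hX₂ : Measurable X₂)
    (hY₁ : Measurable Y₁) (hY₂ : Measurable Y₂)
    (hindep : IndepFun (fun ω => (X₁ ω, Y₁ ω)) (fun ω => (X₂ ω, Y₂ ω)) μ) :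
    let C := cov[ent (fun ω => X₁ ω + X₂ ω) (fun ω => (Y₁ ω, Y₂ ω)) μ,
      ent X₂ (fun ω => (X₁ ω + X₂ ω, (Y₁ ω, Y₂ ω))) μ; μ]
    0 ≤ C ∧ (C = 0 ↔ variance (ent X₁ Y₁ μ) μ = 0 ∨ variance (ent X₂ Y₂ μ) μ = 0) := by
  intro C
  have hU : Measurable (fun ω => X₁ ω + X₂ ω) := hX₁.add hX₂
  have hY := hY₁.prodMk hY₂
  have hX := hX₁.prodMk hX₂
  rw [var_zero_iff hX₁ hY₁, var_zero_iff hX₂ hY₂]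
  set D₁ : Ω → II := fun ω => bias X₁ Y₁ μ (Y₁ ω) with hD₁
  set D₂ : Ω → II := fun ω => bias X₂ Y₂ μ (Y₂ ω) with hD₂
  have mD₁ : Measurable D₁ := measurable_bias.comp hY₁
  have mD₂ : Measurable D₂ := measurable_bias.comp hY₂
  have i1 : IsProbabilityMeasure (μ.map D₁) := Measure.isProbabilityMeasure_map mD₁.aemeasurable
  have i2 : IsProbabilityMeasure (μ.map D₂) := Measure.isProbabilityMeasure_map mD₂.aemeasurable
  have hDi : IndepFun D₁ D₂ μ := hindep.comp (measurable_bias.comp measurable_snd)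
    (measurable_bias.comp measurable_snd)
  have hmap : μ.map (fun ω => (D₁ ω, D₂ ω)) = (μ.map D₁).prod (μ.map D₂) :=
    (indepFun_iff_map_prod_eq_prod_map_map mD₁.aemeasurable mD₂.aemeasurable).1 hDi
  have mD := (mD₁.prodMk mD₂)
  -- the two output variables
  have hAB := AB_ae hX₁ hX₂ hY₁ hY₂ hindep
  have lA : MemLp (ent (fun ω => X₁ ω + X₂ ω) (fun ω => (Y₁ ω, Y₂ ω)) μ) 2 μ := memLp_ent hU hY
  have lB : MemLp (ent X₂ (fun ω => (X₁ ω + X₂ ω, (Y₁ ω, Y₂ ω))) μ) 2 μ :=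
    memLp_ent hX₂ (hU.prodMk hY)
  let FA : (β₁ × β₂) × (ZMod 2 × ZMod 2) → ℝ := fun z =>
    LL (bias X₁ Y₁ μ z.1.1 * bias X₂ Y₂ μ z.1.2) (z.2.1 + z.2.2)
  let FB : (β₁ × β₂) × (ZMod 2 × ZMod 2) → ℝ := fun z =>
    LL (bias X₁ Y₁ μ z.1.1) z.2.1 + LL (bias X₂ Y₂ μ z.1.2) z.2.2 - FA z
  have mb1 : Measurable (fun z : (β₁ × β₂) × (ZMod 2 × ZMod 2) =>
      (bias X₁ Y₁ μ z.1.1 : ℝ)) :=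
    measurable_subtype_coe.comp (measurable_bias.comp (measurable_fst.comp measurable_fst))
  have mb2 : Measurable (fun z : (β₁ × β₂) × (ZMod 2 × ZMod 2) =>
      (bias X₂ Y₂ μ z.1.2 : ℝ)) :=
    measurable_subtype_coe.comp (measurable_bias.comp (measurable_snd.comp measurable_fst))
  have mx1 : Measurable (fun z : (β₁ × β₂) × (ZMod 2 × ZMod 2) => z.2.1) := by fun_prop
  have mx2 : Measurable (fun z : (β₁ × β₂) × (ZMod 2 × ZMod 2) => z.2.2) := by fun_prop
  have mFA : Measurable FA := measurable_LL.comp ((mb1.mul mb2).prodMk (mx1.add mx2))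
  have mFB : Measurable FB :=
    ((measurable_LL.comp (mb1.prodMk mx1)).add (measurable_LL.comp (mb2.prodMk mx2))).sub mFA
  have eA : ent (fun ω => X₁ ω + X₂ ω) (fun ω => (Y₁ ω, Y₂ ω)) μ =ᵐ[μ]
      fun ω => FA ((Y₁ ω, Y₂ ω), (X₁ ω, X₂ ω)) := hAB.mono fun ω h => h.1
  have eB : ent X₂ (fun ω => (X₁ ω + X₂ ω, (Y₁ ω, Y₂ ω))) μ =ᵐ[μ]
      fun ω => FB ((Y₁ ω, Y₂ ω), (X₁ ω, X₂ ω)) := hAB.mono fun ω h => h.2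
  have hj := joint_ae hX₁ hX₂ hY₁ hY₂ hindep
  have tA := integral_transfer hX hY mFA ((lA.integrable (by norm_num)).congr eA)
  have tB := integral_transfer hX hY mFB ((lB.integrable (by norm_num)).congr eB)
  have tAB := integral_transfer (F := fun z => FA z * FB z) hX hY (mFA.mul mFB)
    ((lA.integrable_mul lB).congr (eA.mul eB))
  have sA : (fun ω => ∑ x, (condDistrib (fun ω => (X₁ ω, X₂ ω)) (fun ω => (Y₁ ω, Y₂ ω)) μ
      (Y₁ ω, Y₂ ω)).real {x} * FA ((Y₁ ω, Y₂ ω), x)) =ᵐ[μ]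
      fun ω => ph (D₁ ω * D₂ ω) := by
    filter_upwards [hj] with ω h
    simp only [h]
    exact sumA _ _
  have sB : (fun ω => ∑ x, (condDistrib (fun ω => (X₁ ω, X₂ ω)) (fun ω => (Y₁ ω, Y₂ ω)) μ
      (Y₁ ω, Y₂ ω)).real {x} * FB ((Y₁ ω, Y₂ ω), x)) =ᵐ[μ]
      fun ω => gG (D₁ ω) (D₂ ω) := by
    filter_upwards [hj] with ω h
    simp only [h]
    exact sumB _ _
  have sAB : (fun ω => ∑ x, (condDistrib (fun ω => (X₁ ω, X₂ ω)) (fun ω => (Y₁ ω, Y₂ ω)) μ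
      (Y₁ ω, Y₂ ω)).real {x} * (FA ((Y₁ ω, Y₂ ω), x) * FB ((Y₁ ω, Y₂ ω), x))) =ᵐ[μ]
      fun ω => ph (D₁ ω * D₂ ω) * gG (D₁ ω) (D₂ ω) + cC (D₁ ω) (D₂ ω) := by
    filter_upwards [hj] with ω h
    simp only [h]
    exact sumAB _ _
  -- measurability on the square
  have c1 : Measurable (fun z : II × II => (z.1 : ℝ)) := measurable_subtype_coe.comp measurable_fst
  have c2 : Measurable (fun z : II × II => (z.2 : ℝ)) := measurable_subtype_coe.comp measurable_snd
  have mp : Measurable (fun z : II × II => ph (z.1 * z.2)) := measurable_ph.comp (c1.mul c2)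
  have mg : Measurable (fun z : II × II => gG z.1 z.2) :=
    ((measurable_ph.comp c1).add (measurable_ph.comp c2)).sub mp
  have mc : Measurable (fun z : II × II => cC z.1 z.2) := by
    unfold cC
    refine Measurable.sub (Finset.measurable_sum _ fun x _ => ?_) (mp.mul mg)
    have hr : ∀ x, Measurable (fun a : ℝ => rr a x) := fun x => by
      unfold rr; fun_prop
    have hl : ∀ x, Measurable (fun a : ℝ => LL a x) := fun x =>
      (Real.measurable_log.comp (hr x)).neg
    exact (((hr _).comp c1).mul ((hr _).comp c2)).mul (((hl _).comp (c1.mul c2)).mul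
      ((((hl _).comp c1).add ((hl _).comp c2)).sub ((hl _).comp (c1.mul c2))))
  have ipg : Integrable (fun ω => ph (D₁ ω * D₂ ω) * gG (D₁ ω) (D₂ ω)) μ := by
    refine .of_bound (C := Real.log 2 * (2 * Real.log 2))
      ((mp.mul mg).comp mD).aestronglyMeasurable (.of_forall fun ω => ?_)
    have k12 := ph_nonneg (iabs_mul (D₁ ω) (D₂ ω))
    have k1 := ph_nonneg (iabs (D₁ ω))
    have k2 := ph_nonneg (iabs (D₂ ω))
    have l12 := ph_le (D₁ ω * D₂ ω)
    have l1 := ph_le (D₁ ω)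
    have l2 := ph_le (D₂ ω)
    rw [Real.norm_eq_abs, abs_mul]
    refine mul_le_mul ?_ ?_ (abs_nonneg _) (k12.trans l12)
    · rw [abs_of_nonneg k12]; exact l12
    · unfold gG; rw [abs_le]; constructor <;> linarith
  have iAB := tAB.1.congr sAB
  have ic : Integrable (fun ω => cC (D₁ ω) (D₂ ω)) μ := by
    have := iAB.sub ipg
    refine this.congr (.of_forall fun ω => ?_)
    simp
  have push : ∀ {F : II × II → ℝ}, Measurable F →
      ∫ z, F z ∂((μ.map D₁).prod (μ.map D₂)) = ∫ ω, F (D₁ ω, D₂ ω) ∂μ := fun hF => by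
    rw [← hmap, integral_map mD.aemeasurable hF.aestronglyMeasurable]
  refine analytic (μ.map D₁) (μ.map D₂) ?_ ?_
  · rw [← hmap]
    exact (integrable_map_measure mc.aestronglyMeasurable mD.aemeasurable).2 ic
  · rw [push (F := fun z : II × II => ph (z.1 * z.2) * gG z.1 z.2) (mp.mul mg), push mp, push mg, push mc]
    have hC : C = _ := covariance_eq_sub lA lB
    rw [hC, integral_congr_ae (eA.mul eB), integral_congr_ae eA, integral_congr_ae eB]
    have e1 := tA.2.trans (integral_congr_ae sA)
    have e2 := tB.2.trans (integral_congr_ae sB)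
    have e3 := tAB.2.trans ((integral_congr_ae sAB).trans (integral_add ipg ic))
    rw [e1, e2]
    have e3' : ∫ ω, ((fun ω => FA ((Y₁ ω, Y₂ ω), (X₁ ω, X₂ ω))) *
      fun ω => FB ((Y₁ ω, Y₂ ω), (X₁ ω, X₂ ω))) ω ∂μ = _ := e3
    rw [e3']
    ring

lemma main_nat (hX₁ : Measurable X₁) (hX₂ : Measurable X₂)
    (hY₁ : Measurable Y₁) (hY₂ : Measurable Y₂)
    (hindep : IndepFun (fun ω => (X₁ ω, Y₁ ω)) (fun ω => (X₂ ω, Y₂ ω)) μ) :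
    ∃ C : ℝ, variance (ent (fun ω => X₁ ω + X₂ ω) (fun ω => (Y₁ ω, Y₂ ω)) μ) μ +
      variance (ent X₂ (fun ω => (X₁ ω + X₂ ω, (Y₁ ω, Y₂ ω))) μ) μ + 2 * C =
      variance (ent X₁ Y₁ μ) μ + variance (ent X₂ Y₂ μ) μ ∧
    0 ≤ C ∧ (C = 0 ↔ variance (ent X₁ Y₁ μ) μ = 0 ∨ variance (ent X₂ Y₂ μ) μ = 0) := by
  refine ⟨_, ?_, cov_main hX₁ hX₂ hY₁ hY₂ hindep⟩
  have hU : Measurable (fun ω => X₁ ω + X₂ ω) := hX₁.add hX₂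
  have hY := hY₁.prodMk hY₂
  have lA : MemLp (ent (fun ω => X₁ ω + X₂ ω) (fun ω => (Y₁ ω, Y₂ ω)) μ) 2 μ := memLp_ent hU hY
  have lB : MemLp (ent X₂ (fun ω => (X₁ ω + X₂ ω, (Y₁ ω, Y₂ ω))) μ) 2 μ :=
    memLp_ent hX₂ (hU.prodMk hY)
  have l1 : MemLp (ent X₁ Y₁ μ) 2 μ := memLp_ent hX₁ hY₁
  have l2 : MemLp (ent X₂ Y₂ μ) 2 μ := memLp_ent hX₂ hY₂
  have hm1 : Measurable (fun z : ZMod 2 × β₁ => - Real.log ((condDistrib X₁ Y₁ μ z.2).real {z.1})) :=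
    (Real.measurable_log.comp ((meas_sing _).comp measurable_swap)).neg
  have hm2 : Measurable (fun z : ZMod 2 × β₂ => - Real.log ((condDistrib X₂ Y₂ μ z.2).real {z.1})) :=
    (Real.measurable_log.comp ((meas_sing _).comp measurable_swap)).neg
  have hi : IndepFun (ent X₁ Y₁ μ) (ent X₂ Y₂ μ) μ := hindep.comp hm1 hm2
  rw [← IndepFun.variance_add l1 l2 hi]
  have hs : ent X₁ Y₁ μ + ent X₂ Y₂ μ =ᵐ[μ]
      ent (fun ω => X₁ ω + X₂ ω) (fun ω => (Y₁ ω, Y₂ ω)) μ +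
      ent X₂ (fun ω => (X₁ ω + X₂ ω, (Y₁ ω, Y₂ ω))) μ := by
    filter_upwards [AB_ae hX₁ hX₂ hY₁ hY₂ hindep] with ω h
    rw [Pi.add_apply, Pi.add_apply, h.1, h.2, ent_eq, ent_eq]
    ring
  rw [variance_congr hs, variance_add lA lB]
  ring

end concl

end PolarAux

section scale
variable {Ω β : Type*} [MeasurableSpace Ω] [MeasurableSpace β]

lemma PolarAux.varent_eq (X : Ω → ZMod 2) (Y : Ω → β) (μ : Measure Ω) [IsProbabilityMeasure μ] :
    varent X Y μ = ((Real.log 2)⁻¹) ^ 2 * variance (PolarAux.ent X Y μ) μ := by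
  rw [varent, ← variance_const_mul]
  congr 1
  funext ω
  simp only [entRV, PolarAux.ent, Real.logb, measureReal_def]
  ring

end scale

/-- Varentropy decreases under the polar transform, with equality iff one of the two
input varentropies vanishes. -/
theorem varentropy_polar_transform
    {Ω 𝒴₁ 𝒴₂ : Type*} [MeasurableSpace Ω] [MeasurableSpace 𝒴₁] [MeasurableSpace 𝒴₂]
    (μ : Measure Ω) [IsProbabilityMeasure μ]
    (X₁ X₂ : Ω → ZMod 2) (Y₁ : Ω → 𝒴₁) (Y₂ : Ω → 𝒴₂)
    (hX₁ : Measurable X₁) (hX₂ : Measurable X₂)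
    (hY₁ : Measurable Y₁) (hY₂ : Measurable Y₂)
    (hindep : IndepFun (fun ω => (X₁ ω, Y₁ ω)) (fun ω => (X₂ ω, Y₂ ω)) μ) :
    varent (fun ω => X₁ ω + X₂ ω) (fun ω => (Y₁ ω, Y₂ ω)) μ
        + varent X₂ (fun ω => (X₁ ω + X₂ ω, (Y₁ ω, Y₂ ω))) μ
      ≤ varent X₁ Y₁ μ + varent X₂ Y₂ μ
    ∧ (varent (fun ω => X₁ ω + X₂ ω) (fun ω => (Y₁ ω, Y₂ ω)) μ
          + varent X₂ (fun ω => (X₁ ω + X₂ ω, (Y₁ ω, Y₂ ω))) μ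
        = varent X₁ Y₁ μ + varent X₂ Y₂ μ
      ↔ varent X₁ Y₁ μ = 0 ∨ varent X₂ Y₂ μ = 0) := by
  obtain ⟨C, h1, h2, h3⟩ := PolarAux.main_nat (μ := μ) hX₁ hX₂ hY₁ hY₂ hindep
  simp only [PolarAux.varent_eq]
  have hl : 0 < ((Real.log 2)⁻¹) ^ 2 := by
    have := Real.log_pos one_lt_two
    positivity
  rw [← mul_add, ← mul_add, ← h1]
  refine ⟨mul_le_mul_of_nonneg_left (by linarith) hl.le, ?_⟩
  rw [mul_right_inj' hl.ne', mul_eq_zero, mul_eq_zero, or_iff_right hl.ne', or_iff_right hl.ne',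
    ← h3]
  constructor <;> intro h <;> linarith
end

section
/- Let (X1,Y1) and (X2,Y2) be BDEs on a common probability space such that the pair (X1,Y1) is independent of the pair (X2,Y2), and let h⁻ := h(U1|Ȳ) and h⁺ := h(U2|(U1,Ȳ)) be the entropy random variables at the output of the polar transform. Then Cov(h⁻, h⁺) ≥ 0, with equality if and only if Var(h(X1|Y1)) = 0 or Var(h(X2|Y2)) = 0. -/
open MeasureTheory ProbabilityTheory

/-- Covariance of two real random variables: `Cov(F,G) = E[FG] - E[F]E[G]`. -/
noncomputable def cov {Ω : Type*} [MeasurableSpace Ω] (μ : Measure Ω) (F G : Ω → ℝ) : ℝ :=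
  (∫ ω, F ω * G ω ∂μ) - (∫ ω, F ω ∂μ) * (∫ ω, G ω ∂μ)


/-- output bias -/
noncomputable def rr (p q : ℝ) : ℝ := p * (1 - q) + q * (1 - p)
noncomputable def FF (p q : ℝ) : ℝ := Real.binEntropy (rr p q)
noncomputable def GG (p q : ℝ) : ℝ := Real.binEntropy p + Real.binEntropy q - Real.binEntropy (rr p q)
noncomputable def AA (p q : ℝ) : ℝ := Real.binEntropy (p * (1 - q) / rr p q)
noncomputable def BB (p q : ℝ) : ℝ := Real.binEntropy (p * q / (1 - rr p q))
noncomputable def DD (p q : ℝ) : ℝ :=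
  rr p q * (1 - rr p q) * (Real.log (1 - rr p q) - Real.log (rr p q)) * (AA p q - BB p q)

lemma rr_comm (p q : ℝ) : rr p q = rr q p := by unfold rr; ring
lemma rr_one_sub (p q : ℝ) : rr (1 - p) q = 1 - rr p q := by unfold rr; ring
lemma FF_comm (p q : ℝ) : FF p q = FF q p := by unfold FF; rw [rr_comm]
lemma GG_comm (p q : ℝ) : GG p q = GG q p := by unfold GG; rw [rr_comm]; ring

lemma rr_nonneg {p q : ℝ} (hp : p ∈ Set.Icc (0:ℝ) 1) (hq : q ∈ Set.Icc (0:ℝ) 1) : 0 ≤ rr p q := by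
  obtain ⟨h0, h1⟩ := hp; obtain ⟨h2, h3⟩ := hq
  have := mul_nonneg h0 (sub_nonneg.2 h3)
  have := mul_nonneg h2 (sub_nonneg.2 h1)
  unfold rr; linarith

lemma rr_le_one {p q : ℝ} (hp : p ∈ Set.Icc (0:ℝ) 1) (hq : q ∈ Set.Icc (0:ℝ) 1) : rr p q ≤ 1 := by
  have h : (1 - p) ∈ Set.Icc (0:ℝ) 1 := ⟨by linarith [hp.2], by linarith [hp.1]⟩
  have := rr_nonneg h hq
  rw [rr_one_sub] at this; linarith

lemma rr_mem {p q : ℝ} (hp : p ∈ Set.Icc (0:ℝ) 1) (hq : q ∈ Set.Icc (0:ℝ) 1) :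
    rr p q ∈ Set.Icc (0:ℝ) 1 := ⟨rr_nonneg hp hq, rr_le_one hp hq⟩

/-- reduction to [0,1/2] -/
lemma exists_half (x : ℝ) (hx : x ∈ Set.Icc (0:ℝ) 1) :
    ∃ y ∈ Set.Icc (0:ℝ) 2⁻¹, (y = x ∨ y = 1 - x) ∧ y * (1 - y) = x * (1 - x) := by
  rcases le_total x 2⁻¹ with h | h
  · exact ⟨x, ⟨hx.1, h⟩, Or.inl rfl, rfl⟩
  · exact ⟨1 - x, ⟨by linarith [hx.2], by norm_num at *; linarith⟩, Or.inr rfl, by ring⟩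

lemma binEntropy_half (x : ℝ) {y : ℝ} (h : y = x ∨ y = 1 - x) :
    Real.binEntropy y = Real.binEntropy x := by
  rcases h with rfl | rfl
  · rfl
  · exact Real.binEntropy_one_sub x

lemma le_of_m_le {x y : ℝ} (hx : x ∈ Set.Icc (0:ℝ) 2⁻¹) (_hy : y ∈ Set.Icc (0:ℝ) 2⁻¹)
    (h : x * (1 - x) ≤ y * (1 - y)) : x ≤ y := by
  by_contra! hc
  have h1 := hx.2
  have : y < 2⁻¹ := lt_of_lt_of_le hc h1
  norm_num at h1 this
  nlinarith

lemma binEntropy_le {x y : ℝ} (hx : x ∈ Set.Icc (0:ℝ) 1) (hy : y ∈ Set.Icc (0:ℝ) 1)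
    (h : x * (1 - x) ≤ y * (1 - y)) : Real.binEntropy x ≤ Real.binEntropy y := by
  obtain ⟨x', hx', h1, h2⟩ := exists_half x hx
  obtain ⟨y', hy', h3, h4⟩ := exists_half y hy
  rw [← binEntropy_half x h1, ← binEntropy_half y h3]
  exact Real.binEntropy_strictMonoOn.monotoneOn hx' hy' (le_of_m_le hx' hy' (by linarith))

lemma binEntropy_lt {x y : ℝ} (hx : x ∈ Set.Icc (0:ℝ) 1) (hy : y ∈ Set.Icc (0:ℝ) 1)
    (h : x * (1 - x) < y * (1 - y)) : Real.binEntropy x < Real.binEntropy y := by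
  obtain ⟨x', hx', h1, h2⟩ := exists_half x hx
  obtain ⟨y', hy', h3, h4⟩ := exists_half y hy
  rw [← binEntropy_half x h1, ← binEntropy_half y h3]
  refine Real.binEntropy_strictMonoOn hx' hy' (lt_of_le_of_ne (le_of_m_le hx' hy' (by linarith)) ?_)
  rintro rfl
  linarith

lemma FF_mono {p p' q : ℝ} (hp : p ∈ Set.Icc (0:ℝ) 1) (hp' : p' ∈ Set.Icc (0:ℝ) 1)
    (hq : q ∈ Set.Icc (0:ℝ) 1) (h : p * (1 - p) ≤ p' * (1 - p')) : FF p q ≤ FF p' q := by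
  refine binEntropy_le (rr_mem hp hq) (rr_mem hp' hq) ?_
  unfold rr
  nlinarith [mul_le_mul_of_nonneg_right h (sq_nonneg (1 - 2 * q))]

lemma GG_one_sub (p q : ℝ) : GG (1 - p) q = GG p q := by
  unfold GG; rw [rr_one_sub, Real.binEntropy_one_sub, Real.binEntropy_one_sub]

lemma GG_half (x q : ℝ) {y : ℝ} (h : y = x ∨ y = 1 - x) : GG y q = GG x q := by
  rcases h with rfl | rfl
  · rfl
  · exact GG_one_sub x q

lemma GG_monoOn {q : ℝ} (hq : q ∈ Set.Icc (0:ℝ) 2⁻¹) :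
    MonotoneOn (fun p => GG p q) (Set.Icc (0:ℝ) 2⁻¹) := by
  have hd : ∀ x ∈ Set.Ioo (0:ℝ) 2⁻¹, HasDerivAt (fun p => GG p q)
      (Real.log (1 - x) - Real.log x
        - (Real.log (1 - rr x q) - Real.log (rr x q)) * (1 - 2 * q)) x := by
    intro x hx
    obtain ⟨h0, h1⟩ := hx
    obtain ⟨h2, h3⟩ := hq
    norm_num at h1 h3
    have r0 : 0 < rr x q := by unfold rr; nlinarith
    have r1 : rr x q < 1 := by unfold rr; nlinarith
    have e1 : HasDerivAt (fun p => rr p q) (1 - 2 * q) x := by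
      unfold rr
      have := ((hasDerivAt_id x).mul_const (1 - q)).add (((hasDerivAt_id x).const_sub 1).const_mul q)
      exact this.congr_deriv (by ring)
    have e2 := (Real.hasDerivAt_binEntropy r0.ne' r1.ne).comp x e1
    have e3 := Real.hasDerivAt_binEntropy h0.ne' (by linarith : x ≠ 1)
    exact (e3.add_const (Real.binEntropy q)).sub e2
  refine monotoneOn_of_deriv_nonneg (convex_Icc _ _) ?_ ?_ ?_
  · refine Continuous.continuousOn ?_
    unfold GG rr
    have := Real.binEntropy_continuous
    fun_prop
  · rw [interior_Icc]
    exact fun x hx => (hd x hx).differentiableAt.differentiableWithinAt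
  · rw [interior_Icc]
    intro x hx
    rw [(hd x hx).deriv]
    obtain ⟨h0, h1⟩ := hx
    obtain ⟨h2, h3⟩ := hq
    norm_num at h1 h3
    have r0 : x ≤ rr x q := by unfold rr; nlinarith
    have r1 : rr x q ≤ 1/2 := by unfold rr; nlinarith
    have l1 := Real.log_le_log h0 r0
    have l2 := Real.log_le_log (by linarith : 0 < 1 - rr x q) (by linarith : 1 - rr x q ≤ 1 - x)
    have l3 := Real.log_le_log (by linarith : 0 < rr x q) (by linarith : rr x q ≤ 1 - rr x q)
    nlinarith

lemma GG_mono {p p' q : ℝ} (hp : p ∈ Set.Icc (0:ℝ) 1) (hp' : p' ∈ Set.Icc (0:ℝ) 1)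
    (hq : q ∈ Set.Icc (0:ℝ) 1) (h : p * (1 - p) ≤ p' * (1 - p')) : GG p q ≤ GG p' q := by
  obtain ⟨x', hx', h1, h2⟩ := exists_half p hp
  obtain ⟨y', hy', h3, h4⟩ := exists_half p' hp'
  obtain ⟨z', hz', h5, h6⟩ := exists_half q hq
  rw [← GG_half p q h1, ← GG_half p' q h3, GG_comm x', GG_comm y', ← GG_half q _ h5,
    ← GG_half q _ h5, GG_comm z', GG_comm z']
  exact GG_monoOn hz' hx' hy' (le_of_m_le hx' hy' (by linarith))

lemma FF_mem {p q : ℝ} (hp : p ∈ Set.Icc (0:ℝ) 1) (hq : q ∈ Set.Icc (0:ℝ) 1) :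
    0 ≤ FF p q ∧ FF p q ≤ Real.log 2 :=
  ⟨Real.binEntropy_nonneg (rr_nonneg hp hq) (rr_le_one hp hq), Real.binEntropy_le_log_two⟩

/-- interior facts -/
lemma int_facts {p q : ℝ} (hp : p ∈ Set.Ioo (0:ℝ) 1) (hq : q ∈ Set.Ioo (0:ℝ) 1) :
    0 < p * q ∧ 0 < p * (1 - q) ∧ 0 < q * (1 - p) ∧ 0 < (1 - p) * (1 - q) ∧
    0 < rr p q ∧ 0 < 1 - rr p q := by
  obtain ⟨h0, h1⟩ := hp; obtain ⟨h2, h3⟩ := hq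
  have a := mul_pos h0 h2
  have b := mul_pos h0 (sub_pos.2 h3)
  have c := mul_pos h2 (sub_pos.2 h1)
  have d := mul_pos (sub_pos.2 h1) (sub_pos.2 h3)
  refine ⟨a, b, c, d, ?_, ?_⟩ <;> unfold rr <;> nlinarith

lemma mem_Ioo_or {p : ℝ} (hp : p ∈ Set.Icc (0:ℝ) 1) : p = 0 ∨ p = 1 ∨ p ∈ Set.Ioo (0:ℝ) 1 := by
  rcases hp.1.eq_or_lt with h | h
  · exact Or.inl h.symm
  · rcases hp.2.eq_or_lt with h' | h'
    · exact Or.inr (Or.inl h')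
    · exact Or.inr (Or.inr ⟨h, h'⟩)

/-- the conditional second moment -/
noncomputable def KK (p q : ℝ) : ℝ :=
  p * q * (-Real.log (1 - rr p q) * -Real.log (p * q / (1 - rr p q)))
  + (1 - p) * (1 - q) * (-Real.log (1 - rr p q) * -Real.log ((1 - p) * (1 - q) / (1 - rr p q)))
  + p * (1 - q) * (-Real.log (rr p q) * -Real.log (p * (1 - q) / rr p q))
  + (1 - p) * q * (-Real.log (rr p q) * -Real.log ((1 - p) * q / rr p q))

lemma GG_eq {p q : ℝ} (hp : p ∈ Set.Icc (0:ℝ) 1) (hq : q ∈ Set.Icc (0:ℝ) 1) :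
    GG p q = p * q * -Real.log (p * q / (1 - rr p q))
  + (1 - p) * (1 - q) * -Real.log ((1 - p) * (1 - q) / (1 - rr p q))
  + p * (1 - q) * -Real.log (p * (1 - q) / rr p q)
  + (1 - p) * q * -Real.log ((1 - p) * q / rr p q) := by
  rcases mem_Ioo_or hp with rfl | rfl | hp
  · rcases mem_Ioo_or hq with rfl | rfl | hq
    · simp [GG, rr]
    · simp [GG, rr]
    · have h1 := hq.1.ne'
      have h2 := (sub_pos.2 hq.2).ne'
      simp [GG, rr, h1, h2]
  · rcases mem_Ioo_or hq with rfl | rfl | hq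
    · simp [GG, rr]
    · simp [GG, rr]
    · have h1 := hq.1.ne'
      have h2 := (sub_pos.2 hq.2).ne'
      simp [GG, rr, h1, h2]
  · rcases mem_Ioo_or hq with rfl | rfl | hq
    · have h1 := hp.1.ne'
      have h2 := (sub_pos.2 hp.2).ne'
      simp [GG, rr, h1, h2]
    · have h1 := hp.1.ne'
      have h2 := (sub_pos.2 hp.2).ne'
      simp [GG, rr, h1, h2]
    · obtain ⟨a, b, c, d, e, f⟩ := int_facts hp hq
      have p0 := hp.1.ne'
      have q0 := hq.1.ne'
      have p1 := (sub_pos.2 hp.2).ne'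
      have q1 := (sub_pos.2 hq.2).ne'
      rw [mul_comm (1 - p) q]
      rw [Real.log_div a.ne' f.ne', Real.log_div b.ne' e.ne', Real.log_div c.ne' e.ne',
        Real.log_div d.ne' f.ne', Real.log_mul p0 q0, Real.log_mul p0 q1, Real.log_mul q0 p1,
        Real.log_mul p1 q1]
      unfold GG Real.binEntropy
      simp only [Real.log_inv]
      generalize h1 : Real.log (rr p q) = l1
      generalize h2 : Real.log (1 - rr p q) = l2
      unfold rr
      ring

lemma KK_eq {p q : ℝ} (hp : p ∈ Set.Icc (0:ℝ) 1) (hq : q ∈ Set.Icc (0:ℝ) 1) :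
    KK p q = FF p q * GG p q + DD p q := by
  rcases mem_Ioo_or hp with rfl | rfl | hp
  · rcases mem_Ioo_or hq with rfl | rfl | hq
    · simp [KK, FF, GG, DD, AA, BB, rr]
    · simp [KK, FF, GG, DD, AA, BB, rr]
    · have h1 := hq.1.ne'
      have h2 := (sub_pos.2 hq.2).ne'
      simp [KK, FF, GG, DD, AA, BB, rr, h1, h2]
  · rcases mem_Ioo_or hq with rfl | rfl | hq
    · simp [KK, FF, GG, DD, AA, BB, rr]
    · simp [KK, FF, GG, DD, AA, BB, rr]
    · have h1 := hq.1.ne'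
      have h2 := (sub_pos.2 hq.2).ne'
      simp [KK, FF, GG, DD, AA, BB, rr, h1, h2]
  · rcases mem_Ioo_or hq with rfl | rfl | hq
    · have h1 := hp.1.ne'
      have h2 := (sub_pos.2 hp.2).ne'
      simp [KK, FF, GG, DD, AA, BB, rr, h1, h2]
    · have h1 := hp.1.ne'
      have h2 := (sub_pos.2 hp.2).ne'
      simp [KK, FF, GG, DD, AA, BB, rr, h1, h2]
    · obtain ⟨a, b, c, d, e, f⟩ := int_facts hp hq
      rw [GG_eq (Set.Ioo_subset_Icc_self hp) (Set.Ioo_subset_Icc_self hq)]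
      unfold KK DD FF AA BB Real.binEntropy
      simp only [Real.log_inv]
      have k1 : 1 - p * (1 - q) / rr p q = (1 - p) * q / rr p q := by
        field_simp; unfold rr; ring
      have k2 : 1 - p * q / (1 - rr p q) = (1 - p) * (1 - q) / (1 - rr p q) := by
        field_simp; unfold rr; ring
      rw [k1, k2]
      generalize Real.log (p * (1 - q) / rr p q) = l1
      generalize Real.log ((1 - p) * q / rr p q) = l2
      generalize Real.log (p * q / (1 - rr p q)) = l3
      generalize Real.log ((1 - p) * (1 - q) / (1 - rr p q)) = l4
      generalize Real.log (rr p q) = l5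
      generalize Real.log (1 - rr p q) = l6
      have e' := e.ne'
      have f' := f.ne'
      field_simp
      unfold rr
      ring

/-- degenerate parameters -/
def TT : Set ℝ := {p | p = 0 ∨ p = 1 ∨ p = 2⁻¹}

lemma DD_pos {p q : ℝ} (hp : p ∈ Set.Icc (0:ℝ) 1) (hq : q ∈ Set.Icc (0:ℝ) 1)
    (hp' : p ∉ TT) (hq' : q ∉ TT) : 0 < DD p q := by
  simp only [TT, Set.mem_ofPred_eq, not_or] at hp' hq'
  have hp1 : p ∈ Set.Ioo (0:ℝ) 1 := by
    rcases mem_Ioo_or hp with h | h | h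
    · exact absurd h hp'.1
    · exact absurd h hp'.2.1
    · exact h
  have hq1 : q ∈ Set.Ioo (0:ℝ) 1 := by
    rcases mem_Ioo_or hq with h | h | h
    · exact absurd h hq'.1
    · exact absurd h hq'.2.1
    · exact h
  obtain ⟨a, b, c, d, e, f⟩ := int_facts hp1 hq1
  have hA : p * (1 - q) / rr p q ∈ Set.Icc (0:ℝ) 1 :=
    ⟨by positivity, by rw [div_le_one e]; unfold rr; linarith⟩
  have hB : p * q / (1 - rr p q) ∈ Set.Icc (0:ℝ) 1 :=
    ⟨by positivity, by rw [div_le_one f]; unfold rr; linarith⟩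
  have mA : p * (1 - q) / rr p q * (1 - p * (1 - q) / rr p q)
      = (p * q * ((1 - p) * (1 - q))) / (rr p q) ^ 2 := by
    have : 1 - p * (1 - q) / rr p q = (1 - p) * q / rr p q := by
      field_simp; unfold rr; ring
    rw [this]; field_simp
  have mB : p * q / (1 - rr p q) * (1 - p * q / (1 - rr p q))
      = (p * q * ((1 - p) * (1 - q))) / (1 - rr p q) ^ 2 := by
    have : 1 - p * q / (1 - rr p q) = (1 - p) * (1 - q) / (1 - rr p q) := by
      field_simp; unfold rr; ring
    rw [this]; field_simp
  have hne : rr p q ≠ 1 - rr p q := by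
    intro h
    have : (1 - 2 * p) * (1 - 2 * q) = 0 := by unfold rr at h; linarith
    rcases mul_eq_zero.1 this with h | h
    · exact hp'.2.2 (by norm_num; linarith)
    · exact hq'.2.2 (by norm_num; linarith)
  have hm := mul_pos a d
  unfold DD
  rw [mul_assoc]
  refine mul_pos (mul_pos e f) ?_
  rcases lt_or_gt_of_ne hne with h | h
  · refine mul_pos (sub_pos.2 (Real.log_lt_log e h)) (sub_pos.2 ?_)
    refine binEntropy_lt hB hA ?_
    rw [mA, mB]
    exact div_lt_div_of_pos_left hm (by positivity) (by gcongr)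
  · refine mul_pos_of_neg_of_neg (sub_neg.2 (Real.log_lt_log f h)) (sub_neg.2 ?_)
    refine binEntropy_lt hA hB ?_
    rw [mA, mB]
    exact div_lt_div_of_pos_left hm (by positivity) (by gcongr)

lemma DD_comm {p q : ℝ} (hp : p ∈ Set.Icc (0:ℝ) 1) (hq : q ∈ Set.Icc (0:ℝ) 1) :
    DD p q = DD q p := by
  have h1 := KK_eq hp hq
  have h2 := KK_eq hq hp
  have : KK p q = KK q p := by
    unfold KK; rw [rr_comm q p, mul_comm q p, mul_comm q (1 - p), mul_comm (1 - q) (1 - p),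
      mul_comm (1 - q) p]; ring
  rw [FF_comm q p, GG_comm q p] at h2
  linarith

lemma DD_zero {p q : ℝ} (hp : p ∈ TT) : DD p q = 0 := by
  rcases hp with rfl | rfl | rfl
  · simp [DD, AA, BB, rr]
  · by_cases h : 1 - q = 0
    · simp [DD, rr, h]
    by_cases h' : q = 0
    · simp [DD, rr, h']
    simp [DD, AA, BB, rr, h, h']
  · have : rr 2⁻¹ q = 2⁻¹ := by unfold rr; ring
    simp only [DD, this]; norm_num

lemma DD_nonneg {p q : ℝ} (hp : p ∈ Set.Icc (0:ℝ) 1) (hq : q ∈ Set.Icc (0:ℝ) 1) : 0 ≤ DD p q := by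
  by_cases h : p ∈ TT
  · rw [DD_zero h]
  by_cases h' : q ∈ TT
  · rw [DD_comm hp hq, DD_zero h']
  exact (DD_pos hp hq h h').le

lemma FF_T {p q : ℝ} (hp : p ∈ TT) :
    FF p q = Real.binEntropy p + Real.binEntropy q - Real.binEntropy p * Real.binEntropy q / Real.log 2 := by
  have hl : Real.log 2 ≠ 0 := (Real.log_pos one_lt_two).ne'
  rcases hp with rfl | rfl | rfl
  · simp [FF, rr]
  · simp [FF, rr]
  · have : rr 2⁻¹ q = 2⁻¹ := by unfold rr; ring
    simp only [FF, this, Real.binEntropy_two_inv]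
    field_simp; ring

lemma GG_T {p q : ℝ} (hp : p ∈ TT) :
    GG p q = Real.binEntropy p * Real.binEntropy q / Real.log 2 := by
  have := FF_T (q := q) hp
  unfold FF at this; unfold GG; rw [this]; ring

lemma HH_T {p : ℝ} (hp : p ∈ TT) : Real.binEntropy p * Real.binEntropy p = Real.log 2 * Real.binEntropy p := by
  rcases hp with rfl | rfl | rfl
  · simp
  · simp
  · rw [Real.binEntropy_two_inv]

lemma FFGG_T {p q : ℝ} (hp : p ∈ TT) : FF p q * GG p q = Real.binEntropy p * Real.binEntropy q := by
  have hl : Real.log 2 ≠ 0 := (Real.log_pos one_lt_two).ne'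
  have := HH_T hp
  rw [FF_T hp, GG_T hp]
  field_simp
  linear_combination (Real.binEntropy q * (Real.log 2 - Real.binEntropy q)) * this


lemma integrable_of_bdd {α : Type*} [MeasurableSpace α] (ν : Measure α) [IsProbabilityMeasure ν]
    {f : α → ℝ} (hf : Measurable f) {C : ℝ} (h : ∀ x, |f x| ≤ C) : Integrable f ν :=
  Integrable.of_bound hf.aestronglyMeasurable C (Filter.Eventually.of_forall h)

lemma chebyshev {α : Type*} [MeasurableSpace α] (ν : Measure α) [IsProbabilityMeasure ν]
    {f g : α → ℝ} (hf : Integrable f ν) (hg : Integrable g ν)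
    (hfg : Integrable (fun x => f x * g x) ν)
    (h : ∀ x y, 0 ≤ (f x - f y) * (g x - g y)) :
    (∫ x, f x ∂ν) * (∫ x, g x ∂ν) ≤ ∫ x, f x * g x ∂ν := by
  have h1 : ∀ y, 0 ≤ (∫ x, f x * g x ∂ν) - (∫ x, f x ∂ν) * g y - f y * (∫ x, g x ∂ν) + f y * g y := by
    intro y
    have : 0 ≤ ∫ x, (f x - f y) * (g x - g y) ∂ν := integral_nonneg fun x => h x y
    have e : ∫ x, (f x - f y) * (g x - g y) ∂ν
        = ∫ x, (f x * g x - f x * g y - f y * g x + f y * g y) ∂ν := by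
      congr 1; ext x; ring
    have j1 : Integrable (fun x => f x * g x - f x * g y) ν := hfg.sub (hf.mul_const _)
    have j2 : Integrable (fun x => f x * g x - f x * g y - f y * g x) ν := j1.sub (hg.const_mul _)
    rw [e, integral_add j2 (integrable_const _),
      integral_sub j1 (hg.const_mul _), integral_sub hfg (hf.mul_const _),
      integral_mul_const, integral_const_mul] at this
    simpa using this
  have h2 : 0 ≤ ∫ y, ((∫ x, f x * g x ∂ν) - (∫ x, f x ∂ν) * g y - f y * (∫ x, g x ∂ν) + f y * g y) ∂ν :=
    integral_nonneg fun y => h1 y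
  have j1 : Integrable (fun y => (∫ x, f x * g x ∂ν) - (∫ x, f x ∂ν) * g y) ν :=
    (integrable_const _).sub (hg.const_mul _)
  have j2 : Integrable (fun y => (∫ x, f x * g x ∂ν) - (∫ x, f x ∂ν) * g y
    - f y * (∫ x, g x ∂ν)) ν := j1.sub (hf.mul_const _)
  rw [integral_add j2 hfg, integral_sub j1 (hf.mul_const _),
    integral_sub (integrable_const _) (hg.const_mul _), integral_mul_const, integral_const_mul] at h2
  simp at h2
  linarith

lemma measurable_FF : Measurable (fun z : ℝ × ℝ => FF z.1 z.2) := by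
  unfold FF rr
  have := Real.binEntropy_continuous.measurable
  fun_prop

lemma measurable_GG : Measurable (fun z : ℝ × ℝ => GG z.1 z.2) := by
  unfold GG rr
  have := Real.binEntropy_continuous.measurable
  fun_prop

lemma measurable_DD : Measurable (fun z : ℝ × ℝ => DD z.1 z.2) := by
  unfold DD AA BB rr
  have := Real.binEntropy_continuous.measurable
  have := Real.measurable_log
  fun_prop

lemma abs_bin_le {p : ℝ} (hp : p ∈ Set.Icc (0:ℝ) 1) : |Real.binEntropy p| ≤ Real.log 2 := by
  rw [abs_of_nonneg (Real.binEntropy_nonneg hp.1 hp.2)]; exact Real.binEntropy_le_log_two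

lemma abs_FF_le {p q : ℝ} (hp : p ∈ Set.Icc (0:ℝ) 1) (hq : q ∈ Set.Icc (0:ℝ) 1) :
    |FF p q| ≤ Real.log 2 := abs_bin_le (rr_mem hp hq)

lemma abs_GG_le {p q : ℝ} (hp : p ∈ Set.Icc (0:ℝ) 1) (hq : q ∈ Set.Icc (0:ℝ) 1) :
    |GG p q| ≤ 3 * Real.log 2 := by
  have h1 := abs_le.1 (abs_bin_le hp)
  have h2 := abs_le.1 (abs_bin_le hq)
  have h3 := abs_le.1 (abs_bin_le (rr_mem hp hq))
  unfold GG
  rw [abs_le]; constructor <;> linarith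

lemma mul_log_bdd {x : ℝ} (h0 : 0 ≤ x) (h1 : x ≤ 1) : |x * Real.log x| ≤ 1 := by
  rcases h0.eq_or_lt with h | h
  · simp [← h]
  · rw [mul_comm]; exact (Real.abs_log_mul_self_lt x h h1).le

lemma abs_DD_le {p q : ℝ} (hp : p ∈ Set.Icc (0:ℝ) 1) (hq : q ∈ Set.Icc (0:ℝ) 1) :
    |DD p q| ≤ 4 * Real.log 2 := by
  have hr := rr_mem hp hq
  have hL : 0 < Real.log 2 := Real.log_pos one_lt_two
  have hA : |AA p q| ≤ Real.log 2 := by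
    refine abs_bin_le ⟨div_nonneg (mul_nonneg hp.1 (sub_nonneg.2 hq.2)) hr.1, div_le_one_of_le₀ ?_ hr.1⟩
    unfold rr
    linarith [mul_nonneg hq.1 (sub_nonneg.2 hp.2)]
  have hB : |BB p q| ≤ Real.log 2 := by
    refine abs_bin_le ⟨div_nonneg (mul_nonneg hp.1 hq.1) (sub_nonneg.2 hr.2),
      div_le_one_of_le₀ ?_ (sub_nonneg.2 hr.2)⟩
    unfold rr
    linarith [mul_nonneg (sub_nonneg.2 hq.2) (sub_nonneg.2 hp.2)]
  have hAB : |AA p q - BB p q| ≤ 2 * Real.log 2 := by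
    have := abs_sub (AA p q) (BB p q); linarith
  have l1 := mul_log_bdd hr.1 hr.2
  have l2 := mul_log_bdd (sub_nonneg.2 hr.2) (by linarith [hr.1])
  have hC : |rr p q * (1 - rr p q) * (Real.log (1 - rr p q) - Real.log (rr p q))| ≤ 2 := by
    have : rr p q * (1 - rr p q) * (Real.log (1 - rr p q) - Real.log (rr p q))
      = rr p q * ((1 - rr p q) * Real.log (1 - rr p q)) - (1 - rr p q) * (rr p q * Real.log (rr p q)) := by
      ring
    rw [this]
    refine (abs_sub _ _).trans ?_
    rw [abs_mul (rr p q), abs_mul (1 - rr p q) (rr p q * _), abs_of_nonneg hr.1, abs_of_nonneg (sub_nonneg.2 hr.2)]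
    have := mul_le_mul hr.2 l2 (abs_nonneg _) zero_le_one
    have := mul_le_mul (by linarith [hr.1] : 1 - rr p q ≤ 1) l1 (abs_nonneg _) zero_le_one
    linarith
  unfold DD
  rw [abs_mul]
  have := mul_le_mul hC hAB (abs_nonneg _) zero_le_two
  linarith

section prodpart

variable {α β : Type*} [MeasurableSpace α] [MeasurableSpace β]

/-- covariance functional in terms of the biases -/
noncomputable def CC (ν : Measure (α × β)) (p : α → ℝ) (q : β → ℝ) : ℝ :=
  (∫ z, KK (p z.1) (q z.2) ∂ν) - (∫ z, FF (p z.1) (q z.2) ∂ν) * (∫ z, GG (p z.1) (q z.2) ∂ν)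

variable (ν₁ : Measure α) (ν₂ : Measure β) [IsProbabilityMeasure ν₁] [IsProbabilityMeasure ν₂]
  {p : α → ℝ} {q : β → ℝ}

lemma int_FF (hp : Measurable p) (hq : Measurable q)
    (hp1 : ∀ x, p x ∈ Set.Icc (0:ℝ) 1) (hq1 : ∀ x, q x ∈ Set.Icc (0:ℝ) 1) :
    Integrable (fun z : α × β => FF (p z.1) (q z.2)) (ν₁.prod ν₂) :=
  integrable_of_bdd _ (measurable_FF.comp (by fun_prop : Measurable fun z : α × β => (p z.1, q z.2)))
    fun z => abs_FF_le (hp1 _) (hq1 _)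

lemma int_GG (hp : Measurable p) (hq : Measurable q)
    (hp1 : ∀ x, p x ∈ Set.Icc (0:ℝ) 1) (hq1 : ∀ x, q x ∈ Set.Icc (0:ℝ) 1) :
    Integrable (fun z : α × β => GG (p z.1) (q z.2)) (ν₁.prod ν₂) :=
  integrable_of_bdd _ (measurable_GG.comp (by fun_prop : Measurable fun z : α × β => (p z.1, q z.2)))
    fun z => abs_GG_le (hp1 _) (hq1 _)

lemma int_DD (hp : Measurable p) (hq : Measurable q)
    (hp1 : ∀ x, p x ∈ Set.Icc (0:ℝ) 1) (hq1 : ∀ x, q x ∈ Set.Icc (0:ℝ) 1) :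
    Integrable (fun z : α × β => DD (p z.1) (q z.2)) (ν₁.prod ν₂) :=
  integrable_of_bdd _ (measurable_DD.comp (by fun_prop : Measurable fun z : α × β => (p z.1, q z.2)))
    fun z => abs_DD_le (hp1 _) (hq1 _)

lemma int_FG (hp : Measurable p) (hq : Measurable q)
    (hp1 : ∀ x, p x ∈ Set.Icc (0:ℝ) 1) (hq1 : ∀ x, q x ∈ Set.Icc (0:ℝ) 1) :
    Integrable (fun z : α × β => FF (p z.1) (q z.2) * GG (p z.1) (q z.2)) (ν₁.prod ν₂) :=
  integrable_of_bdd _ ((measurable_FF.mul measurable_GG).comp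
      (by fun_prop : Measurable fun z : α × β => (p z.1, q z.2)))
    (C := Real.log 2 * (3 * Real.log 2))
    fun z => by
      rw [abs_mul]
      exact mul_le_mul (abs_FF_le (hp1 _) (hq1 _)) (abs_GG_le (hp1 _) (hq1 _)) (abs_nonneg _)
        (Real.log_pos one_lt_two).le

lemma harris (hp : Measurable p) (hq : Measurable q)
    (hp1 : ∀ x, p x ∈ Set.Icc (0:ℝ) 1) (hq1 : ∀ x, q x ∈ Set.Icc (0:ℝ) 1) :
    (∫ z, FF (p z.1) (q z.2) ∂(ν₁.prod ν₂)) * (∫ z, GG (p z.1) (q z.2) ∂(ν₁.prod ν₂))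
      ≤ ∫ z, FF (p z.1) (q z.2) * GG (p z.1) (q z.2) ∂(ν₁.prod ν₂) := by
  have iF := int_FF ν₁ ν₂ hp hq hp1 hq1
  have iG := int_GG ν₁ ν₂ hp hq hp1 hq1
  have iFG := int_FG ν₁ ν₂ hp hq hp1 hq1
  have L0 : 0 ≤ Real.log 2 := (Real.log_pos one_lt_two).le
  have mF : ∀ x, Measurable fun y => FF (p x) (q y) := fun x =>
    measurable_FF.comp (by fun_prop : Measurable fun y : β => (p x, q y))
  have mG : ∀ x, Measurable fun y => GG (p x) (q y) := fun x =>
    measurable_GG.comp (by fun_prop : Measurable fun y : β => (p x, q y))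
  have sF : ∀ x, Integrable (fun y => FF (p x) (q y)) ν₂ := fun x =>
    integrable_of_bdd _ (mF x) fun y => abs_FF_le (hp1 _) (hq1 _)
  have sG : ∀ x, Integrable (fun y => GG (p x) (q y)) ν₂ := fun x =>
    integrable_of_bdd _ (mG x) fun y => abs_GG_le (hp1 _) (hq1 _)
  have sFG : ∀ x, Integrable (fun y => FF (p x) (q y) * GG (p x) (q y)) ν₂ := fun x =>
    integrable_of_bdd _ ((mF x).mul (mG x)) (C := Real.log 2 * (3 * Real.log 2)) fun z => by
      rw [abs_mul]
      exact mul_le_mul (abs_FF_le (hp1 _) (hq1 _)) (abs_GG_le (hp1 _) (hq1 _)) (abs_nonneg _) L0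
  rw [integral_prod _ iF, integral_prod _ iG, integral_prod _ iFG]
  have jF := iF.integral_prod_left
  have jG := iG.integral_prod_left
  have jFG := iFG.integral_prod_left
  have bF : ∀ x, |∫ y, FF (p x) (q y) ∂ν₂| ≤ Real.log 2 := fun x => by
    have := norm_integral_le_of_norm_le_const (μ := ν₂) (f := fun y => FF (p x) (q y))
      (Filter.Eventually.of_forall fun y => abs_FF_le (hp1 x) (hq1 y))
    simpa using this
  have jP : Integrable (fun x => (∫ y, FF (p x) (q y) ∂ν₂) * ∫ y, GG (p x) (q y) ∂ν₂) ν₁ :=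
    jG.bdd_mul jF.aestronglyMeasurable (Filter.Eventually.of_forall bF)
  refine (chebyshev ν₁ jF jG jP ?_).trans (integral_mono jP jFG fun x =>
    chebyshev ν₂ (sF x) (sG x) (sFG x) ?_)
  · intro x y
    rcases le_total (p x * (1 - p x)) (p y * (1 - p y)) with h | h
    · exact mul_nonneg_of_nonpos_of_nonpos
        (sub_nonpos.2 (integral_mono (sF x) (sF y) fun z => FF_mono (hp1 _) (hp1 _) (hq1 _) h))
        (sub_nonpos.2 (integral_mono (sG x) (sG y) fun z => GG_mono (hp1 _) (hp1 _) (hq1 _) h))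
    · exact mul_nonneg
        (sub_nonneg.2 (integral_mono (sF y) (sF x) fun z => FF_mono (hp1 _) (hp1 _) (hq1 _) h))
        (sub_nonneg.2 (integral_mono (sG y) (sG x) fun z => GG_mono (hp1 _) (hp1 _) (hq1 _) h))
  · intro y z
    simp only [FF_comm (p x), GG_comm (p x)]
    rcases le_total (q y * (1 - q y)) (q z * (1 - q z)) with h | h
    · exact mul_nonneg_of_nonpos_of_nonpos
        (sub_nonpos.2 (FF_mono (hq1 _) (hq1 _) (hp1 _) h))
        (sub_nonpos.2 (GG_mono (hq1 _) (hq1 _) (hp1 _) h))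
    · exact mul_nonneg
        (sub_nonneg.2 (FF_mono (hq1 _) (hq1 _) (hp1 _) h))
        (sub_nonneg.2 (GG_mono (hq1 _) (hq1 _) (hp1 _) h))

lemma CC_eq (hp : Measurable p) (hq : Measurable q)
    (hp1 : ∀ x, p x ∈ Set.Icc (0:ℝ) 1) (hq1 : ∀ x, q x ∈ Set.Icc (0:ℝ) 1) :
    CC (ν₁.prod ν₂) p q = (∫ z, DD (p z.1) (q z.2) ∂(ν₁.prod ν₂))
      + ((∫ z, FF (p z.1) (q z.2) * GG (p z.1) (q z.2) ∂(ν₁.prod ν₂)) -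
    (∫ z, FF (p z.1) (q z.2) ∂(ν₁.prod ν₂)) * (∫ z, GG (p z.1) (q z.2) ∂(ν₁.prod ν₂))) := by
  unfold CC
  simp_rw [fun z : α × β => KK_eq (hp1 z.1) (hq1 z.2)]
  rw [integral_add (int_FG ν₁ ν₂ hp hq hp1 hq1) (int_DD ν₁ ν₂ hp hq hp1 hq1)]
  ring

lemma CC_nonneg (hp : Measurable p) (hq : Measurable q)
    (hp1 : ∀ x, p x ∈ Set.Icc (0:ℝ) 1) (hq1 : ∀ x, q x ∈ Set.Icc (0:ℝ) 1) :
    0 ≤ CC (ν₁.prod ν₂) p q := by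
  rw [CC_eq ν₁ ν₂ hp hq hp1 hq1]
  have := harris ν₁ ν₂ hp hq hp1 hq1
  have := integral_nonneg (μ := ν₁.prod ν₂) (f := fun z : α × β => DD (p z.1) (q z.2))
    fun z => DD_nonneg (hp1 z.1) (hq1 z.2)
  linarith

lemma CC_swap (hp : Measurable p) (hq : Measurable q)
    (hp1 : ∀ x, p x ∈ Set.Icc (0:ℝ) 1) (hq1 : ∀ x, q x ∈ Set.Icc (0:ℝ) 1) :
    CC (ν₂.prod ν₁) q p = CC (ν₁.prod ν₂) p q := by
  have hK : ∀ z : β × α, KK (q z.1) (p z.2) = KK (p z.2) (q z.1) := fun z => by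
    rw [KK_eq (hp1 _) (hq1 _), KK_eq (hq1 _) (hp1 _), DD_comm (hp1 _) (hq1 _), FF_comm, GG_comm]
  unfold CC
  simp_rw [hK, fun z : β × α => FF_comm (q z.1) (p z.2), fun z : β × α => GG_comm (q z.1) (p z.2)]
  rw [← integral_prod_swap (μ := ν₁) (ν := ν₂) (fun z : α × β => KK (p z.1) (q z.2)),
    ← integral_prod_swap (μ := ν₁) (ν := ν₂) (fun z : α × β => FF (p z.1) (q z.2)),
    ← integral_prod_swap (μ := ν₁) (ν := ν₂) (fun z : α × β => GG (p z.1) (q z.2))]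
  simp only [Prod.fst_swap, Prod.snd_swap]


lemma CC_T (hp : Measurable p) (hq : Measurable q)
    (hp1 : ∀ x, p x ∈ Set.Icc (0:ℝ) 1) (hq1 : ∀ x, q x ∈ Set.Icc (0:ℝ) 1)
    (hT : ∀ᵐ x ∂ν₁, p x ∈ TT) :
    CC (ν₁.prod ν₂) p q = (∫ x, Real.binEntropy (p x) ∂ν₁) * (∫ y, Real.binEntropy (q y) ∂ν₂)
      * (Real.log 2 - ∫ x, Real.binEntropy (p x) ∂ν₁)
      * (Real.log 2 - ∫ y, Real.binEntropy (q y) ∂ν₂) / Real.log 2 ^ 2 := by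
  have hT' : ∀ᵐ z ∂(ν₁.prod ν₂), p z.1 ∈ TT :=
    Measure.quasiMeasurePreserving_fst.ae hT
  have hL : Real.log 2 ≠ 0 := (Real.log_pos one_lt_two).ne'
  have mH := Real.binEntropy_continuous.measurable
  have i1 : Integrable (fun x => Real.binEntropy (p x)) ν₁ :=
    integrable_of_bdd _ (mH.comp hp) fun x => abs_bin_le (hp1 x)
  have i2 : Integrable (fun x => Real.binEntropy (q x)) ν₂ :=
    integrable_of_bdd _ (mH.comp hq) fun x => abs_bin_le (hq1 x)
  have i1' := i1.comp_fst ν₂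
  have i2' := i2.comp_snd ν₁
  have i12 := i1.mul_prod i2
  rw [CC_eq ν₁ ν₂ hp hq hp1 hq1]
  have e0 : ∫ z, DD (p z.1) (q z.2) ∂(ν₁.prod ν₂) = 0 :=
    integral_eq_zero_of_ae (hT'.mono fun z hz => DD_zero hz)
  have e12 := integral_prod_mul (μ := ν₁) (ν := ν₂) (fun x => Real.binEntropy (p x))
    (fun y => Real.binEntropy (q y))
  have e1 : ∫ z, FF (p z.1) (q z.2) * GG (p z.1) (q z.2) ∂(ν₁.prod ν₂) =
      ∫ z, Real.binEntropy (p z.1) * Real.binEntropy (q z.2) ∂(ν₁.prod ν₂) :=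
    integral_congr_ae (hT'.mono fun z hz => FFGG_T hz)
  have e2 : ∫ z, GG (p z.1) (q z.2) ∂(ν₁.prod ν₂) =
      ∫ z, Real.binEntropy (p z.1) * Real.binEntropy (q z.2) / Real.log 2 ∂(ν₁.prod ν₂) :=
    integral_congr_ae (hT'.mono fun z hz => GG_T hz)
  have e3 : ∫ z, FF (p z.1) (q z.2) ∂(ν₁.prod ν₂) =
      ∫ z, (Real.binEntropy (p z.1) + Real.binEntropy (q z.2)
        - Real.binEntropy (p z.1) * Real.binEntropy (q z.2) / Real.log 2) ∂(ν₁.prod ν₂) :=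
    integral_congr_ae (hT'.mono fun z hz => FF_T hz)
  have i3 : Integrable (fun z : α × β => Real.binEntropy (p z.1) + Real.binEntropy (q z.2))
      (ν₁.prod ν₂) := i1'.add i2'
  rw [integral_sub i3 (i12.div_const _), integral_add i1' i2', integral_div, e12,
    integral_fun_fst (μ := ν₁) (ν := ν₂) (f := fun x => Real.binEntropy (p x)),
    integral_fun_snd (μ := ν₁) (ν := ν₂) (f := fun x => Real.binEntropy (q x))] at e3
  rw [integral_div, e12] at e2
  rw [e12] at e1
  rw [e0, e1, e2, e3]
  simp only [probReal_univ, one_smul]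
  field_simp
  ring

/-- degenerate bias -/
def Deg (ν : Measure α) (p : α → ℝ) : Prop :=
  (∀ᵐ x ∂ν, p x = 0 ∨ p x = 1) ∨ (∀ᵐ x ∂ν, p x = 2⁻¹)

lemma Deg_T {p : α → ℝ} (h : Deg ν₁ p) : ∀ᵐ x ∂ν₁, p x ∈ TT := by
  rcases h with h | h
  · filter_upwards [h] with x hx
    rcases hx with hx | hx
    · exact Or.inl hx
    · exact Or.inr (Or.inl hx)
  · filter_upwards [h] with x hx using Or.inr (Or.inr hx)

lemma Deg_iff (hp : Measurable p) (hp1 : ∀ x, p x ∈ Set.Icc (0:ℝ) 1) :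
    Deg ν₁ p ↔ (∫ x, Real.binEntropy (p x) ∂ν₁) = 0 ∨ (∫ x, Real.binEntropy (p x) ∂ν₁) = Real.log 2 := by
  have mH := Real.binEntropy_continuous.measurable
  have i1 : Integrable (fun x => Real.binEntropy (p x)) ν₁ :=
    integrable_of_bdd _ (mH.comp hp) fun x => abs_bin_le (hp1 x)
  have h1 := integral_eq_zero_iff_of_nonneg (μ := ν₁) (f := fun x => Real.binEntropy (p x))
    (fun x => Real.binEntropy_nonneg (hp1 x).1 (hp1 x).2) i1
  have h2 := integral_eq_zero_iff_of_nonneg (μ := ν₁) (f := fun x => Real.log 2 - Real.binEntropy (p x))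
    (fun x => sub_nonneg.2 Real.binEntropy_le_log_two) ((integrable_const _).sub i1)
  rw [integral_sub (integrable_const _) i1] at h2
  simp only [integral_const, probReal_univ, one_smul] at h2
  unfold Deg
  refine or_congr ?_ ?_
  · rw [h1]
    refine Filter.eventually_congr (Filter.Eventually.of_forall fun x => ?_)
    exact Real.binEntropy_eq_zero.symm
  · rw [eq_comm (b := Real.log 2), ← sub_eq_zero, h2]
    refine Filter.eventually_congr (Filter.Eventually.of_forall fun x => ?_)
    simp only [Pi.zero_apply]
    rw [sub_eq_zero, eq_comm (a := Real.log 2), Real.binEntropy_eq_log_two]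

lemma CC_zero_of_T (hp : Measurable p) (hq : Measurable q)
    (hp1 : ∀ x, p x ∈ Set.Icc (0:ℝ) 1) (hq1 : ∀ x, q x ∈ Set.Icc (0:ℝ) 1)
    (hT : ∀ᵐ x ∂ν₁, p x ∈ TT) :
    CC (ν₁.prod ν₂) p q = 0 ↔ Deg ν₁ p ∨ Deg ν₂ q := by
  have hL : Real.log 2 ≠ 0 := (Real.log_pos one_lt_two).ne'
  rw [CC_T ν₁ ν₂ hp hq hp1 hq1 hT, Deg_iff ν₁ hp hp1, Deg_iff ν₂ hq hq1, div_eq_zero_iff]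
  simp only [mul_eq_zero, sub_eq_zero, eq_comm (a := Real.log 2), pow_eq_zero_iff, hL, ne_eq,
    OfNat.ofNat_ne_zero, not_false_eq_true]
  tauto

lemma CC_zero_iff (hp : Measurable p) (hq : Measurable q)
    (hp1 : ∀ x, p x ∈ Set.Icc (0:ℝ) 1) (hq1 : ∀ x, q x ∈ Set.Icc (0:ℝ) 1) :
    CC (ν₁.prod ν₂) p q = 0 ↔ Deg ν₁ p ∨ Deg ν₂ q := by
  have key : (∀ᵐ x ∂ν₁, p x ∈ TT) ∨ (∀ᵐ x ∂ν₂, q x ∈ TT) →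
      (CC (ν₁.prod ν₂) p q = 0 ↔ Deg ν₁ p ∨ Deg ν₂ q) := by
    rintro (h | h)
    · exact CC_zero_of_T ν₁ ν₂ hp hq hp1 hq1 h
    · rw [← CC_swap ν₁ ν₂ hp hq hp1 hq1, or_comm]
      exact CC_zero_of_T ν₂ ν₁ hq hp hq1 hp1 h
  constructor
  · intro h
    refine (key ?_).1 h
    rw [CC_eq ν₁ ν₂ hp hq hp1 hq1] at h
    have h1 := harris ν₁ ν₂ hp hq hp1 hq1
    have h2 : ∀ z : α × β, 0 ≤ DD (p z.1) (q z.2) := fun z => DD_nonneg (hp1 z.1) (hq1 z.2)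
    have h3 : 0 ≤ ∫ z, DD (p z.1) (q z.2) ∂(ν₁.prod ν₂) := integral_nonneg fun z => h2 z
    have h4 : ∫ z, DD (p z.1) (q z.2) ∂(ν₁.prod ν₂) = 0 := by
      linarith
    rw [integral_eq_zero_iff_of_nonneg h2 (int_DD ν₁ ν₂ hp hq hp1 hq1)] at h4
    have h5 : (ν₁.prod ν₂) ({x | p x ∉ TT} ×ˢ {y | q y ∉ TT}) = 0 := by
      refine measure_mono_null ?_ (ae_iff.1 h4)
      rintro ⟨x, y⟩ ⟨hx, hy⟩
      exact (DD_pos (hp1 x) (hq1 y) hx hy).ne'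
    rw [Measure.prod_prod, mul_eq_zero] at h5
    exact h5.imp (fun h => ae_iff.2 h) (fun h => ae_iff.2 h)
  · intro h
    exact (key (h.imp (Deg_T ν₁) (Deg_T ν₂))).2 h

end prodpart

/-- Bernoulli weights -/
noncomputable def ww (p : ℝ) (x : ZMod 2) : ℝ := if x = 1 then p else 1 - p

lemma ww_zero (p : ℝ) : ww p 0 = 1 - p := by simp [ww]
lemma ww_one (p : ℝ) : ww p 1 = p := by simp [ww]

lemma zmod2_cases (x : ZMod 2) : x = 0 ∨ x = 1 := by
  revert x; decide

lemma sum_zmod2 {M : Type*} [AddCommMonoid M] (f : ZMod 2 → M) : ∑ x, f x = f 0 + f 1 :=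
  Fin.sum_univ_two f

lemma ww_nonneg {p : ℝ} (hp : p ∈ Set.Icc (0:ℝ) 1) (x : ZMod 2) : 0 ≤ ww p x := by
  rcases zmod2_cases x with rfl | rfl
  · rw [ww_zero]; linarith [hp.2]
  · rw [ww_one]; exact hp.1

lemma ww_le_one {p : ℝ} (hp : p ∈ Set.Icc (0:ℝ) 1) (x : ZMod 2) : ww p x ≤ 1 := by
  rcases zmod2_cases x with rfl | rfl
  · rw [ww_zero]; linarith [hp.1]
  · rw [ww_one]; exact hp.2

lemma measurable_ww (x : ZMod 2) : Measurable (fun p => ww p x) := by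
  rcases zmod2_cases x with rfl | rfl
  · simp only [ww_zero]; fun_prop
  · simp only [ww_one]; fun_prop

lemma ww_rr_zero (p q : ℝ) : ww (rr p q) 0 = ww p 0 * ww q 0 + ww p 1 * ww q 1 := by
  simp only [ww_zero, ww_one, rr]; ring

lemma ww_rr_one (p q : ℝ) : ww (rr p q) 1 = ww p 0 * ww q 1 + ww p 1 * ww q 0 := by
  simp only [ww_zero, ww_one, rr]; ring

lemma ww_mul_le {p q : ℝ} (hp : p ∈ Set.Icc (0:ℝ) 1) (hq : q ∈ Set.Icc (0:ℝ) 1) (x y : ZMod 2) :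
    ww p x * ww q y ≤ ww (rr p q) (x + y) := by
  have h00 := mul_nonneg (ww_nonneg hp 0) (ww_nonneg hq 0)
  have h01 := mul_nonneg (ww_nonneg hp 0) (ww_nonneg hq 1)
  have h10 := mul_nonneg (ww_nonneg hp 1) (ww_nonneg hq 0)
  have h11 := mul_nonneg (ww_nonneg hp 1) (ww_nonneg hq 1)
  have e : (1 : ZMod 2) + 1 = 0 := by decide
  rcases zmod2_cases x with rfl | rfl <;> rcases zmod2_cases y with rfl | rfl <;>
    simp only [add_zero, zero_add, e, ww_rr_zero, ww_rr_one] <;> linarith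

section probpart

variable {Ω β : Type*} [MeasurableSpace Ω] [MeasurableSpace β]
  (μ : Measure Ω) [IsProbabilityMeasure μ] (X : Ω → ZMod 2) (Y : Ω → β)

/-- conditional bias -/
noncomputable def pp : β → ℝ := fun y => (condDistrib X Y μ y {1}).toReal

lemma measurable_pp : Measurable (pp μ X Y) :=
  (Kernel.measurable_coe _ (measurableSet_singleton _)).ennreal_toReal

lemma pp_mem (y : β) : pp μ X Y y ∈ Set.Icc (0:ℝ) 1 :=
  ⟨ENNReal.toReal_nonneg, ENNReal.toReal_le_of_le_ofReal zero_le_one (by simpa using prob_le_one)⟩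

lemma cond_toReal (y : β) (x : ZMod 2) :
    (condDistrib X Y μ y {x}).toReal = ww (pp μ X Y y) x := by
  rcases zmod2_cases x with rfl | rfl
  · rw [ww_zero]
    have : ({0} : Set (ZMod 2)) = {1}ᶜ := by
      ext x
      rcases zmod2_cases x with rfl | rfl <;> simp
    rw [this, prob_compl_eq_one_sub (measurableSet_singleton _),
      ENNReal.toReal_sub_of_le prob_le_one ENNReal.one_ne_top]
    rfl
  · rw [ww_one]; rfl

lemma cond_eq (y : β) (x : ZMod 2) :
    condDistrib X Y μ y {x} = ENNReal.ofReal (ww (pp μ X Y y) x) := by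
  rw [← cond_toReal, ENNReal.ofReal_toReal (measure_ne_top _ _)]

variable {X Y}

lemma lint1 (hX : Measurable X) (hY : Measurable Y) {g : β × ZMod 2 → ENNReal} (hg : Measurable g) :
    ∫⁻ ω, g (Y ω, X ω) ∂μ
      = ∫⁻ y, ∑ x, g (y, x) * ENNReal.ofReal (ww (pp μ X Y y) x) ∂(μ.map Y) := by
  have h : (μ.map Y).compProd (condDistrib X Y μ) = μ.map (fun ω => (Y ω, X ω)) :=
    compProd_map_condDistrib hX.aemeasurable
  rw [← lintegral_map (f := g) (g := fun ω => (Y ω, X ω)) hg (hY.prodMk hX), ← h,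
    Measure.lintegral_compProd hg]
  simp_rw [lintegral_fintype, cond_eq]

lemma ident (hX : Measurable X) (hY : Measurable Y) (u : ZMod 2) {f : β → ENNReal}
    (hf : Measurable f)
    (h : ∀ B : Set β, MeasurableSet B →
      ∫⁻ ω, {z : β × ZMod 2 | z.1 ∈ B ∧ z.2 = u}.indicator 1 (Y ω, X ω) ∂μ
        = ∫⁻ ω, B.indicator f (Y ω) ∂μ) :
    ∀ᵐ ω ∂μ, condDistrib X Y μ (Y ω) {u} = f (Y ω) := by
  have := Measure.isProbabilityMeasure_map (μ := μ) hY.aemeasurable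
  refine ae_of_ae_map (μ := μ) (f := Y) (p := fun y => condDistrib X Y μ y {u} = f y) hY.aemeasurable ?_
  refine ae_eq_of_forall_setLIntegral_eq_of_sigmaFinite
    (Kernel.measurable_coe _ (measurableSet_singleton _)) hf fun B hB _ => ?_
  rw [← Measure.compProd_apply_prod hB (measurableSet_singleton _),
    compProd_map_condDistrib hX.aemeasurable, ← lintegral_indicator hB,
    lintegral_map (hf.indicator hB) hY, ← h B hB]
  have e : {z : β × ZMod 2 | z.1 ∈ B ∧ z.2 = u} = B ×ˢ {u} := by ext z; simp
  have hm : MeasurableSet (B ×ˢ ({u} : Set (ZMod 2))) := hB.prod (measurableSet_singleton _)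
  rw [e, ← lintegral_map (f := (B ×ˢ ({u} : Set (ZMod 2))).indicator 1)
    (g := fun ω => (Y ω, X ω)) (measurable_one.indicator hm) (hY.prodMk hX),
    lintegral_indicator_one hm]

lemma ae1 (hX : Measurable X) (hY : Measurable Y) {S : Set (β × ZMod 2)} (hS : MeasurableSet S) :
    (∀ᵐ ω ∂μ, (Y ω, X ω) ∈ S) ↔
      ∀ᵐ y ∂(μ.map Y), ∀ x, ww (pp μ X Y y) x = 0 ∨ (y, x) ∈ S := by
  have h := lint1 μ hX hY (g := Sᶜ.indicator 1) (measurable_one.indicator hS.compl)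
  have hm : Measurable fun ω => Sᶜ.indicator (1 : β × ZMod 2 → ENNReal) (Y ω, X ω) :=
    (measurable_one.indicator hS.compl).comp (hY.prodMk hX)
  have hm2 : Measurable fun y => ∑ x, Sᶜ.indicator (1 : β × ZMod 2 → ENNReal) (y, x)
      * ENNReal.ofReal (ww (pp μ X Y y) x) := by
    refine Finset.measurable_sum _ fun x _ => Measurable.mul ?_ ?_
    · exact (measurable_one.indicator hS.compl).comp (by fun_prop)
    · exact ((measurable_ww x).comp (measurable_pp μ X Y)).ennreal_ofReal
  have h1 := lintegral_eq_zero_iff (μ := μ) hm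
  have h2 := lintegral_eq_zero_iff (μ := μ.map Y) hm2
  rw [h, h2] at h1
  have a1 : (∀ᵐ ω ∂μ, (Y ω, X ω) ∈ S) ↔
      (fun ω => Sᶜ.indicator (1 : β × ZMod 2 → ENNReal) (Y ω, X ω)) =ᵐ[μ] 0 := by
    refine Filter.eventually_congr (Filter.Eventually.of_forall fun ω => ?_)
    simp
  rw [a1, ← h1]
  refine Filter.eventually_congr (Filter.Eventually.of_forall fun y => ?_)
  simp only [Pi.zero_apply, Finset.sum_eq_zero_iff, Finset.mem_univ, forall_true_left, mul_eq_zero,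
    ENNReal.ofReal_eq_zero]
  refine forall_congr' fun x => ?_
  rw [or_comm]
  refine or_congr ⟨fun h => le_antisymm h (ww_nonneg (pp_mem μ X Y y) x), fun h => h.le⟩ ?_
  simp

lemma mul_log_sq_le {x : ℝ} (h0 : 0 ≤ x) (h1 : x ≤ 1) : Real.log x ^ 2 * x ≤ 4 := by
  rcases h0.eq_or_lt with h | h
  · simp [← h]
  · have := Real.abs_log_mul_self_lt (Real.sqrt x) (Real.sqrt_pos.2 h) (by simpa using h1)
    rw [Real.log_sqrt h0] at this
    have h2 := (sq_lt_one_iff_abs_lt_one _).2 this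
    rw [mul_pow, Real.sq_sqrt h0] at h2
    nlinarith

lemma entRV_eq (ω : Ω) : entRV X Y μ ω = -Real.logb 2 (ww (pp μ X Y (Y ω)) (X ω)) := by
  unfold entRV; rw [cond_toReal]

lemma measurable_ent : Measurable fun z : β × ZMod 2 => -Real.logb 2 (ww (pp μ X Y z.1) z.2) := by
  refine measurable_from_prod_countable_left fun x => ?_
  have h1 := (measurable_ww x).comp (measurable_pp μ X Y)
  exact (Real.measurable_log.comp h1 |>.div_const _).neg

lemma memLp_ent (hX : Measurable X) (hY : Measurable Y) : MemLp (entRV X Y μ) 2 μ := by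
  have hm : Measurable (entRV X Y μ) := by
    have : entRV X Y μ = (fun z : β × ZMod 2 => -Real.logb 2 (ww (pp μ X Y z.1) z.2)) ∘
      fun ω => (Y ω, X ω) := by ext ω; exact entRV_eq μ ω
    rw [this]
    exact (measurable_ent μ).comp (hY.prodMk hX)
  rw [memLp_two_iff_integrable_sq hm.aestronglyMeasurable]
  refine ⟨(hm.pow_const 2).aestronglyMeasurable, ?_⟩
  rw [hasFiniteIntegral_iff_ofReal (Filter.Eventually.of_forall fun ω => sq_nonneg _)]
  simp_rw [entRV_eq]
  rw [lint1 μ hX hY (g := fun z => ENNReal.ofReal ((-Real.logb 2 (ww (pp μ X Y z.1) z.2)) ^ 2))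
    ((measurable_ent μ).pow_const 2).ennreal_ofReal]
  have := Measure.isProbabilityMeasure_map (μ := μ) hY.aemeasurable
  have hb : ∀ y, ∑ x, ENNReal.ofReal ((-Real.logb 2 (ww (pp μ X Y y) x)) ^ 2)
      * ENNReal.ofReal (ww (pp μ X Y y) x) ≤ ∑ x : ZMod 2, ENNReal.ofReal (4 / Real.log 2 ^ 2) := by
    intro y
    refine Finset.sum_le_sum fun x _ => ?_
    rw [← ENNReal.ofReal_mul (sq_nonneg _)]
    refine ENNReal.ofReal_le_ofReal ?_
    have h1 := mul_log_sq_le (ww_nonneg (pp_mem μ X Y y) x) (ww_le_one (pp_mem μ X Y y) x)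
    rw [Real.logb, neg_sq, div_pow, div_mul_eq_mul_div]
    gcongr
  refine (lintegral_mono hb).trans_lt ?_
  simp only [lintegral_const, measure_univ, mul_one]
  exact ENNReal.sum_lt_top.2 fun _ _ => ENNReal.ofReal_lt_top

lemma ent_const_iff (hX : Measurable X) (hY : Measurable Y) (c : ℝ) :
    (∀ᵐ ω ∂μ, entRV X Y μ ω = c) ↔
      ∀ᵐ y ∂(μ.map Y), ∀ x, ww (pp μ X Y y) x = 0 ∨ -Real.logb 2 (ww (pp μ X Y y) x) = c := by
  simp_rw [entRV_eq]
  exact ae1 μ hX hY (S := {z | -Real.logb 2 (ww (pp μ X Y z.1) z.2) = c})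
    (measurableSet_eq_fun (measurable_ent μ) measurable_const)

lemma var_zero_iff (hX : Measurable X) (hY : Measurable Y) :
    variance (entRV X Y μ) μ = 0 ↔ Deg (μ.map Y) (pp μ X Y) := by
  have hmem := memLp_ent μ hX hY
  have hv : variance (entRV X Y μ) μ = 0 ↔ ∃ c, ∀ᵐ ω ∂μ, entRV X Y μ ω = c := by
    constructor
    · intro h
      exact ⟨_, ae_eq_integral_of_variance_eq_zero hmem h⟩
    · rintro ⟨c, hc⟩
      have : entRV X Y μ =ᵐ[μ] fun _ => c := hc
      rw [variance_congr this]
      simp [variance_eq_integral aemeasurable_const]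
  rw [hv]
  simp_rw [ent_const_iff μ hX hY]
  constructor
  · rintro ⟨c, hc⟩
    by_cases h0 : c = 0
    · left
      filter_upwards [hc] with y hy
      have hp := pp_mem μ X Y y
      have := hy 1
      rw [ww_one, h0, neg_eq_zero, Real.logb_eq_zero] at this
      norm_num at this
      rcases this with h | h | h
      · exact Or.inl h
      · exact Or.inr h
      · linarith [hp.1]
    · right
      filter_upwards [hc] with y hy
      have hp := pp_mem μ X Y y
      have a := hy 1
      have b := hy 0
      rw [ww_one] at a
      rw [ww_zero] at b
      rcases a with a | a
      · rw [a] at b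
        simp at b
        exact absurd b.symm h0
      rcases b with b | b
      · have : pp μ X Y y = 1 := by linarith
        rw [this] at a
        simp at a
        exact absurd a.symm h0
      have hp0 : pp μ X Y y ≠ 0 := by
        intro h; rw [h] at a; simp at a; exact h0 a.symm
      have hp1 : 1 - pp μ X Y y ≠ 0 := by
        intro h; rw [h] at b; simp at b; exact h0 b.symm
      have e := Real.logb_injOn_pos one_lt_two (lt_of_le_of_ne hp.1 hp0.symm)
        (lt_of_le_of_ne (sub_nonneg.2 hp.2) hp1.symm) (by linarith)
      norm_num; linarith
  · rintro (h | h)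
    · refine ⟨0, ?_⟩
      filter_upwards [h] with y hy x
      rcases zmod2_cases x with rfl | rfl <;> rcases hy with hy | hy <;>
        simp [ww_zero, ww_one, hy]
    · refine ⟨1, ?_⟩
      filter_upwards [h] with y hy x
      have e : (1:ℝ) - 2⁻¹ = 2⁻¹ := by norm_num
      right
      rcases zmod2_cases x with rfl | rfl <;> simp [ww_zero, ww_one, hy, e, Real.logb_inv]

end probpart

section polarpart

variable {Ω 𝒴₁ 𝒴₂ : Type*} [MeasurableSpace Ω] [MeasurableSpace 𝒴₁] [MeasurableSpace 𝒴₂]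
  (μ : Measure Ω) [IsProbabilityMeasure μ]
  {X₁ X₂ : Ω → ZMod 2} {Y₁ : Ω → 𝒴₁} {Y₂ : Ω → 𝒴₂}

lemma lint2 (hX₁ : Measurable X₁) (hX₂ : Measurable X₂)
    (hY₁ : Measurable Y₁) (hY₂ : Measurable Y₂)
    (hindep : IndepFun (fun ω => (X₁ ω, Y₁ ω)) (fun ω => (X₂ ω, Y₂ ω)) μ)
    {g : ZMod 2 → ZMod 2 → 𝒴₁ × 𝒴₂ → ENNReal} (hg : ∀ x y, Measurable (g x y)) :
    ∫⁻ ω, g (X₁ ω) (X₂ ω) (Y₁ ω, Y₂ ω) ∂μ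
      = ∫⁻ z, ∑ x, ∑ y, g x y z *
          ENNReal.ofReal (ww (pp μ X₁ Y₁ z.1) x * ww (pp μ X₂ Y₂ z.2) y)
          ∂((μ.map Y₁).prod (μ.map Y₂)) := by
  have h1 := Measure.isProbabilityMeasure_map (μ := μ) hY₁.aemeasurable
  have h2 := Measure.isProbabilityMeasure_map (μ := μ) hY₂.aemeasurable
  have hi := hindep.comp measurable_swap measurable_swap
  have hm1 : Measurable fun ω => (Y₁ ω, X₁ ω) := hY₁.prodMk hX₁
  have hm2 : Measurable fun ω => (Y₂ ω, X₂ ω) := hY₂.prodMk hX₂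
  have h3 := Measure.isProbabilityMeasure_map (μ := μ) hm1.aemeasurable
  have h4 := Measure.isProbabilityMeasure_map (μ := μ) hm2.aemeasurable
  have hlaw : μ.map (fun ω => ((Y₁ ω, X₁ ω), (Y₂ ω, X₂ ω)))
      = (μ.map (fun ω => (Y₁ ω, X₁ ω))).prod (μ.map (fun ω => (Y₂ ω, X₂ ω))) :=
    (indepFun_iff_map_prod_eq_prod_map_map hm1.aemeasurable hm2.aemeasurable).1 hi
  set G : (𝒴₁ × ZMod 2) × (𝒴₂ × ZMod 2) → ENNReal := fun t => g t.1.2 t.2.2 (t.1.1, t.2.1) with hG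
  have hGm : Measurable G := by
    have a : Measurable fun s : (𝒴₁ × 𝒴₂) × (ZMod 2 × ZMod 2) => g s.2.1 s.2.2 s.1 :=
      measurable_from_prod_countable_left fun x => hg x.1 x.2
    have b : Measurable fun t : (𝒴₁ × ZMod 2) × (𝒴₂ × ZMod 2) =>
      (((t.1.1, t.2.1), (t.1.2, t.2.2)) : (𝒴₁ × 𝒴₂) × (ZMod 2 × ZMod 2)) := by fun_prop
    exact a.comp b
  have e1 : ∫⁻ ω, g (X₁ ω) (X₂ ω) (Y₁ ω, Y₂ ω) ∂μ
      = ∫⁻ t, G t ∂(μ.map (fun ω => ((Y₁ ω, X₁ ω), (Y₂ ω, X₂ ω)))) :=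
    (lintegral_map hGm (hm1.prodMk hm2)).symm
  have e2 : ∀ s, ∫⁻ t, G (s, t) ∂(μ.map (fun ω => (Y₂ ω, X₂ ω)))
      = ∫⁻ y, ∑ x, G (s, (y, x)) * ENNReal.ofReal (ww (pp μ X₂ Y₂ y) x) ∂(μ.map Y₂) := by
    intro s
    have hs : Measurable fun t => G (s, t) := hGm.comp (by fun_prop)
    rw [lintegral_map hs hm2]
    exact lint1 μ hX₂ hY₂ hs
  have hw1 : ∀ x, Measurable fun y => ENNReal.ofReal (ww (pp μ X₁ Y₁ y) x) := fun x =>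
    ((measurable_ww x).comp (measurable_pp μ X₁ Y₁)).ennreal_ofReal
  have hw2 : ∀ x, Measurable fun y => ENNReal.ofReal (ww (pp μ X₂ Y₂ y) x) := fun x =>
    ((measurable_ww x).comp (measurable_pp μ X₂ Y₂)).ennreal_ofReal
  have hK : Measurable fun s => ∫⁻ t, G (s, t) ∂(μ.map (fun ω => (Y₂ ω, X₂ ω))) :=
    hGm.lintegral_prod_right'
  rw [e1, hlaw, lintegral_prod _ hGm.aemeasurable, lintegral_map hK hm1, lint1 μ hX₁ hY₁ hK]
  simp_rw [e2]
  have hw12 : ∀ x y, Measurable fun z : 𝒴₁ × 𝒴₂ =>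
      ENNReal.ofReal (ww (pp μ X₁ Y₁ z.1) x * ww (pp μ X₂ Y₂ z.2) y) := fun x y =>
    (((measurable_ww x).comp ((measurable_pp μ X₁ Y₁).comp measurable_fst)).mul
    ((measurable_ww y).comp ((measurable_pp μ X₂ Y₂).comp measurable_snd))).ennreal_ofReal
  have hS : Measurable fun z : 𝒴₁ × 𝒴₂ => ∑ x, ∑ y, g x y z *
      ENNReal.ofReal (ww (pp μ X₁ Y₁ z.1) x * ww (pp μ X₂ Y₂ z.2) y) :=
    Finset.measurable_sum _ fun x _ => Finset.measurable_sum _ fun y _ =>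
      (hg x y).mul (hw12 x y)
  rw [lintegral_prod _ hS.aemeasurable]
  refine lintegral_congr fun y₁ => ?_
  have hgy : ∀ x y, Measurable fun y₂ => g x y (y₁, y₂) := fun x y =>
    (hg x y).comp (by fun_prop)
  have hS2 : ∀ x : ZMod 2, Measurable fun y₂ => ∑ y, g x y (y₁, y₂) *
      ENNReal.ofReal (ww (pp μ X₁ Y₁ y₁) x * ww (pp μ X₂ Y₂ y₂) y) := fun x =>
    Finset.measurable_sum _ fun y _ => ((hg x y).mul (hw12 x y)).comp measurable_prodMk_left
  rw [lintegral_finset_sum _ fun x _ => hS2 x]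
  refine Finset.sum_congr rfl fun x _ => ?_
  have hS3 : Measurable fun y₂ => ∑ y, g x y (y₁, y₂) *
      ENNReal.ofReal (ww (pp μ X₂ Y₂ y₂) y) :=
    Finset.measurable_sum _ fun y _ => (hgy x y).mul (hw2 y)
  rw [← lintegral_mul_const _ hS3]
  refine lintegral_congr fun y₂ => ?_
  rw [Finset.sum_mul]
  refine Finset.sum_congr rfl fun y _ => ?_
  rw [ENNReal.ofReal_mul (ww_nonneg (pp_mem μ X₁ Y₁ y₁) x)]
  ring

lemma int2 (hX₁ : Measurable X₁) (hX₂ : Measurable X₂)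
    (hY₁ : Measurable Y₁) (hY₂ : Measurable Y₂)
    (hindep : IndepFun (fun ω => (X₁ ω, Y₁ ω)) (fun ω => (X₂ ω, Y₂ ω)) μ)
    {g : ZMod 2 → ZMod 2 → 𝒴₁ × 𝒴₂ → ℝ} (hg : ∀ x y, Measurable (g x y))
    (hg0 : ∀ x y z, 0 ≤ g x y z) :
    ∫ ω, g (X₁ ω) (X₂ ω) (Y₁ ω, Y₂ ω) ∂μ
      = ∫ z, ∑ x, ∑ y, g x y z * (ww (pp μ X₁ Y₁ z.1) x * ww (pp μ X₂ Y₂ z.2) y)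
          ∂((μ.map Y₁).prod (μ.map Y₂)) := by
  have hw0 : ∀ x y z, 0 ≤ g x y z * (ww (pp μ X₁ Y₁ z.1) x * ww (pp μ X₂ Y₂ z.2) y) :=
    fun x y z => mul_nonneg (hg0 x y z)
      (mul_nonneg (ww_nonneg (pp_mem μ X₁ Y₁ z.1) x) (ww_nonneg (pp_mem μ X₂ Y₂ z.2) y))
  have hw12 : ∀ x y, Measurable fun z : 𝒴₁ × 𝒴₂ =>
      (ww (pp μ X₁ Y₁ z.1) x * ww (pp μ X₂ Y₂ z.2) y) := fun x y =>
    (((measurable_ww x).comp ((measurable_pp μ X₁ Y₁).comp measurable_fst)).mul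
    ((measurable_ww y).comp ((measurable_pp μ X₂ Y₂).comp measurable_snd)))
  have a : Measurable fun s : (𝒴₁ × 𝒴₂) × (ZMod 2 × ZMod 2) => g s.2.1 s.2.2 s.1 :=
    measurable_from_prod_countable_left fun x => hg x.1 x.2
  have b : Measurable fun ω => g (X₁ ω) (X₂ ω) (Y₁ ω, Y₂ ω) :=
    a.comp ((hY₁.prodMk hY₂).prodMk (hX₁.prodMk hX₂))
  rw [integral_eq_lintegral_of_nonneg_ae (Filter.Eventually.of_forall fun ω => hg0 _ _ _)
    b.aestronglyMeasurable, integral_eq_lintegral_of_nonneg_ae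
    (Filter.Eventually.of_forall fun z => Finset.sum_nonneg fun x _ => Finset.sum_nonneg fun y _ =>
      hw0 x y z)
    (Finset.measurable_sum _ fun x _ => Finset.measurable_sum _ fun y _ =>
      (hg x y).mul (hw12 x y)).aestronglyMeasurable,
    lint2 μ hX₁ hX₂ hY₁ hY₂ hindep (g := fun x y z => ENNReal.ofReal (g x y z))
      (fun x y => (hg x y).ennreal_ofReal)]
  congr 1
  refine lintegral_congr fun z => ?_
  rw [ENNReal.ofReal_sum_of_nonneg fun x _ => Finset.sum_nonneg fun y _ => hw0 x y z]
  refine Finset.sum_congr rfl fun x _ => ?_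
  rw [ENNReal.ofReal_sum_of_nonneg fun y _ => hw0 x y z]
  refine Finset.sum_congr rfl fun y _ => ?_
  rw [ENNReal.ofReal_mul (hg0 x y z)]

lemma add_self_zmod2 (v u : ZMod 2) : v + u + u = v := by
  revert v u; decide

lemma cond_minus (hX₁ : Measurable X₁) (hX₂ : Measurable X₂)
    (hY₁ : Measurable Y₁) (hY₂ : Measurable Y₂)
    (hindep : IndepFun (fun ω => (X₁ ω, Y₁ ω)) (fun ω => (X₂ ω, Y₂ ω)) μ) (u : ZMod 2) :
    ∀ᵐ ω ∂μ, condDistrib (fun ω => X₁ ω + X₂ ω) (fun ω => (Y₁ ω, Y₂ ω)) μ (Y₁ ω, Y₂ ω) {u}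
      = ENNReal.ofReal (ww (rr (pp μ X₁ Y₁ (Y₁ ω)) (pp μ X₂ Y₂ (Y₂ ω))) u) := by
  have hmr : Measurable fun z : 𝒴₁ × 𝒴₂ =>
      ENNReal.ofReal (ww (rr (pp μ X₁ Y₁ z.1) (pp μ X₂ Y₂ z.2)) u) := by
    have h1 : Measurable fun z : 𝒴₁ × 𝒴₂ => pp μ X₁ Y₁ z.1 :=
      (measurable_pp μ X₁ Y₁).comp measurable_fst
    have h2 : Measurable fun z : 𝒴₁ × 𝒴₂ => pp μ X₂ Y₂ z.2 :=
      (measurable_pp μ X₂ Y₂).comp measurable_snd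
    refine ((measurable_ww u).comp ?_).ennreal_ofReal
    unfold rr
    exact (h1.mul (h2.const_sub 1)).add (h2.mul (h1.const_sub 1))
  refine ident μ (hX₁.add hX₂) (hY₁.prodMk hY₂) u hmr fun B hB => ?_
  have L := lint2 μ hX₁ hX₂ hY₁ hY₂ hindep
    (g := fun x y z => if x + y = u then B.indicator 1 z else 0)
    (fun x y => by
      split_ifs
      · exact measurable_one.indicator hB
      · exact measurable_const)
  have R := lint2 μ hX₁ hX₂ hY₁ hY₂ hindep
    (g := fun x y z => B.indicator (fun z : 𝒴₁ × 𝒴₂ =>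
      ENNReal.ofReal (ww (rr (pp μ X₁ Y₁ z.1) (pp μ X₂ Y₂ z.2)) u)) z)
    (fun x y => hmr.indicator hB)
  refine Eq.trans ?_ (L.trans (Eq.trans ?_ R.symm))
  · refine lintegral_congr fun ω => ?_
    by_cases h : X₁ ω + X₂ ω = u <;> by_cases hb : (Y₁ ω, Y₂ ω) ∈ B <;> simp [h, hb]
  · refine lintegral_congr fun z => ?_
    have hp := pp_mem μ X₁ Y₁ z.1
    have hq := pp_mem μ X₂ Y₂ z.2
    by_cases hb : z ∈ B
    · simp only [Set.indicator_of_mem hb, Pi.one_apply, sum_zmod2, ← mul_add]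
      generalize pp μ X₁ Y₁ z.1 = p at *
      generalize pp μ X₂ Y₂ z.2 = q at *
      have e : (1 : ZMod 2) + 1 = 0 := by decide
      have hn : ∀ x y, 0 ≤ ww p x * ww q y := fun x y =>
        mul_nonneg (ww_nonneg hp x) (ww_nonneg hq y)
      have hs : ww p 0 * ww q 0 + ww p 0 * ww q 1 + (ww p 1 * ww q 0 + ww p 1 * ww q 1) = 1 := by
        simp only [ww_zero, ww_one]; ring
      rw [← ENNReal.ofReal_add (hn _ _) (hn _ _), ← ENNReal.ofReal_add (hn _ _) (hn _ _),
        ← ENNReal.ofReal_add (add_nonneg (hn _ _) (hn _ _)) (add_nonneg (hn _ _) (hn _ _)), hs]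
      rcases zmod2_cases u with rfl | rfl
      · rw [ww_rr_zero, ENNReal.ofReal_add (hn _ _) (hn _ _)]
        simp [e]
      · rw [ww_rr_one, ENNReal.ofReal_add (hn _ _) (hn _ _)]
        simp [e]
    · simp [hb]

lemma cond_plus (hX₁ : Measurable X₁) (hX₂ : Measurable X₂)
    (hY₁ : Measurable Y₁) (hY₂ : Measurable Y₂)
    (hindep : IndepFun (fun ω => (X₁ ω, Y₁ ω)) (fun ω => (X₂ ω, Y₂ ω)) μ) (u : ZMod 2) :
    ∀ᵐ ω ∂μ, condDistrib X₂ (fun ω => (X₁ ω + X₂ ω, (Y₁ ω, Y₂ ω))) μ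
        (X₁ ω + X₂ ω, (Y₁ ω, Y₂ ω)) {u}
      = ENNReal.ofReal (ww (pp μ X₁ Y₁ (Y₁ ω)) (X₁ ω + X₂ ω + u) * ww (pp μ X₂ Y₂ (Y₂ ω)) u
        / ww (rr (pp μ X₁ Y₁ (Y₁ ω)) (pp μ X₂ Y₂ (Y₂ ω))) (X₁ ω + X₂ ω)) := by
  set f : ZMod 2 → 𝒴₁ × 𝒴₂ → ENNReal := fun v z =>
    ENNReal.ofReal (ww (pp μ X₁ Y₁ z.1) (v + u) * ww (pp μ X₂ Y₂ z.2) u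
        / ww (rr (pp μ X₁ Y₁ z.1) (pp μ X₂ Y₂ z.2)) v) with hf
  have hfm : ∀ v, Measurable (f v) := by
    intro v
    have h1 : Measurable fun z : 𝒴₁ × 𝒴₂ => pp μ X₁ Y₁ z.1 :=
      (measurable_pp μ X₁ Y₁).comp measurable_fst
    have h2 : Measurable fun z : 𝒴₁ × 𝒴₂ => pp μ X₂ Y₂ z.2 :=
      (measurable_pp μ X₂ Y₂).comp measurable_snd
    refine Measurable.ennreal_ofReal (Measurable.div (Measurable.mul ?_ ?_) ?_)
    · exact (measurable_ww _).comp h1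
    · exact (measurable_ww _).comp h2
    · refine ((measurable_ww v).comp ?_)
      unfold rr
      exact (h1.mul (h2.const_sub 1)).add (h2.mul (h1.const_sub 1))
  have hfm' : Measurable fun s : ZMod 2 × (𝒴₁ × 𝒴₂) => f s.1 s.2 :=
    measurable_from_prod_countable_right fun v => hfm v
  refine ident μ hX₂ ((hX₁.add hX₂).prodMk (hY₁.prodMk hY₂)) u hfm' fun B hB => ?_
  have hBm : ∀ v, MeasurableSet {z | (v, z) ∈ B} := fun v => measurable_prodMk_left hB
  have L := lint2 μ hX₁ hX₂ hY₁ hY₂ hindep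
    (g := fun x y z => if y = u then {z | (x + y, z) ∈ B}.indicator 1 z else 0)
    (fun x y => by
      split_ifs
      · exact measurable_one.indicator (hBm _)
      · exact measurable_const)
  have R := lint2 μ hX₁ hX₂ hY₁ hY₂ hindep
    (g := fun x y z => {z | (x + y, z) ∈ B}.indicator (f (x + y)) z)
    (fun x y => (hfm _).indicator (hBm _))
  refine Eq.trans ?_ (L.trans (Eq.trans ?_ R.symm))
  · refine lintegral_congr fun ω => ?_
    by_cases h : X₂ ω = u
    · by_cases hb : (X₁ ω + u, (Y₁ ω, Y₂ ω)) ∈ B <;> simp [h, hb]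
    · simp [h]
  · refine lintegral_congr fun z => ?_
    have hp := pp_mem μ X₁ Y₁ z.1
    have hq := pp_mem μ X₂ Y₂ z.2
    have hfz : ∀ v, f v z = ENNReal.ofReal (ww (pp μ X₁ Y₁ z.1) (v + u) * ww (pp μ X₂ Y₂ z.2) u
        / ww (rr (pp μ X₁ Y₁ z.1) (pp μ X₂ Y₂ z.2)) v) := fun v => rfl
    generalize pp μ X₁ Y₁ z.1 = p at *
    generalize pp μ X₂ Y₂ z.2 = q at *
    have e : (1 : ZMod 2) + 1 = 0 := by decide
    have hn : ∀ x y, 0 ≤ ww p x * ww q y := fun x y =>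
      mul_nonneg (ww_nonneg hp x) (ww_nonneg hq y)
    have hkey : ∀ v, f v z * ENNReal.ofReal (ww (rr p q) v)
        = ENNReal.ofReal (ww p (v + u) * ww q u) := by
      intro v
      have hle := ww_mul_le hp hq (v + u) u
      have huu : v + u + u = v := add_self_zmod2 v u
      rw [huu] at hle
      have h0 := (hn (v + u) u).trans hle
      rw [hfz, ← ENNReal.ofReal_mul (div_nonneg (hn _ _) h0)]
      congr 1
      rcases h0.eq_or_lt with h | h
      · rw [← h] at hle ⊢
        rw [mul_zero]
        exact le_antisymm (hn _ _) hle
      · field_simp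
    have k0 := hkey 0
    have k1 := hkey 1
    rw [ww_rr_zero, ENNReal.ofReal_add (hn _ _) (hn _ _)] at k0
    rw [ww_rr_one, ENNReal.ofReal_add (hn _ _) (hn _ _)] at k1
    have hind : ∀ (v : ZMod 2) (F : 𝒴₁ × 𝒴₂ → ENNReal), {z | (v, z) ∈ B}.indicator F z
        = B.indicator 1 (v, z) * F z := by
      intro v F
      by_cases h : (v, z) ∈ B <;> simp [h]
    clear_value f
    simp only [hind, Pi.one_apply, mul_one, sum_zmod2, add_zero, zero_add, e]
    generalize f 0 z = f0 at *
    generalize f 1 z = f1 at *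
    generalize B.indicator (1 : ZMod 2 × (𝒴₁ × 𝒴₂) → ENNReal) (0, z) = i0 at *
    generalize B.indicator (1 : ZMod 2 × (𝒴₁ × 𝒴₂) → ENNReal) (1, z) = i1 at *
    have hfin : ∀ w00 w01 w10 w11 : ENNReal,
        i0 * f0 * w00 + i1 * f1 * w01 + (i1 * f1 * w10 + i0 * f0 * w11)
        = i0 * (f0 * (w00 + w11)) + i1 * (f1 * (w01 + w10)) := by intros; ring
    rw [hfin, k0, k1]
    rcases zmod2_cases u with hu | hu
    · simp [hu]
    · simp [hu, e, add_comm]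

/-- output entropy variables, explicit form -/
noncomputable def hm (p q : ℝ) (x y : ZMod 2) : ℝ := -Real.log (ww (rr p q) (x + y))
noncomputable def hpl (p q : ℝ) (x y : ZMod 2) : ℝ :=
  -Real.log (ww p x * ww q y / ww (rr p q) (x + y))

lemma ww_rr_nonneg {p q : ℝ} (hp : p ∈ Set.Icc (0:ℝ) 1) (hq : q ∈ Set.Icc (0:ℝ) 1) (x : ZMod 2) :
    0 ≤ ww (rr p q) x := ww_nonneg (rr_mem hp hq) x

lemma hm_nonneg {p q : ℝ} (hp : p ∈ Set.Icc (0:ℝ) 1) (hq : q ∈ Set.Icc (0:ℝ) 1) (x y : ZMod 2) :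
    0 ≤ hm p q x y :=
  neg_nonneg.2 (Real.log_nonpos (ww_rr_nonneg hp hq _) (ww_le_one (rr_mem hp hq) _))

lemma hpl_nonneg {p q : ℝ} (hp : p ∈ Set.Icc (0:ℝ) 1) (hq : q ∈ Set.Icc (0:ℝ) 1) (x y : ZMod 2) :
    0 ≤ hpl p q x y :=
  neg_nonneg.2 (Real.log_nonpos
    (div_nonneg (mul_nonneg (ww_nonneg hp _) (ww_nonneg hq _)) (ww_rr_nonneg hp hq _))
    (div_le_one_of_le₀ (ww_mul_le hp hq _ _) (ww_rr_nonneg hp hq _)))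

lemma sum_hm (p q : ℝ) : ∑ x, ∑ y, hm p q x y * (ww p x * ww q y) = FF p q := by
  have e : (1 : ZMod 2) + 1 = 0 := by decide
  simp only [sum_zmod2, hm, add_zero, zero_add, e, ww_zero, ww_one, FF, Real.binEntropy,
    Real.log_inv]
  unfold rr
  ring

lemma sum_hpl {p q : ℝ} (hp : p ∈ Set.Icc (0:ℝ) 1) (hq : q ∈ Set.Icc (0:ℝ) 1) :
    ∑ x, ∑ y, hpl p q x y * (ww p x * ww q y) = GG p q := by
  have e : (1 : ZMod 2) + 1 = 0 := by decide
  rw [GG_eq hp hq]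
  simp only [sum_zmod2, hpl, add_zero, zero_add, e, ww_zero, ww_one]
  ring

lemma sum_hmul (p q : ℝ) :
    ∑ x, ∑ y, (hm p q x y * hpl p q x y) * (ww p x * ww q y) = KK p q := by
  have e : (1 : ZMod 2) + 1 = 0 := by decide
  simp only [sum_zmod2, hm, hpl, add_zero, zero_add, e, ww_zero, ww_one, KK]
  ring

lemma cov_eq (hX₁ : Measurable X₁) (hX₂ : Measurable X₂)
    (hY₁ : Measurable Y₁) (hY₂ : Measurable Y₂)
    (hindep : IndepFun (fun ω => (X₁ ω, Y₁ ω)) (fun ω => (X₂ ω, Y₂ ω)) μ) :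
    cov μ (entRV (fun ω => X₁ ω + X₂ ω) (fun ω => (Y₁ ω, Y₂ ω)) μ)
              (entRV X₂ (fun ω => (X₁ ω + X₂ ω, (Y₁ ω, Y₂ ω))) μ)
      = ((Real.log 2)⁻¹) ^ 2 *
        CC ((μ.map Y₁).prod (μ.map Y₂)) (pp μ X₁ Y₁) (pp μ X₂ Y₂) := by
  have hp := pp_mem μ X₁ Y₁
  have hq := pp_mem μ X₂ Y₂
  set p := pp μ X₁ Y₁
  set q := pp μ X₂ Y₂
  have h1 : Measurable fun z : 𝒴₁ × 𝒴₂ => p z.1 := (measurable_pp μ X₁ Y₁).comp measurable_fst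
  have h2 : Measurable fun z : 𝒴₁ × 𝒴₂ => q z.2 := (measurable_pp μ X₂ Y₂).comp measurable_snd
  have hr : Measurable fun z : 𝒴₁ × 𝒴₂ => rr (p z.1) (q z.2) := by
    unfold rr
    exact (h1.mul (h2.const_sub 1)).add (h2.mul (h1.const_sub 1))
  have mm : ∀ x y, Measurable fun z : 𝒴₁ × 𝒴₂ => hm (p z.1) (q z.2) x y := fun x y =>
    (Real.measurable_log.comp ((measurable_ww _).comp hr)).neg
  have mp : ∀ x y, Measurable fun z : 𝒴₁ × 𝒴₂ => hpl (p z.1) (q z.2) x y := fun x y =>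
    (Real.measurable_log.comp ((((measurable_ww _).comp h1).mul ((measurable_ww _).comp h2)).div
      ((measurable_ww _).comp hr))).neg
  have am : ∀ᵐ ω ∂μ, entRV (fun ω => X₁ ω + X₂ ω) (fun ω => (Y₁ ω, Y₂ ω)) μ ω
      = (Real.log 2)⁻¹ * hm (p (Y₁ ω)) (q (Y₂ ω)) (X₁ ω) (X₂ ω) := by
    filter_upwards [ae_all_iff.2 (cond_minus μ hX₁ hX₂ hY₁ hY₂ hindep)] with ω hω
    unfold entRV hm
    rw [hω, ENNReal.toReal_ofReal (ww_rr_nonneg (hp _) (hq _) _), Real.logb]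
    ring
  have ap : ∀ᵐ ω ∂μ, entRV X₂ (fun ω => (X₁ ω + X₂ ω, (Y₁ ω, Y₂ ω))) μ ω
      = (Real.log 2)⁻¹ * hpl (p (Y₁ ω)) (q (Y₂ ω)) (X₁ ω) (X₂ ω) := by
    filter_upwards [ae_all_iff.2 (cond_plus μ hX₁ hX₂ hY₁ hY₂ hindep)] with ω hω
    unfold entRV hpl
    rw [hω, ENNReal.toReal_ofReal (div_nonneg (mul_nonneg (ww_nonneg (hp _) _)
      (ww_nonneg (hq _) _)) (ww_rr_nonneg (hp _) (hq _) _)), Real.logb, add_self_zmod2]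
    ring
  have i1 := int2 μ hX₁ hX₂ hY₁ hY₂ hindep (g := fun x y z => hm (p z.1) (q z.2) x y) mm
    (fun x y z => hm_nonneg (hp _) (hq _) x y)
  have i2 := int2 μ hX₁ hX₂ hY₁ hY₂ hindep (g := fun x y z => hpl (p z.1) (q z.2) x y) mp
    (fun x y z => hpl_nonneg (hp _) (hq _) x y)
  have i3 := int2 μ hX₁ hX₂ hY₁ hY₂ hindep
    (g := fun x y z => hm (p z.1) (q z.2) x y * hpl (p z.1) (q z.2) x y)
    (fun x y => (mm x y).mul (mp x y))
    (fun x y z => mul_nonneg (hm_nonneg (hp _) (hq _) x y) (hpl_nonneg (hp _) (hq _) x y))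
  simp only [p, q] at i1 i2 i3
  simp only [sum_hm] at i1
  simp only [sum_hpl (pp_mem μ X₁ Y₁ _) (pp_mem μ X₂ Y₂ _)] at i2
  simp only [sum_hmul] at i3
  have j1 : ∫ ω, entRV (fun ω => X₁ ω + X₂ ω) (fun ω => (Y₁ ω, Y₂ ω)) μ ω ∂μ
      = (Real.log 2)⁻¹ * ∫ z, FF (p z.1) (q z.2) ∂((μ.map Y₁).prod (μ.map Y₂)) := by
    rw [integral_congr_ae am, integral_const_mul, i1]
  have j2 : ∫ ω, entRV X₂ (fun ω => (X₁ ω + X₂ ω, (Y₁ ω, Y₂ ω))) μ ω ∂μ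
      = (Real.log 2)⁻¹ * ∫ z, GG (p z.1) (q z.2) ∂((μ.map Y₁).prod (μ.map Y₂)) := by
    rw [integral_congr_ae ap, integral_const_mul, i2]
  have j3 : ∫ ω, entRV (fun ω => X₁ ω + X₂ ω) (fun ω => (Y₁ ω, Y₂ ω)) μ ω *
        entRV X₂ (fun ω => (X₁ ω + X₂ ω, (Y₁ ω, Y₂ ω))) μ ω ∂μ
      = (Real.log 2)⁻¹ ^ 2 * ∫ z, KK (p z.1) (q z.2) ∂((μ.map Y₁).prod (μ.map Y₂)) := by
    rw [← i3, ← integral_const_mul]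
    refine integral_congr_ae ?_
    filter_upwards [am, ap] with ω h1 h2
    rw [h1, h2]
    ring
  unfold cov CC
  rw [j1, j2, j3]
  ring

end polarpart

/-- The entropy random variables at the output of the polar transform are positively
correlated, with zero covariance iff one of the input varentropies vanishes. -/
theorem covariance_polar_transform
    {Ω 𝒴₁ 𝒴₂ : Type*} [MeasurableSpace Ω] [MeasurableSpace 𝒴₁] [MeasurableSpace 𝒴₂]
    (μ : Measure Ω) [IsProbabilityMeasure μ]
    (X₁ X₂ : Ω → ZMod 2) (Y₁ : Ω → 𝒴₁) (Y₂ : Ω → 𝒴₂)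
    (hX₁ : Measurable X₁) (hX₂ : Measurable X₂)
    (hY₁ : Measurable Y₁) (hY₂ : Measurable Y₂)
    (hindep : IndepFun (fun ω => (X₁ ω, Y₁ ω)) (fun ω => (X₂ ω, Y₂ ω)) μ) :
    0 ≤ cov μ (entRV (fun ω => X₁ ω + X₂ ω) (fun ω => (Y₁ ω, Y₂ ω)) μ)
              (entRV X₂ (fun ω => (X₁ ω + X₂ ω, (Y₁ ω, Y₂ ω))) μ)
    ∧ (cov μ (entRV (fun ω => X₁ ω + X₂ ω) (fun ω => (Y₁ ω, Y₂ ω)) μ)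
              (entRV X₂ (fun ω => (X₁ ω + X₂ ω, (Y₁ ω, Y₂ ω))) μ) = 0
      ↔ variance (entRV X₁ Y₁ μ) μ = 0 ∨ variance (entRV X₂ Y₂ μ) μ = 0) := by
  have h1 := Measure.isProbabilityMeasure_map (μ := μ) hY₁.aemeasurable
  have h2 := Measure.isProbabilityMeasure_map (μ := μ) hY₂.aemeasurable
  have hl : 0 < ((Real.log 2)⁻¹) ^ 2 := pow_pos (inv_pos.2 (Real.log_pos one_lt_two)) 2
  rw [cov_eq μ hX₁ hX₂ hY₁ hY₂ hindep, var_zero_iff μ hX₁ hY₁, var_zero_iff μ hX₂ hY₂,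
    mul_eq_zero, or_iff_right hl.ne',
    CC_zero_iff (μ.map Y₁) (μ.map Y₂) (measurable_pp μ X₁ Y₁) (measurable_pp μ X₂ Y₂)
      (pp_mem μ X₁ Y₁) (pp_mem μ X₂ Y₂)]
  exact ⟨mul_nonneg hl.le (CC_nonneg (μ.map Y₁) (μ.map Y₂) (measurable_pp μ X₁ Y₁)
    (measurable_pp μ X₂ Y₂) (pp_mem μ X₁ Y₁) (pp_mem μ X₂ Y₂)), Iff.rfl⟩
end

section
/- Let (X,Y) be a BDE, let κ be a regular conditional distribution of X given Y, and define B(ω) := min(κ(Y(ω))({0}), κ(Y(ω))({1})). The following three statements are equivalent: (i) B = 0 almost surely or B = 1/2 almost surely; (ii) H(X|Y) = 0 or H(X|Y) = 1; (iii) V(X|Y) = 0. -/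
open MeasureTheory ProbabilityTheory

open scoped ENNReal

/-- Integrating out `X` given `Y`. -/
lemma lintegral_cond_aux
    {Ω β : Type*} [MeasurableSpace Ω] [MeasurableSpace β]
    (μ : Measure Ω) [IsProbabilityMeasure μ]
    (X : Ω → ZMod 2) (Y : Ω → β) (hX : Measurable X) (hY : Measurable Y)
    (g : ℝ → ℝ≥0∞) (hg : Measurable g) :
    ∫⁻ ω, g ((condDistrib X Y μ (Y ω)) {X ω}).toReal ∂μ =
      ∫⁻ ω, (ENNReal.ofReal ((condDistrib X Y μ (Y ω)) {0}).toReal *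
          g ((condDistrib X Y μ (Y ω)) {0}).toReal +
        ENNReal.ofReal (1 - ((condDistrib X Y μ (Y ω)) {0}).toReal) *
          g (1 - ((condDistrib X Y μ (Y ω)) {0}).toReal)) ∂μ := by
  have hm : Measurable (fun z : β × ZMod 2 => g ((condDistrib X Y μ z.1) {z.2}).toReal) := by
    refine hg.comp (Measurable.ennreal_toReal ?_)
    refine measurable_from_prod_countable_left (fun x => ?_)
    exact Kernel.measurable_coe _ (measurableSet_singleton x)
  have h1 : ∫⁻ ω, g ((condDistrib X Y μ (Y ω)) {X ω}).toReal ∂μ =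
      ∫⁻ z, g ((condDistrib X Y μ z.1) {z.2}).toReal ∂(μ.map (fun ω => (Y ω, X ω))) := by
    rw [lintegral_map hm (hY.prodMk hX)]
  rw [h1, ← compProd_map_condDistrib hX.aemeasurable, Measure.lintegral_compProd hm,
    lintegral_map hm.lintegral_kernel_prod_right' hY]
  refine lintegral_congr fun ω => ?_
  rw [lintegral_fintype]
  have hs : ((condDistrib X Y μ (Y ω)) {1}).toReal
      = 1 - ((condDistrib X Y μ (Y ω)) {0}).toReal := by
    have : ({1} : Set (ZMod 2)) = {0}ᶜ := by
      ext x; revert x; simp only [Set.mem_singleton_iff, Set.mem_compl_iff]; decide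
    rw [this]
    exact probReal_compl_eq_one_sub (μ := condDistrib X Y μ (Y ω)) (measurableSet_singleton 0)
  have hu : (Finset.univ : Finset (ZMod 2)) = {0, 1} := by decide
  rw [hu, Finset.sum_pair (by decide), ← hs, ENNReal.ofReal_toReal (measure_ne_top _ _),
    ENNReal.ofReal_toReal (measure_ne_top _ _)]
  ring

lemma sq_log_aux (p : ℝ) (h0 : 0 ≤ p) (h1 : p ≤ 1) : p * (Real.log p) ^ 2 ≤ 4 := by
  rcases h0.eq_or_lt with h | h
  · simp [← h]
  · have := Real.abs_log_mul_self_rpow_lt p (1/2) h h1 (by norm_num)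
    rw [← Real.sqrt_eq_rpow] at this
    have h2 : |Real.log p * √p| ^ 2 ≤ (1 / (1/2 : ℝ)) ^ 2 :=
      pow_le_pow_left₀ (abs_nonneg _) this.le 2
    rw [sq_abs, mul_pow, Real.sq_sqrt h0] at h2
    linarith

/-- Characterization of extreme binary data elements: with
`B(ω) = min(κ(Y ω){0}, κ(Y ω){1})`, the following are equivalent:
(i) `B ≡ 0` a.s. or `B ≡ 1/2` a.s.; (ii) `H(X|Y) ∈ {0,1}`; (iii) `V(X|Y) = 0`. -/
theorem extreme_BDE_characterization
    {Ω β : Type*} [MeasurableSpace Ω] [MeasurableSpace β]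
    (μ : Measure Ω) [IsProbabilityMeasure μ]
    (X : Ω → ZMod 2) (Y : Ω → β) (hX : Measurable X) (hY : Measurable Y)
    (B : Ω → ℝ)
    (hB : ∀ ω, B ω = min ((condDistrib X Y μ (Y ω)) {0}).toReal
                        ((condDistrib X Y μ (Y ω)) {1}).toReal) :
    ((∀ᵐ ω ∂μ, B ω = 0) ∨ (∀ᵐ ω ∂μ, B ω = 1/2)
      ↔ (∫ ω, entRV X Y μ ω ∂μ) = 0 ∨ (∫ ω, entRV X Y μ ω ∂μ) = 1)
    ∧ ((∫ ω, entRV X Y μ ω ∂μ) = 0 ∨ (∫ ω, entRV X Y μ ω ∂μ) = 1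
      ↔ variance (entRV X Y μ) μ = 0) := by
  set q : Ω → ℝ := fun ω => ((condDistrib X Y μ (Y ω)) {X ω}).toReal with hq
  set p : Ω → ℝ := fun ω => ((condDistrib X Y μ (Y ω)) {0}).toReal with hp
  have hs : ∀ ω, ((condDistrib X Y μ (Y ω)) {1}).toReal = 1 - p ω := by
    intro ω
    have : ({1} : Set (ZMod 2)) = {0}ᶜ := by
      ext x; revert x; simp only [Set.mem_singleton_iff, Set.mem_compl_iff]; decide
    rw [this]
    exact probReal_compl_eq_one_sub (μ := condDistrib X Y μ (Y ω)) (measurableSet_singleton 0)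
  have key : ∀ g : ℝ → ℝ≥0∞, Measurable g → ∫⁻ ω, g (q ω) ∂μ =
      ∫⁻ ω, (ENNReal.ofReal (p ω) * g (p ω) + ENNReal.ofReal (1 - p ω) * g (1 - p ω)) ∂μ :=
    fun g hg => lintegral_cond_aux μ X Y hX hY g hg
  have hp0 : ∀ ω, 0 ≤ p ω := fun ω => ENNReal.toReal_nonneg
  have hp1 : ∀ ω, p ω ≤ 1 := fun ω => by
    have h := hs ω
    have : 0 ≤ ((condDistrib X Y μ (Y ω)) {1}).toReal := ENNReal.toReal_nonneg
    linarith
  have hq0 : ∀ ω, 0 ≤ q ω := fun ω => ENNReal.toReal_nonneg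
  have hq1 : ∀ ω, q ω ≤ 1 := fun ω =>
    measureReal_le_one (μ := condDistrib X Y μ (Y ω)) (s := {X ω})
  have hpm : Measurable p :=
    ((Kernel.measurable_coe _ (measurableSet_singleton 0)).comp hY).ennreal_toReal
  have hqm : Measurable q := by
    refine Measurable.ennreal_toReal ?_
    have : Measurable (fun z : β × ZMod 2 => (condDistrib X Y μ z.1) {z.2}) :=
      measurable_from_prod_countable_left
        (fun x => Kernel.measurable_coe _ (measurableSet_singleton x))
    exact this.comp (hY.prodMk hX)
  have hB' : ∀ ω, B ω = min (p ω) (1 - p ω) := fun ω => by rw [hB, hs]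
  have hl2 : 0 < Real.log 2 := Real.log_pos (by norm_num)
  have hh : entRV X Y μ = fun ω => - Real.logb 2 (q ω) := rfl
  rw [hh]
  have hlm : Measurable (fun t : ℝ => - Real.logb 2 t) := by
    unfold Real.logb
    exact (Real.measurable_log.div_const _).neg
  have hhm : Measurable (fun ω => - Real.logb 2 (q ω)) := hlm.comp hqm
  have hh0 : ∀ ω, 0 ≤ - Real.logb 2 (q ω) := fun ω => by
    have := Real.logb_nonpos (b := 2) (by norm_num) (hq0 ω) (hq1 ω)
    linarith
  have trans : ∀ S : Set ℝ, MeasurableSet S → ((∀ᵐ ω ∂μ, q ω ∈ S) ↔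
      ∀ᵐ ω ∂μ, (p ω = 0 ∨ p ω ∈ S) ∧ (1 - p ω = 0 ∨ 1 - p ω ∈ S)) := by
    intro S hS
    have hg : Measurable (Sᶜ.indicator (fun _ => (1 : ℝ≥0∞))) :=
      measurable_const.indicator hS.compl
    have k := key _ hg
    have e1 : (∀ᵐ ω ∂μ, q ω ∈ S) ↔ ∫⁻ ω, Sᶜ.indicator (fun _ => (1 : ℝ≥0∞)) (q ω) ∂μ = 0 := by
      rw [lintegral_eq_zero_iff (show Measurable fun ω => Sᶜ.indicator (fun _ => (1 : ℝ≥0∞)) (q ω) from hg.comp hqm)]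
      refine Filter.eventually_congr (Filter.Eventually.of_forall fun ω => ?_)
      by_cases h : q ω ∈ S <;> simp [h]
    rw [e1, k, lintegral_eq_zero_iff (by
      have := hg.comp hpm
      have := hg.comp (measurable_const.sub hpm : Measurable fun ω => 1 - p ω)
      exact (hpm.ennreal_ofReal.mul (hg.comp hpm)).add
        ((measurable_const.sub hpm).ennreal_ofReal.mul this))]
    refine Filter.eventually_congr (Filter.Eventually.of_forall fun ω => ?_)
    have a := hp0 ω
    have b := hp1 ω
    have c1 : p ω ≤ 0 ↔ p ω = 0 := ⟨fun h => le_antisymm h a, fun h => h.le⟩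
    have c2 : 1 ≤ p ω ↔ 1 - p ω = 0 := ⟨fun h => by linarith, fun h => by linarith⟩
    by_cases h : p ω ∈ S <;> by_cases h' : 1 - p ω ∈ S <;> simp [h, h', c1, c2]
  have hL2 : MemLp (fun ω => - Real.logb 2 (q ω)) 2 μ := by
    rw [memLp_two_iff_integrable_sq hhm.aestronglyMeasurable]
    refine ⟨(hhm.pow_const 2).aestronglyMeasurable, ?_⟩
    rw [hasFiniteIntegral_iff_ofReal (Filter.Eventually.of_forall fun ω => sq_nonneg _)]
    rw [key (fun t => ENNReal.ofReal ((- Real.logb 2 t) ^ 2)) (hlm.pow_const 2).ennreal_ofReal]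
    have bd : ∀ t : ℝ, 0 ≤ t → t ≤ 1 → ENNReal.ofReal t * ENNReal.ofReal ((- Real.logb 2 t) ^ 2)
        ≤ ENNReal.ofReal (4 / Real.log 2 ^ 2) := by
      intro t h0 h1
      rw [← ENNReal.ofReal_mul h0]
      refine ENNReal.ofReal_le_ofReal ?_
      have := sq_log_aux t h0 h1
      rw [neg_sq, Real.logb, div_pow, ← mul_div_assoc]
      gcongr
    refine lt_of_le_of_lt (lintegral_mono fun ω => add_le_add (bd (p ω) (hp0 ω) (hp1 ω))
      (bd (1 - p ω) (by linarith [hp1 ω]) (by linarith [hp0 ω]))) ?_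
    simp
  have hbm : Measurable (fun ω => Real.binEntropy (p ω)) :=
    Real.binEntropy_continuous.measurable.comp hpm
  have hb0 : ∀ ω, 0 ≤ Real.binEntropy (p ω) := fun ω => Real.binEntropy_nonneg (hp0 ω) (hp1 ω)
  have hbi : Integrable (fun ω => Real.binEntropy (p ω)) μ := by
    refine Integrable.of_bound hbm.aestronglyMeasurable (Real.log 2)
      (Filter.Eventually.of_forall fun ω => ?_)
    rw [Real.norm_of_nonneg (hb0 ω)]
    exact Real.binEntropy_le_log_two
  have hH : ∫ ω, - Real.logb 2 (q ω) ∂μ = (∫ ω, Real.binEntropy (p ω) ∂μ) / Real.log 2 := by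
    rw [← integral_div, integral_eq_lintegral_of_nonneg_ae (Filter.Eventually.of_forall hh0)
      hhm.aestronglyMeasurable, integral_eq_lintegral_of_nonneg_ae
      (Filter.Eventually.of_forall fun ω => div_nonneg (hb0 ω) hl2.le)
      (hbm.div_const _).aestronglyMeasurable,
      key (fun t => ENNReal.ofReal (- Real.logb 2 t)) hlm.ennreal_ofReal]
    congr 1
    refine lintegral_congr fun ω => ?_
    have a := hp0 ω
    have b := hp1 ω
    have b' : 0 ≤ 1 - p ω := by linarith
    have n1 : 0 ≤ - Real.logb 2 (p ω) := by
      have := Real.logb_nonpos (b := 2) (by norm_num) a b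
      linarith
    have n2 : 0 ≤ - Real.logb 2 (1 - p ω) := by
      have := Real.logb_nonpos (b := 2) (by norm_num) b' (by linarith)
      linarith
    rw [← ENNReal.ofReal_mul a, ← ENNReal.ofReal_mul b',
      ← ENNReal.ofReal_add (mul_nonneg a n1) (mul_nonneg b' n2)]
    congr 1
    rw [Real.binEntropy_eq_negMulLog_add_negMulLog_one_sub, Real.negMulLog, Real.negMulLog,
      Real.logb, Real.logb]
    ring
  have B0 : ∀ ω, B ω = 0 ↔ p ω = 0 ∨ p ω = 1 := by
    intro ω
    have a := hp0 ω
    have b := hp1 ω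
    rw [hB']
    constructor
    · intro h
      rcases min_choice (p ω) (1 - p ω) with h' | h' <;> rw [h'] at h
      · exact Or.inl h
      · right; linarith
    · rintro (h | h) <;> simp [h]
  have B1 : ∀ ω, B ω = 1/2 ↔ p ω = 2⁻¹ := by
    intro ω
    rw [hB']
    constructor
    · intro h
      have h1 := min_le_left (p ω) (1 - p ω)
      have h2 := min_le_right (p ω) (1 - p ω)
      rw [h] at h1 h2
      norm_num at h1 h2 ⊢
      linarith
    · intro h; rw [h]; norm_num
  have i12 : ((∀ᵐ ω ∂μ, B ω = 0) ∨ (∀ᵐ ω ∂μ, B ω = 1/2)) ↔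
      (∫ ω, - Real.logb 2 (q ω) ∂μ) = 0 ∨ (∫ ω, - Real.logb 2 (q ω) ∂μ) = 1 := by
    refine or_congr ?_ ?_
    · rw [hH, div_eq_zero_iff, or_iff_left hl2.ne',
        integral_eq_zero_iff_of_nonneg hb0 hbi]
      refine Filter.eventually_congr (Filter.Eventually.of_forall fun ω => ?_)
      rw [B0]
      exact Real.binEntropy_eq_zero.symm
    · rw [hH, div_eq_one_iff_eq hl2.ne']
      have e : ∫ ω, (Real.log 2 - Real.binEntropy (p ω)) ∂μ
          = Real.log 2 - ∫ ω, Real.binEntropy (p ω) ∂μ := by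
        rw [integral_sub (integrable_const _) hbi]; simp
      have e2 : (∫ ω, Real.binEntropy (p ω) ∂μ = Real.log 2) ↔
          ∫ ω, (Real.log 2 - Real.binEntropy (p ω)) ∂μ = 0 := by
        rw [e, sub_eq_zero, eq_comm]
      rw [e2, integral_eq_zero_iff_of_nonneg
        (fun ω => sub_nonneg.2 Real.binEntropy_le_log_two) ((integrable_const _).sub hbi)]
      refine Filter.eventually_congr (Filter.Eventually.of_forall fun ω => ?_)
      rw [B1]
      change _ ↔ Real.log 2 - Real.binEntropy (p ω) = 0
      rw [sub_eq_zero, eq_comm (a := Real.log 2), Real.binEntropy_eq_log_two]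
  refine ⟨i12, i12.symm.trans ?_⟩
  have vc : ∀ c : ℝ, (∀ᵐ ω ∂μ, q ω ∈ ({c} : Set ℝ)) →
      variance (fun ω => - Real.logb 2 (q ω)) μ = 0 := by
    intro c hc
    rw [variance_congr (Y := fun _ => - Real.logb 2 c)
      (by filter_upwards [hc] with ω h; rw [Set.mem_singleton_iff.1 h])]
    rw [variance_eq_integral measurable_const.aemeasurable]
    simp
  constructor
  · rintro (h | h)
    · refine vc 1 ((trans _ (measurableSet_singleton _)).2 ?_)
      filter_upwards [h] with ω h
      rcases (B0 ω).1 h with h | h <;> simp [h]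
    · refine vc 2⁻¹ ((trans _ (measurableSet_singleton _)).2 ?_)
      filter_upwards [h] with ω h
      have := (B1 ω).1 h
      rw [this]
      norm_num
  · intro hv
    have hv' : evariance (fun ω => - Real.logb 2 (q ω)) μ = 0 := by
      rw [← hL2.ofReal_variance_eq, hv, ENNReal.ofReal_zero]
    rw [evariance_eq_zero_iff hhm.aemeasurable] at hv'
    set c := ∫ ω, - Real.logb 2 (q ω) ∂μ
    have hS : MeasurableSet {t : ℝ | - Real.logb 2 t = c} := hlm (measurableSet_singleton c)
    have hv2 := (trans _ hS).1 hv'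
    simp only [Set.mem_ofPred_eq] at hv2
    by_cases hc : c = 0
    · left
      filter_upwards [hv2] with ω h
      rw [B0]
      rcases h.1 with h | h
      · exact Or.inl h
      · rw [hc, neg_eq_zero, Real.logb_eq_zero] at h
        have := hp0 ω
        norm_num at h
        rcases h with h | h | h
        · exact Or.inl h
        · exact Or.inr h
        · linarith
    · right
      filter_upwards [hv2] with ω ⟨h1, h2⟩
      rw [B1]
      have a := hp0 ω
      have b := hp1 ω
      rcases h1 with h1 | h1
      · rw [h1] at h2; norm_num at h2; exact absurd h2.symm hc
      · rcases h2 with h2 | h2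
        · have : p ω = 1 := by linarith
          rw [this] at h1; norm_num at h1; exact absurd h1.symm hc
        · have n1 : p ω ≠ 0 := by
            intro h; rw [h] at h1; norm_num at h1; exact hc h1.symm
          have n2 : 1 - p ω ≠ 0 := by
            intro h; rw [h] at h2; norm_num at h2; exact hc h2.symm
          have := Real.logb_injOn_pos (b := 2) (by norm_num)
            (Set.mem_Ioi.2 (lt_of_le_of_ne a n1.symm))
            (Set.mem_Ioi.2 (lt_of_le_of_ne (by linarith) n2.symm))
            (by linarith : Real.logb 2 (p ω) = Real.logb 2 (1 - p ω))
          linarith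
end

section
/- Let (X1,Y1) and (X2,Y2) be BDEs on a common probability space such that the pair (X1,Y1) is independent of the pair (X2,Y2); set U1 := X1 + X2 (in 𝔽₂), U2 := X2, Ȳ := (Y1,Y2), and let A_i(ω) := κ_i(Y_i(ω))({0}) where κ_i is a regular conditional distribution of X_i given Y_i. Then almost surely a regular conditional distribution of U1 given Ȳ assigns the point {0} probability A1∗A2; and almost surely a regular conditional distribution of U2 given (U1,Ȳ) assigns {0} probability A1·A2/(A1∗A2) on the event {U1 = 0} and probability (1−A1)·A2/((1−A1)∗A2) on the event {U1 = 1} (the events where the relevant denominator vanishes have probability zero). -/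
open MeasureTheory ProbabilityTheory

/-- The convolution `p ∗ q = pq + (1-p)(1-q)`. -/
noncomputable def pstar (p q : ℝ) : ℝ := p * q + (1 - p) * (1 - q)

lemma polar_lintegral_single {Ω 𝒴 : Type*} [MeasurableSpace Ω] [MeasurableSpace 𝒴]
    (μ : Measure Ω) [IsProbabilityMeasure μ] (X : Ω → ZMod 2) (Y : Ω → 𝒴)
    (hX : Measurable X) (hY : Measurable Y) (g : ZMod 2 × 𝒴 → ENNReal) (hg : Measurable g) :
    ∫⁻ ω, g (X ω, Y ω) ∂μ = ∫⁻ ω, (g (0, Y ω) * condDistrib X Y μ (Y ω) {0}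
      + g (1, Y ω) * condDistrib X Y μ (Y ω) {1}) ∂μ := by
  have hg' : Measurable (fun p : 𝒴 × ZMod 2 => g (p.2, p.1)) := hg.comp measurable_swap
  have h1 : ∫⁻ ω, g (X ω, Y ω) ∂μ
      = ∫⁻ p, g (p.2, p.1) ∂(Measure.map (fun a => (Y a, X a)) μ) := by
    rw [lintegral_map hg' (hY.prodMk hX)]
  rw [h1, ← compProd_map_condDistrib hX.aemeasurable, Measure.lintegral_compProd hg',
    lintegral_map hg'.lintegral_kernel_prod_right' hY]
  refine lintegral_congr fun ω => ?_
  rw [lintegral_fintype]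
  exact Fin.sum_univ_two (fun x : Fin 2 =>
    g ((x : ZMod 2), Y ω) * (condDistrib X Y μ (Y ω)) {(x : ZMod 2)})

lemma polar_lintegral_indep {Ω α β : Type*} [MeasurableSpace Ω] [MeasurableSpace α]
    [MeasurableSpace β] (μ : Measure Ω) [IsProbabilityMeasure μ] (V : Ω → α) (W : Ω → β)
    (hV : Measurable V) (hW : Measurable W) (h : IndepFun V W μ)
    (F : α × β → ENNReal) (hF : Measurable F) :
    ∫⁻ ω, F (V ω, W ω) ∂μ = ∫⁻ ω, ∫⁻ ω', F (V ω, W ω') ∂μ ∂μ := by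
  have := (indepFun_iff_map_prod_eq_prod_map_map hV.aemeasurable hW.aemeasurable).1 h
  have h1 : ∫⁻ ω, F (V ω, W ω) ∂μ = ∫⁻ p, F p ∂(Measure.map (fun a => (V a, W a)) μ) := by
    rw [lintegral_map hF (hV.prodMk hW)]
  rw [h1, this, lintegral_prod _ hF.aemeasurable, lintegral_map hF.lintegral_prod_right' hV]
  refine lintegral_congr fun ω => ?_
  exact lintegral_map (f := fun y => F (V ω, y)) (hF.comp measurable_prodMk_left) hW

lemma polar_key {Ω 𝒴₁ 𝒴₂ : Type*} [MeasurableSpace Ω] [MeasurableSpace 𝒴₁] [MeasurableSpace 𝒴₂]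
    (μ : Measure Ω) [IsProbabilityMeasure μ]
    (X₁ X₂ : Ω → ZMod 2) (Y₁ : Ω → 𝒴₁) (Y₂ : Ω → 𝒴₂)
    (hX₁ : Measurable X₁) (hX₂ : Measurable X₂)
    (hY₁ : Measurable Y₁) (hY₂ : Measurable Y₂)
    (hindep : IndepFun (fun ω => (X₁ ω, Y₁ ω)) (fun ω => (X₂ ω, Y₂ ω)) μ)
    (k₁ : ZMod 2 → 𝒴₁ → ENNReal) (k₂ : ZMod 2 → 𝒴₂ → ENNReal)
    (hk₁ : ∀ a y, k₁ a y = condDistrib X₁ Y₁ μ y {a})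
    (hk₂ : ∀ a y, k₂ a y = condDistrib X₂ Y₂ μ y {a})
    (f : ZMod 2 → ZMod 2 → 𝒴₁ × 𝒴₂ → ENNReal) (hf : ∀ a b, Measurable (f a b)) :
    ∫⁻ ω, f (X₁ ω) (X₂ ω) (Y₁ ω, Y₂ ω) ∂μ = ∫⁻ ω,
      ((f 0 0 (Y₁ ω, Y₂ ω) * k₂ 0 (Y₂ ω) + f 0 1 (Y₁ ω, Y₂ ω) * k₂ 1 (Y₂ ω)) * k₁ 0 (Y₁ ω)
      + (f 1 0 (Y₁ ω, Y₂ ω) * k₂ 0 (Y₂ ω) + f 1 1 (Y₁ ω, Y₂ ω) * k₂ 1 (Y₂ ω)) * k₁ 1 (Y₁ ω))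
      ∂μ := by
  have mk₁ : ∀ a, Measurable (k₁ a) := fun a => by
    rw [funext (hk₁ a)]; exact Kernel.measurable_coe _ (measurableSet_singleton a)
  have mk₂ : ∀ a, Measurable (k₂ a) := fun a => by
    rw [funext (hk₂ a)]; exact Kernel.measurable_coe _ (measurableSet_singleton a)
  have hF : Measurable (fun p : (ZMod 2 × 𝒴₁) × (ZMod 2 × 𝒴₂) =>
      f p.1.1 p.2.1 (p.1.2, p.2.2)) := by
    have h0 : Measurable (fun q : ZMod 2 × (ZMod 2 × (𝒴₁ × 𝒴₂)) => f q.1 q.2.1 q.2.2) :=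
      measurable_from_prod_countable_right fun a =>
        measurable_from_prod_countable_right fun b => hf a b
    exact h0.comp (g := fun q : ZMod 2 × (ZMod 2 × (𝒴₁ × 𝒴₂)) => f q.1 q.2.1 q.2.2)
      (f := fun p : (ZMod 2 × 𝒴₁) × (ZMod 2 × 𝒴₂) => (p.1.1, (p.2.1, (p.1.2, p.2.2))))
      (by fun_prop)
  have hiY : IndepFun Y₁ Y₂ μ := hindep.comp measurable_snd measurable_snd
  have e1 := polar_lintegral_indep μ _ _ (hX₁.prodMk hY₁) (hX₂.prodMk hY₂) hindep _ hF
  -- the inner integral, as a function of the first pair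
  let G : ZMod 2 × 𝒴₁ → 𝒴₂ → ENNReal := fun z y₂ =>
    f z.1 0 (z.2, y₂) * k₂ 0 y₂ + f z.1 1 (z.2, y₂) * k₂ 1 y₂
  have hGm : ∀ a, Measurable (fun p : 𝒴₁ × 𝒴₂ => G (a, p.1) p.2) := fun a =>
    ((hf a 0).mul ((mk₂ 0).comp measurable_snd)).add
      ((hf a 1).mul ((mk₂ 1).comp measurable_snd))
  have e2 : ∀ z : ZMod 2 × 𝒴₁, ∫⁻ ω', f z.1 (X₂ ω') (z.2, Y₂ ω') ∂μ
      = ∫⁻ ω', G z (Y₂ ω') ∂μ := fun z => by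
    have := polar_lintegral_single μ X₂ Y₂ hX₂ hY₂ (fun q => f z.1 q.1 (z.2, q.2))
      (hF.comp measurable_prodMk_left)
    simp only [← hk₂] at this
    exact this
  have hI : ∀ a, Measurable (fun y₁ => ∫⁻ ω', G (a, y₁) (Y₂ ω') ∂μ) := fun a =>
    Measurable.lintegral_prod_right'
      (f := fun p : 𝒴₁ × Ω => G (a, p.1) (Y₂ p.2))
      ((hGm a).comp (measurable_fst.prodMk (hY₂.comp measurable_snd)))
  have e3 := polar_lintegral_single μ X₁ Y₁ hX₁ hY₁ (fun z => ∫⁻ ω', G z (Y₂ ω') ∂μ)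
    (measurable_from_prod_countable_right hI)
  simp only [← hk₁] at e3
  have e4 := polar_lintegral_indep μ Y₁ Y₂ hY₁ hY₂ hiY
    (fun p => G (0, p.1) p.2 * k₁ 0 p.1 + G (1, p.1) p.2 * k₁ 1 p.1)
    (((hGm 0).mul ((mk₁ 0).comp measurable_fst)).add
      ((hGm 1).mul ((mk₁ 1).comp measurable_fst)))
  refine e1.trans (Eq.trans ?_ e4.symm)
  refine ((lintegral_congr fun ω => e2 (X₁ ω, Y₁ ω)).trans e3).trans ?_
  refine lintegral_congr fun ω => ?_
  have m : ∀ a, Measurable (fun ω' => G (a, Y₁ ω) (Y₂ ω')) := fun a =>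
    (hGm a).comp (measurable_const.prodMk hY₂)
  dsimp only
  rw [lintegral_add_left ((m 0).mul_const _), lintegral_mul_const _ (m 0),
    lintegral_mul_const _ (m 1)]

lemma polar_ae {Ω γ : Type*} [MeasurableSpace Ω] [MeasurableSpace γ]
    (μ : Measure Ω) [IsProbabilityMeasure μ] (U : Ω → ZMod 2) (Z : Ω → γ)
    (hU : Measurable U) (hZ : Measurable Z) (g : γ → ENNReal) (hg : Measurable g)
    (h : ∀ S : Set γ, MeasurableSet S →
      ∫⁻ ω, S.indicator 1 (Z ω) * ({0} : Set (ZMod 2)).indicator 1 (U ω) ∂μ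
        = ∫⁻ ω, S.indicator 1 (Z ω) * g (Z ω) ∂μ) :
    ∀ᵐ ω ∂μ, condDistrib U Z μ (Z ω) {0} = g (Z ω) := by
  have h0 : MeasurableSet ({0} : Set (ZMod 2)) := measurableSet_singleton 0
  have hm : Measurable (fun z => condDistrib U Z μ z {0}) := Kernel.measurable_coe _ h0
  have key : (fun z => condDistrib U Z μ z {0}) =ᵐ[μ.map Z] g := by
    have : IsProbabilityMeasure (μ.map Z) := Measure.isProbabilityMeasure_map hZ.aemeasurable
    refine ae_eq_of_forall_setLIntegral_eq_of_sigmaFinite hm hg fun S hS _ => ?_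
    rw [setLIntegral_map hS hm hZ, setLIntegral_map hS hg hZ,
      setLIntegral_preimage_condDistrib hZ hU.aemeasurable h0 hS,
      ← lintegral_indicator (hZ hS), ← lintegral_indicator_one ((hZ hS).inter (hU h0))]
    refine Eq.trans ?_ ((h S hS).trans ?_)
    · refine lintegral_congr fun ω => ?_
      by_cases h1 : Z ω ∈ S <;> by_cases h2 : U ω = 0 <;> simp [Set.indicator, h1, h2]
    · refine lintegral_congr fun ω => ?_
      by_cases h1 : Z ω ∈ S <;> simp [Set.indicator, h1]
  exact ae_of_ae_map hZ.aemeasurable key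

/-- Evolution of the `α`-parameters under the polar transform: almost surely, a regular
conditional distribution of `U₁ = X₁ + X₂` given `Ȳ = (Y₁,Y₂)` assigns `{0}` probability
`A₁ ∗ A₂`, and a regular conditional distribution of `U₂ = X₂` given `(U₁, Ȳ)` assigns `{0}`
probability `A₁A₂/(A₁∗A₂)` on `{U₁ = 0}` and `(1-A₁)A₂/((1-A₁)∗A₂)` on `{U₁ = 1}`,
the events where the relevant denominator vanishes having probability zero. -/
theorem alpha_evolution_polar_transform
    {Ω 𝒴₁ 𝒴₂ : Type*} [MeasurableSpace Ω] [MeasurableSpace 𝒴₁] [MeasurableSpace 𝒴₂]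
    (μ : Measure Ω) [IsProbabilityMeasure μ]
    (X₁ X₂ : Ω → ZMod 2) (Y₁ : Ω → 𝒴₁) (Y₂ : Ω → 𝒴₂)
    (hX₁ : Measurable X₁) (hX₂ : Measurable X₂)
    (hY₁ : Measurable Y₁) (hY₂ : Measurable Y₂)
    (hindep : IndepFun (fun ω => (X₁ ω, Y₁ ω)) (fun ω => (X₂ ω, Y₂ ω)) μ)
    (A₁ A₂ : Ω → ℝ)
    (hA₁ : ∀ ω, A₁ ω = ((condDistrib X₁ Y₁ μ (Y₁ ω)) {0}).toReal)
    (hA₂ : ∀ ω, A₂ ω = ((condDistrib X₂ Y₂ μ (Y₂ ω)) {0}).toReal) :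
    (∀ᵐ ω ∂μ,
      ((condDistrib (fun ω' => X₁ ω' + X₂ ω') (fun ω' => (Y₁ ω', Y₂ ω')) μ
          ((Y₁ ω, Y₂ ω))) {0}).toReal = pstar (A₁ ω) (A₂ ω))
    ∧ (∀ᵐ ω ∂μ,
      ((condDistrib X₂ (fun ω' => (X₁ ω' + X₂ ω', (Y₁ ω', Y₂ ω'))) μ
          ((X₁ ω + X₂ ω, (Y₁ ω, Y₂ ω)))) {0}).toReal
        = if X₁ ω + X₂ ω = 0 then A₁ ω * A₂ ω / pstar (A₁ ω) (A₂ ω)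
          else (1 - A₁ ω) * A₂ ω / pstar (1 - A₁ ω) (A₂ ω))
    ∧ (∀ᵐ ω ∂μ, (X₁ ω + X₂ ω = 0 → pstar (A₁ ω) (A₂ ω) ≠ 0)
        ∧ (X₁ ω + X₂ ω = 1 → pstar (1 - A₁ ω) (A₂ ω) ≠ 0)) := by
  classical
  let k₁ : ZMod 2 → 𝒴₁ → ENNReal := fun a y => condDistrib X₁ Y₁ μ y {a}
  let k₂ : ZMod 2 → 𝒴₂ → ENNReal := fun a y => condDistrib X₂ Y₂ μ y {a}
  have mk₁ : ∀ a, Measurable (k₁ a) := fun a =>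
    Kernel.measurable_coe _ (measurableSet_singleton a)
  have mk₂ : ∀ a, Measurable (k₂ a) := fun a =>
    Kernel.measurable_coe _ (measurableSet_singleton a)
  have fin₁ : ∀ a y, k₁ a y ≠ ⊤ := fun a y => measure_ne_top _ _
  have fin₂ : ∀ a y, k₂ a y ≠ ⊤ := fun a y => measure_ne_top _ _
  have z01 : ∀ a : ZMod 2, a = 0 ∨ a = 1 := by decide
  have n10 : (1 : ZMod 2) ≠ 0 := by decide
  have s11 : (1 : ZMod 2) + 1 = 0 := by decide
  have one (ν : Measure (ZMod 2)) [IsProbabilityMeasure ν] :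
      (ν {1}).toReal = 1 - (ν {0}).toReal := by
    have hc : ({1} : Set (ZMod 2)) = {0}ᶜ := by
      ext a; rcases z01 a with rfl | rfl <;> simp
    rw [hc]
    exact probReal_compl_eq_one_sub (measurableSet_singleton 0)
  have a₁ : ∀ ω, (k₁ 0 (Y₁ ω)).toReal = A₁ ω := fun ω => (hA₁ ω).symm
  have a₂ : ∀ ω, (k₂ 0 (Y₂ ω)).toReal = A₂ ω := fun ω => (hA₂ ω).symm
  have b₁ : ∀ ω, (k₁ 1 (Y₁ ω)).toReal = 1 - A₁ ω := fun ω => by rw [hA₁ ω]; exact one _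
  have b₂ : ∀ ω, (k₂ 1 (Y₂ ω)).toReal = 1 - A₂ ω := fun ω => by rw [hA₂ ω]; exact one _
  have key := polar_key μ X₁ X₂ Y₁ Y₂ hX₁ hX₂ hY₁ hY₂ hindep k₁ k₂
    (fun _ _ => rfl) (fun _ _ => rfl)
  -- the joint weight of `U₁ = u`
  let D : ZMod 2 → 𝒴₁ × 𝒴₂ → ENNReal := fun u y =>
    k₁ u y.1 * k₂ 0 y.2 + k₁ (u + 1) y.1 * k₂ 1 y.2
  let N : ZMod 2 → 𝒴₁ × 𝒴₂ → ENNReal := fun u y => k₁ u y.1 * k₂ 0 y.2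
  have mN : ∀ u, Measurable (N u) := fun u =>
    ((mk₁ u).comp measurable_fst).mul ((mk₂ 0).comp measurable_snd)
  have mD : ∀ u, Measurable (D u) := fun u =>
    (mN u).add (((mk₁ (u + 1)).comp measurable_fst).mul ((mk₂ 1).comp measurable_snd))
  have fN₁ : ∀ a b y₁ y₂, k₁ a y₁ * k₂ b y₂ ≠ ⊤ := fun a b y₁ y₂ =>
    ENNReal.mul_ne_top (fin₁ _ _) (fin₂ _ _)
  have fD : ∀ u y, D u y ≠ ⊤ := fun u y => ENNReal.add_ne_top.2 ⟨fN₁ _ _ _ _, fN₁ _ _ _ _⟩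
  have gD : ∀ u y, N u y / D u y * D u y = N u y := fun u y =>
    ENNReal.div_mul_cancel' (fun h => (add_eq_zero.1 h).1) (fun h => absurd h (fD u y))
  have D0 : ∀ ω, (D 0 (Y₁ ω, Y₂ ω)).toReal = pstar (A₁ ω) (A₂ ω) := fun ω => by
    simp only [D, zero_add]
    rw [ENNReal.toReal_add (fN₁ _ _ _ _) (fN₁ _ _ _ _), ENNReal.toReal_mul, ENNReal.toReal_mul,
      a₁, a₂, b₁, b₂, pstar]
  have D1 : ∀ ω, (D 1 (Y₁ ω, Y₂ ω)).toReal = pstar (1 - A₁ ω) (A₂ ω) := fun ω => by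
    simp only [D, s11]
    rw [ENNReal.toReal_add (fN₁ _ _ _ _) (fN₁ _ _ _ _), ENNReal.toReal_mul, ENNReal.toReal_mul,
      a₁, a₂, b₁, b₂, pstar]
    ring
  -- change of variables for functions of `U₁` and the observations
  have keyU : ∀ φ : ZMod 2 → 𝒴₁ × 𝒴₂ → ENNReal, (∀ u, Measurable (φ u)) →
      ∫⁻ ω, φ (X₁ ω + X₂ ω) (Y₁ ω, Y₂ ω) ∂μ
        = ∫⁻ ω, (φ 0 (Y₁ ω, Y₂ ω) * D 0 (Y₁ ω, Y₂ ω)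
          + φ 1 (Y₁ ω, Y₂ ω) * D 1 (Y₁ ω, Y₂ ω)) ∂μ := fun φ hφ => by
    rw [key (fun a b => φ (a + b)) (fun a b => hφ _)]
    refine lintegral_congr fun ω => ?_
    simp only [D, s11, add_zero, zero_add]
    ring
  have hU : Measurable (fun ω => X₁ ω + X₂ ω) := hX₁.add hX₂
  have hY : Measurable (fun ω => (Y₁ ω, Y₂ ω)) := hY₁.prodMk hY₂
  have p3 : ∀ᵐ ω ∂μ, D (X₁ ω + X₂ ω) (Y₁ ω, Y₂ ω) ≠ 0 := by
    have mS : ∀ u, MeasurableSet {y | D u y = 0} := fun u =>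
      (mD u) (measurableSet_singleton 0)
    have h := keyU (fun u => {y | D u y = 0}.indicator 1) (fun u => measurable_one.indicator (mS u))
    have hz : ∀ u y, ({y | D u y = 0}.indicator 1 y : ENNReal) * D u y = 0 := fun u y => by
      by_cases hy : D u y = 0 <;> simp [hy]
    simp only [hz, add_zero, lintegral_zero] at h
    have hmeas : Measurable (fun q : ZMod 2 × (𝒴₁ × 𝒴₂) =>
        ({y | D q.1 y = 0}.indicator 1 q.2 : ENNReal)) :=
      measurable_from_prod_countable_right fun u => measurable_one.indicator (mS u)
    have h' := (lintegral_eq_zero_iff (hmeas.comp (hU.prodMk hY))).1 h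
    filter_upwards [h'] with ω hω hc
    simp [hc] at hω
  refine ⟨?_, ?_, ?_⟩
  · have h := polar_ae μ (fun ω => X₁ ω + X₂ ω) (fun ω => (Y₁ ω, Y₂ ω)) hU hY (D 0) (mD 0)
      (fun S hS => by
        rw [keyU (fun u y => S.indicator 1 y * ({0} : Set (ZMod 2)).indicator 1 u)
          (fun u => (measurable_one.indicator hS).mul_const _)]
        refine lintegral_congr fun ω => ?_
        simp)
    filter_upwards [h] with ω hω
    rw [hω, D0]
  · have mg : Measurable (fun q : ZMod 2 × (𝒴₁ × 𝒴₂) => N q.1 q.2 / D q.1 q.2) :=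
      measurable_from_prod_countable_right fun u => (mN u).div (mD u)
    have h := polar_ae μ X₂ (fun ω => (X₁ ω + X₂ ω, (Y₁ ω, Y₂ ω))) hX₂ (hU.prodMk hY)
      (fun q => N q.1 q.2 / D q.1 q.2) mg
      (fun S hS => by
        have mS : ∀ u, Measurable (fun y : 𝒴₁ × 𝒴₂ => (S.indicator 1 (u, y) : ENNReal)) :=
          fun u => (measurable_one.indicator hS).comp measurable_prodMk_left
        rw [keyU (fun u y => S.indicator 1 (u, y) * (N u y / D u y))
          (fun u => (mS u).mul ((mN u).div (mD u))),
          key (fun a b y => S.indicator 1 (a + b, y) * ({0} : Set (ZMod 2)).indicator 1 b)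
          (fun a b => (mS _).mul_const _)]
        refine lintegral_congr fun ω => ?_
        simp only [mul_assoc, gD]
        simp [N]
        ring)
    filter_upwards [h] with ω hω
    rw [hω]
    rcases z01 (X₁ ω + X₂ ω) with hu | hu
    · simp only [hu, if_true]
      rw [ENNReal.toReal_div, D0]
      simp only [N, ENNReal.toReal_mul, a₁, a₂]
    · simp only [hu, n10, if_false]
      rw [ENNReal.toReal_div, D1]
      simp only [N, ENNReal.toReal_mul, b₁, a₂]
  · filter_upwards [p3] with ω hω
    refine ⟨fun hu => ?_, fun hu => ?_⟩
    · rw [hu] at hω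
      rw [← D0]
      exact ENNReal.toReal_ne_zero.2 ⟨hω, fD _ _⟩
    · rw [hu] at hω
      rw [← D1]
      exact ENNReal.toReal_ne_zero.2 ⟨hω, fD _ _⟩
end

section
/- For all p, q ∈ [0,1], f(p,q) ≥ 0, and f(p,q) = 0 if and only if p ∈ {0, 1/2, 1} or q ∈ {0, 1/2, 1}. -/
open Real

/-- The binary entropy function `ℋ(p) = -p log₂ p - (1-p) log₂ (1-p)`
(with the convention `0 · log 0 = 0`, automatic since `Real.logb 2 0 = 0`). -/
noncomputable def binH (p : ℝ) : ℝ := -(p * Real.logb 2 p) - (1 - p) * Real.logb 2 (1 - p)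

/-- The function `f(p,q)` whose expectation gives the conditional-covariance part of the
covariance of the output entropy random variables of the polar transform. Division by zero
yields `0` in Lean, and `Real.logb 2 0 = 0`, which implements the stated conventions. -/
noncomputable def fpq (p q : ℝ) : ℝ :=
  (pstar p q) * (pstar p (1 - q)) * Real.logb 2 ((pstar p q) / (pstar p (1 - q)))
    * (binH (p * (1 - q) / pstar p (1 - q)) - binH (p * q / pstar p q))

lemma binH_eq (x : ℝ) : binH x = Real.binEntropy x / Real.log 2 := by
  rw [Real.binEntropy_eq_negMulLog_add_negMulLog_one_sub]
  unfold binH Real.negMulLog Real.logb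
  ring

lemma binH_symm (x : ℝ) : binH (1 - x) = binH x := by
  unfold binH
  rw [sub_sub_cancel]
  ring

lemma binH_zero : binH 0 = 0 := by simp [binH]

lemma binH_one : binH 1 = 0 := by simp [binH]

lemma binH_div_self (x : ℝ) : binH (x / x) = 0 := by
  by_cases h : x = 0
  · simp [h, binH_zero]
  · rw [div_self h, binH_one]

lemma binH_lt_half {x y : ℝ} (hx : 0 ≤ x) (hxy : x < y) (hy : y ≤ 1 / 2) :
    binH x < binH y := by
  rw [binH_eq, binH_eq]
  have hl : 0 < Real.log 2 := Real.log_pos (by norm_num)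
  apply div_lt_div_of_pos_right _ hl
  apply Real.binEntropy_strictMonoOn _ _ hxy
  · constructor <;> norm_num at * <;> linarith
  · constructor <;> norm_num at * <;> linarith

lemma exists_half_s7 {x : ℝ} (h0 : 0 ≤ x) (h1 : x ≤ 1) :
    ∃ y, 0 ≤ y ∧ y ≤ 1 / 2 ∧ binH y = binH x ∧ y * (1 - y) = x * (1 - x) := by
  rcases le_total x (1 / 2) with h | h
  · exact ⟨x, h0, h, rfl, rfl⟩
  · exact ⟨1 - x, by linarith, by linarith, binH_symm x, by ring⟩

lemma binH_lt {x y : ℝ} (hx0 : 0 ≤ x) (hx1 : x ≤ 1) (hy0 : 0 ≤ y) (hy1 : y ≤ 1)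
    (h : x * (1 - x) < y * (1 - y)) : binH x < binH y := by
  obtain ⟨a, ha0, ha1, hae, ham⟩ := exists_half_s7 hx0 hx1
  obtain ⟨b, hb0, hb1, hbe, hbm⟩ := exists_half_s7 hy0 hy1
  rw [← hae, ← hbe]
  rw [← ham, ← hbm] at h
  apply binH_lt_half ha0 _ hb1
  by_contra hc
  push Not at hc
  nlinarith

lemma binH_div_lt {u v u' v' : ℝ} (hu : 0 < u) (hv : 0 < v) (hu' : 0 < u') (hv' : 0 < v')
    (he : u * v = u' * v') (h : u' + v' < u + v) :
    binH (u / (u + v)) < binH (u' / (u' + v')) := by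
  have hs : 0 < u + v := by positivity
  have hs' : 0 < u' + v' := by positivity
  apply binH_lt (by positivity) ((div_le_one hs).2 (by linarith)) (by positivity)
    ((div_le_one hs').2 (by linarith))
  have e1 : u / (u + v) * (1 - u / (u + v)) = u * v / (u + v) ^ 2 := by
    field_simp
    ring
  have e2 : u' / (u' + v') * (1 - u' / (u' + v')) = u * v / (u' + v') ^ 2 := by
    rw [he]
    field_simp
    ring
  rw [e1, e2]
  apply div_lt_div_of_pos_left (by positivity) (by positivity)
  gcongr

lemma fpq_pos {p q : ℝ} (hp0 : 0 < p) (hp1 : p < 1) (hq0 : 0 < q) (hq1 : q < 1)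
    (hp : p ≠ 1 / 2) (hq : q ≠ 1 / 2) : 0 < fpq p q := by
  have hp1' : 0 < 1 - p := by linarith
  have hq1' : 0 < 1 - q := by linarith
  have a1 := mul_pos hp0 hq0
  have a2 := mul_pos hp1' hq1'
  have a3 := mul_pos hp0 hq1'
  have a4 := mul_pos hp1' hq0
  have e : p * q * ((1 - p) * (1 - q)) = p * (1 - q) * ((1 - p) * q) := by ring
  have hne : p * q + (1 - p) * (1 - q) ≠ p * (1 - q) + (1 - p) * q := by
    intro h
    have h2 : (p - 1 / 2) * (q - 1 / 2) = 0 := by linarith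
    rcases mul_eq_zero.1 h2 with h3 | h3
    · exact hp (by linarith)
    · exact hq (by linarith)
  unfold fpq pstar
  rw [sub_sub_cancel]
  rcases lt_or_gt_of_ne hne with h | h
  · have k := binH_div_lt a3 a4 a1 a2 e.symm h
    have l : Real.logb 2 ((p * q + (1 - p) * (1 - q)) / (p * (1 - q) + (1 - p) * q)) < 0 :=
      Real.logb_neg (by norm_num) (by positivity) ((div_lt_one (by positivity)).2 h)
    apply mul_pos_of_neg_of_neg _ (by linarith)
    exact mul_neg_of_pos_of_neg (by positivity) l
  · have k := binH_div_lt a1 a2 a3 a4 e h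
    have l : 0 < Real.logb 2 ((p * q + (1 - p) * (1 - q)) / (p * (1 - q) + (1 - p) * q)) :=
      Real.logb_pos (by norm_num) ((one_lt_div (by positivity)).2 h)
    apply mul_pos _ (by linarith)
    exact mul_pos (by positivity) l

lemma logb_div_self (x : ℝ) : Real.logb 2 (x / x) = 0 := by
  by_cases h : x = 0
  · simp [h]
  · rw [div_self h, Real.logb_one]

lemma fpq_eq_zero {p q : ℝ}
    (h : p ∈ ({0, 1/2, 1} : Set ℝ) ∨ q ∈ ({0, 1/2, 1} : Set ℝ)) : fpq p q = 0 := by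
  simp only [Set.mem_insert_iff, Set.mem_singleton_iff] at h
  rcases h with (h | h | h) | (h | h | h)
  · subst h; simp [fpq, pstar]
  · have e : pstar p q = pstar p (1 - q) := by subst h; unfold pstar; ring
    unfold fpq; rw [e, logb_div_self]; ring
  · subst h; simp [fpq, pstar, binH_div_self]
  · subst h; simp [fpq, pstar, binH_div_self, binH_zero]
  · have e : pstar p q = pstar p (1 - q) := by subst h; unfold pstar; ring
    unfold fpq; rw [e, logb_div_self]; ring
  · subst h; simp [fpq, pstar, binH_div_self, binH_zero]

/-- For `p, q ∈ [0,1]`, `f(p,q) ≥ 0`, with equality iff `p ∈ {0,1/2,1}` or `q ∈ {0,1/2,1}`. -/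
theorem fpq_nonneg_and_eq_zero_iff
    (p q : ℝ) (hp : p ∈ Set.Icc (0:ℝ) 1) (hq : q ∈ Set.Icc (0:ℝ) 1) :
    0 ≤ fpq p q
    ∧ (fpq p q = 0 ↔ p ∈ ({0, 1/2, 1} : Set ℝ) ∨ q ∈ ({0, 1/2, 1} : Set ℝ)) := by
  by_cases h : p ∈ ({0, 1/2, 1} : Set ℝ) ∨ q ∈ ({0, 1/2, 1} : Set ℝ)
  · have := fpq_eq_zero h
    exact ⟨this.ge, fun _ => h, fun _ => this⟩
  · have h' := h
    simp only [Set.mem_insert_iff, Set.mem_singleton_iff, not_or] at h'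
    obtain ⟨⟨p0, p2, p1⟩, q0, q2, q1⟩ := h'
    have := fpq_pos (lt_of_le_of_ne hp.1 (Ne.symm p0)) (lt_of_le_of_ne hp.2 p1)
      (lt_of_le_of_ne hq.1 (Ne.symm q0)) (lt_of_le_of_ne hq.2 q1) p2 q2
    exact ⟨this.le, fun e => absurd e this.ne', fun e => absurd e h⟩
end
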